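/- arXiv:1303.3449 — 2 statements merged into one kernel-verified Lean document; each statement's English description precedes it below -/
import Mathlib

section
/- Let q > 2 be a prime power and n > 1, 1 ≤ d < n integers with n ≥ 2d + 2·(|P_d| + 1). Then there exists at least one α ∈ 𝔽_{q^n} of degree n over 𝔽_q such that q − 1 divides the index [𝔽_{q^n}^× : H_α], where H_α is the subgroup of 𝔽_{q^n}^× generated by {g(α) : g ∈ P_d}. In particular, for such α the Cayley graph G_d(n,q,α) is not connected (H_α ≠ 𝔽_{q^n}^×). -/
open Polynomial

/-- A polynomial is primary if it is a positive power of a monic irreducible polynomial. -/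
def IsPrimaryPoly {F : Type*} [Field F] (g : Polynomial F) : Prop :=
  ∃ p : Polynomial F, p.Monic ∧ Irreducible p ∧ ∃ e : ℕ, 0 < e ∧ g = p ^ e

/-- `primarySet F d` is the set `P_d` of monic primary polynomials of degree `d` over `F`. -/
def primarySet (F : Type*) [Field F] (d : ℕ) : Set (Polynomial F) :=
  {g | g.Monic ∧ g.natDegree = d ∧ IsPrimaryPoly g}



theorem kummer_coprime {k : Type*} [Field k] {e : ℕ} (he : 0 < e) (ζ : k)
    (hζ : IsPrimitiveRoot ζ e) (u : k) (hu : u ≠ 0)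
    (hpow : ∀ l : ℕ, l.Prime → l ∣ e → ∀ b : k, b ^ l ≠ u) (P : k[X]) (hP : P ≠ 0)
    (hdeg : P.natDegree < e) : IsCoprime (X ^ e - C u) P := by
  rw [Polynomial.isCoprime_iff_aeval_ne_zero_of_isAlgClosed k (AlgebraicClosure k)]
  intro y
  by_contra! hcon
  obtain ⟨h1, h2⟩ := hcon
  have hy : y ^ e = algebraMap k (AlgebraicClosure k) u := by
    simpa [sub_eq_zero] using h1
  have hy0 : y ≠ 0 := by
    rintro rfl
    rw [zero_pow he.ne'] at hy
    exact hu ((map_eq_zero _).1 hy.symm)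
  have hinteg : IsIntegral k y := Algebra.IsIntegral.isIntegral y
  set μ := minpoly k y with hμ
  have hδ : μ.natDegree < e :=
    lt_of_le_of_lt (natDegree_le_of_dvd (minpoly.dvd k y h2) hP) hdeg
  have hδ0 : 0 < μ.natDegree := minpoly.natDegree_pos hinteg
  have hsplit : (μ.map (algebraMap k (AlgebraicClosure k))).Splits := IsAlgClosed.splits _
  have hmon : (μ.map (algebraMap k (AlgebraicClosure k))).Monic := (minpoly.monic hinteg).map _
  -- each root is a root of unity times y
  have hroot : ∀ r ∈ (μ.map (algebraMap k (AlgebraicClosure k))).roots,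
      ∃ c : k, r = algebraMap k (AlgebraicClosure k) c * y := by
    intro r hr
    have hr1 : aeval r μ = 0 := by
      have := (mem_roots'.1 hr).2
      simpa [IsRoot, eval_map_algebraMap] using this
    have hr2 : aeval r (X ^ e - C u : k[X]) = 0 := by
      obtain ⟨w, hw⟩ := minpoly.dvd k y h1
      rw [hw, map_mul, hr1, zero_mul]
    have hr3 : r ^ e = algebraMap k (AlgebraicClosure k) u := by
      simpa [sub_eq_zero] using hr2
    have hr4 : (r / y) ^ e = 1 := by
      rw [div_pow, hr3, ← hy, div_self (pow_ne_zero _ hy0)]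
    have hζ' : IsPrimitiveRoot (algebraMap k (AlgebraicClosure k) ζ) e :=
      hζ.map_of_injective (algebraMap k (AlgebraicClosure k)).injective
    have : NeZero e := ⟨he.ne'⟩
    obtain ⟨i, _, hi⟩ := hζ'.eq_pow_of_pow_eq_one hr4
    refine ⟨ζ ^ i, ?_⟩
    rw [map_pow, hi, div_mul_cancel₀ _ hy0]
  have hprod : ∀ s : Multiset (AlgebraicClosure k),
      (∀ r ∈ s, ∃ c : k, r = algebraMap k (AlgebraicClosure k) c * y) →
      ∃ c : k, s.prod = algebraMap k (AlgebraicClosure k) c * y ^ (Multiset.card s) := by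
    intro s
    induction s using Multiset.induction_on with
    | empty => intro _; exact ⟨1, by simp⟩
    | cons a s ih =>
      intro h
      obtain ⟨c, hc⟩ := ih (fun r hr => h r (Multiset.mem_cons_of_mem hr))
      obtain ⟨c', hc'⟩ := h a (Multiset.mem_cons_self a s)
      refine ⟨c' * c, ?_⟩
      rw [Multiset.prod_cons, hc, hc', Multiset.card_cons, pow_succ, map_mul]; ring
  obtain ⟨c, hc⟩ := hprod _ hroot
  have hcard : Multiset.card (μ.map (algebraMap k (AlgebraicClosure k))).roots = μ.natDegree := by
    rw [← hsplit.natDegree_eq_card_roots, natDegree_map]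
  have hcoef := hsplit.coeff_zero_eq_prod_roots_of_monic hmon
  rw [hc, hcard, coeff_map] at hcoef
  have hμ0 : μ.coeff 0 ≠ 0 := by
    rw [hμ]; exact minpoly.coeff_zero_ne_zero hinteg hy0
  have hc0 : c ≠ 0 := by
    rintro rfl
    simp at hcoef
    exact hμ0 hcoef
  -- y ^ δ ∈ k
  set K0 : Subfield (AlgebraicClosure k) := (algebraMap k (AlgebraicClosure k)).fieldRange with hK0
  have hmemδ : y ^ μ.natDegree ∈ K0 := by
    refine ⟨(-1) ^ (μ.natDegree) * μ.coeff 0 / c, ?_⟩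
    have hc0' : algebraMap k (AlgebraicClosure k) c ≠ 0 := by simpa using hc0
    rw [map_div₀, map_mul, hcoef, div_eq_iff hc0']
    rw [natDegree_map, map_pow, map_neg, map_one, ← mul_assoc, ← mul_pow]
    simp [mul_comm]
  have hmeme : y ^ e ∈ K0 := ⟨u, hy.symm⟩
  set g := Nat.gcd μ.natDegree e with hg
  have hg0 : 0 < g := Nat.gcd_pos_of_pos_left _ hδ0
  have hge : g < e := lt_of_le_of_lt (Nat.gcd_le_left _ hδ0) hδ
  have hmemg : y ^ g ∈ K0 := by
    have hb := Nat.gcd_eq_gcd_ab μ.natDegree e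
    have : y ^ g = (y ^ μ.natDegree) ^ (Nat.gcdA μ.natDegree e) * (y ^ e) ^ (Nat.gcdB μ.natDegree e) := by
      rw [← zpow_natCast, ← zpow_natCast, ← zpow_natCast, ← zpow_mul, ← zpow_mul, ← zpow_add₀ hy0, ← hb]
    rw [this]
    exact K0.mul_mem (zpow_mem hmemδ _) (zpow_mem hmeme _)
  obtain ⟨w, hw⟩ : g ∣ e := Nat.gcd_dvd_right _ _
  have hw1 : w ≠ 1 := by rintro rfl; omega
  obtain ⟨l, hl, v, hv⟩ := Nat.exists_prime_and_dvd hw1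
  obtain ⟨b, hb⟩ : (y ^ g) ^ v ∈ K0 := pow_mem hmemg v
  refine hpow l hl ⟨g * v, by rw [hw, hv]; ring⟩ b ?_
  apply (algebraMap k (AlgebraicClosure k)).injective
  rw [map_pow, hb, ← hy, ← pow_mul, ← pow_mul, hw, hv]
  congr 1; ring

theorem hasse_dvd {K : Type*} [CommRing K] (h k : K[X]) (s l : ℕ) :
    h ^ (s - l) ∣ hasseDeriv l (h ^ s * k) := by
  induction s generalizing l with
  | zero => simp
  | succ s ih =>
    rw [pow_succ', mul_assoc, hasseDeriv_mul]
    refine Finset.dvd_sum fun ij hij => ?_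
    rw [Finset.HasAntidiagonal.mem_antidiagonal] at hij
    obtain ⟨a, b⟩ := ij
    simp only at hij ⊢
    rcases Nat.eq_zero_or_pos a with ha | ha
    · subst ha
      simp only [zero_add] at hij
      subst hij
      rw [hasseDeriv_zero']
      refine (pow_dvd_pow h (show s + 1 - b ≤ (s - b) + 1 by omega)).trans ?_
      rw [pow_succ']
      exact mul_dvd_mul_left _ (ih b)
    · exact (pow_dvd_pow h (show s + 1 - l ≤ s - b by omega)).trans ((ih b).mul_left _)

theorem pow_dvd_of_hasse {K : Type*} [CommRing K] (f : K[X]) (x : K) (L : ℕ)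
    (hf : ∀ l < L, (hasseDeriv l f).eval x = 0) : (X - C x) ^ L ∣ f := by
  have h1 : X ^ L ∣ taylor x f := by
    rw [X_pow_dvd_iff]
    intro d hd
    rw [taylor_coeff, hf d hd]
  obtain ⟨w, hw⟩ := h1
  refine ⟨taylor (-x) w, ?_⟩
  have h2 : taylor (-x) (taylor x f) = f := by
    rw [taylor_taylor]; simp
  rw [← h2, hw, taylor_mul, taylor_pow]
  simp [taylor_X, sub_eq_add_neg]

/-- linear quotient of the Hasse derivative -/
theorem exists_hasse_quot {K : Type*} [Field K] (h : K[X]) (hh : h.Monic) (s l : ℕ) (hl : l ≤ s) :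
    ∃ κ : K[X] →ₗ[K] K[X], (∀ k, hasseDeriv l (h ^ s * k) = h ^ (s - l) * κ k) ∧
      ∀ k A, k ∈ degreeLT K A → κ k ∈ degreeLT K (A + l * h.natDegree) := by
  have hne : ∀ i, h ^ i ≠ 0 := fun i => pow_ne_zero _ hh.ne_zero
  choose κ hκ using fun k => hasse_dvd h k s l
  refine ⟨{ toFun := κ, map_add' := ?_, map_smul' := ?_ }, fun k => hκ k, ?_⟩
  · intro a b
    apply mul_left_cancel₀ (hne (s - l))
    rw [← hκ, mul_add, map_add, hκ, hκ, mul_add]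
  · intro c a
    apply mul_left_cancel₀ (hne (s - l))
    rw [← hκ, mul_smul_comm, map_smul, hκ, RingHom.id_apply, mul_smul_comm]
  · intro k A hk
    rw [mem_degreeLT] at hk ⊢
    simp only [LinearMap.coe_mk, AddHom.coe_mk]
    by_cases h0 : κ k = 0
    · rw [h0, degree_zero]; exact WithBot.bot_lt_coe _
    have hk0 : k ≠ 0 := by
      rintro rfl
      have := hκ 0
      rw [mul_zero, map_zero] at this
      exact h0 ((mul_eq_zero.1 this.symm).resolve_left (hne _))
    have hA : k.natDegree < A := (natDegree_lt_iff_degree_lt hk0).2 hk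
    refine (natDegree_lt_iff_degree_lt h0).1 ?_
    have h1 := natDegree_hasseDeriv_le (h ^ s * k) l
    rw [hκ, natDegree_mul (hne _) h0, natDegree_mul (hne _) hk0, natDegree_pow, natDegree_pow] at h1
    have h2 : s * h.natDegree = (s - l) * h.natDegree + l * h.natDegree := by
      rw [← add_mul]; congr 1; omega
    omega


theorem natDegree_det_le_of {K : Type*} [CommRing K] {ι : Type*} [Fintype ι] [DecidableEq ι]
    (M : Matrix ι ι K[X]) (B : ℕ) (hM : ∀ i j, (M i j).natDegree ≤ B) :
    M.det.natDegree ≤ Fintype.card ι * B := by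
  rw [Matrix.det_apply]
  refine natDegree_sum_le_of_forall_le _ _ fun σ _ => ?_
  refine (natDegree_smul_le _ _).trans ?_
  refine (natDegree_prod_le _ _).trans ?_
  refine (Finset.sum_le_sum fun i _ => hM _ _).trans ?_
  simp

theorem stepanov_indep {K : Type*} [Field K] [Fintype K] (h : K[X]) (hh : h.Monic) (e t A : ℕ)
    (he : 0 < e) (het : e * t + 1 = Fintype.card K)
    (hpow : ∀ l : ℕ, l.Prime → l ∣ e → ∀ (c : K) (w : K[X]), h ≠ C c * w ^ l)
    (β : K) (hβ : h.eval β ≠ 0) (hmA : h.natDegree ≤ A) (hA : 2 * e * A < Fintype.card K)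
    (k : Fin e → K[X]) (hk : ∀ i, k i ∈ degreeLT K A)
    (hdvd : (X - C β) ^ (Fintype.card K) ∣ ∑ i, k i * (h ^ t) ^ (i : ℕ)) : k = 0 := by
  classical
  by_contra hk0
  set P : K[X][X] := ∑ i : Fin e, monomial (i : ℕ) (k i) with hP
  set c : K := h.eval β with hc
  set G : K[X][X] := C h * X ^ e - C (C c) with hG
  have hPc : ∀ i : Fin e, P.coeff i = k i := by
    intro i
    rw [hP, finsetSum_coeff]
    simp only [coeff_monomial]
    rw [Finset.sum_eq_single i]
    · simp
    · intro j _ hj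
      rw [if_neg]
      exact fun h => hj (Fin.ext h)
    · simp
  have hPc' : ∀ i : ℕ, e ≤ i → P.coeff i = 0 := by
    intro i hi
    rw [hP, finsetSum_coeff]
    refine Finset.sum_eq_zero fun j _ => ?_
    rw [coeff_monomial, if_neg]
    have := j.2; omega
  have hP0 : P ≠ 0 := by
    intro h0
    apply hk0
    funext i
    rw [← hPc i, h0]; simp
  have hPdeg : P.natDegree < e := by
    by_contra hcon
    push Not at hcon
    exact hP0 (leadingCoeff_eq_zero.1 (hPc' _ hcon))
  have hGdeg : G.natDegree = e := by
    rw [hG, natDegree_sub_C, natDegree_C_mul_X_pow _ _ hh.ne_zero]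
  have hPcdeg : ∀ i, (P.coeff i).natDegree ≤ A := by
    intro i
    by_cases hi : i < e
    · have := hPc ⟨i, hi⟩
      simp only at this
      rw [this]
      exact natDegree_le_of_degree_le (le_of_lt (mem_degreeLT.1 (hk _)))
    · rw [hPc' i (by omega)]; simp
  have hGcdeg : ∀ i, (G.coeff i).natDegree ≤ A := by
    intro i
    rw [hG, coeff_sub, coeff_C_mul, coeff_X_pow, coeff_C]
    refine (natDegree_sub_le _ _).trans (max_le ?_ ?_)
    · split_ifs <;> simp [hmA]
    · split_ifs <;> simp
  set N : K[X] := resultant G P e P.natDegree with hN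
  have hNdeg : N.natDegree < Fintype.card K := by
    refine lt_of_le_of_lt (natDegree_det_le_of _ A ?_) ?_
    · intro i j
      rw [sylvester, Matrix.of_apply]
      refine Fin.addCases (fun j₁ => ?_) (fun j₁ => ?_) j
      · rw [Fin.addCases_left]; split_ifs
        · exact hPcdeg _
        · simp
      · rw [Fin.addCases_right]; split_ifs
        · exact hGcdeg _
        · simp
    · rw [Fintype.card_fin]
      refine lt_of_le_of_lt (Nat.mul_le_mul_right A ?_) hA
      omega
  obtain ⟨p, r, -, -, hpr⟩ := exists_mul_add_mul_eq_C_resultant G P hGdeg.le le_rfl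
    (Or.inl he.ne')
  have hN0 : N = 0 := by
    have h1 := congrArg (eval (h ^ t)) hpr
    rw [eval_add, eval_mul, eval_mul, eval_C] at h1
    have h2 : (X - C β) ^ (Fintype.card K) ∣ eval (h ^ t) G := by
      obtain ⟨p', hp'⟩ := CharP.exists K
      obtain ⟨a, hp'', ha⟩ := FiniteField.card K p'
      have : Fact p'.Prime := ⟨hp''⟩
      have h3 : eval (h ^ t) G = (h - C c) ^ (Fintype.card K) := by
        rw [ha, sub_pow_char_pow, ← ha, hG]
        rw [eval_sub, eval_mul, eval_C, eval_pow, eval_X, eval_C, ← C_pow, FiniteField.pow_card,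
          ← het, pow_succ', ← pow_mul, mul_comm t e]
      rw [h3]
      exact pow_dvd_pow_of_dvd (dvd_iff_isRoot.2 (by simp [hc])) _
    have h4 : (X - C β) ^ (Fintype.card K) ∣ eval (h ^ t) P := by
      rw [hP, eval_finsetSum]
      simpa [eval_monomial] using hdvd
    have h5 : (X - C β) ^ (Fintype.card K) ∣ N := by
      rw [hN, ← h1]
      exact dvd_add (h2.mul_right _) (h4.mul_right _)
    by_contra hne
    have := natDegree_le_of_dvd h5 hne
    rw [natDegree_pow, natDegree_X_sub_C] at this
    omega
  set L := FractionRing K[X]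
  set φ := algebraMap K[X] L with hφ
  have hφi : Function.Injective φ := IsFractionRing.injective K[X] L
  have hres : resultant (G.map φ) (P.map φ) = 0 := by
    rw [natDegree_map_eq_of_injective hφi, natDegree_map_eq_of_injective hφi, hGdeg,
      resultant_map_map, ← hN, hN0, map_zero]
  have hncop := (resultant_eq_zero_iff.1 hres).2
  apply hncop
  have hφh : φ h ≠ 0 := by
    rw [Ne, map_eq_zero_iff _ hφi]; exact hh.ne_zero
  have hcc : φ (C c) ≠ 0 := by
    rw [Ne, map_eq_zero_iff _ hφi, C_eq_zero]; exact hβ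
  have hGm : G.map φ = C (φ h) * (X ^ e - C (φ (C c) / φ h)) := by
    rw [hG, mul_sub, ← C_mul, mul_div_cancel₀ _ hφh]
    simp
  rw [hGm, isCoprime_mul_unit_left_left (isUnit_C.2 hφh.isUnit)]
  -- primitive root in K
  have hroot : ∃ ζ : K, IsPrimitiveRoot ζ e := by
    obtain ⟨g, hg⟩ := IsCyclic.exists_generator (α := Kˣ)
    have ho : orderOf g = e * t := by
      rw [orderOf_eq_card_of_forall_mem_zpowers hg, Nat.card_eq_fintype_card, Fintype.card_units]
      omega
    have ht : 0 < e * t := by rw [← ho]; exact orderOf_pos g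
    refine ⟨((g ^ t : Kˣ) : K), ?_⟩
    have : IsPrimitiveRoot (g ^ t) e := by
      apply (ho ▸ IsPrimitiveRoot.orderOf g : IsPrimitiveRoot g (e * t)).pow ht
      ring
    exact IsPrimitiveRoot.coe_units_iff.2 this
  obtain ⟨ζ, hζ⟩ := hroot
  refine kummer_coprime he (φ (C ζ)) ?_ _ (div_ne_zero hcc hφh) ?_ _ ?_ ?_
  · exact hζ.map_of_injective (f := φ.comp C) (hφi.comp C_injective)
  · intro l hl hle b hb
    have hb0 : b ≠ 0 := by
      rintro rfl
      rw [zero_pow hl.ne_zero] at hb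
      exact (div_ne_zero hcc hφh) hb.symm
    have h1 : (b⁻¹) ^ l = φ (C c⁻¹ * h) := by
      rw [inv_pow, hb, inv_div, map_mul, div_eq_mul_inv, mul_comm]
      congr 1
      rw [inv_eq_iff_eq_inv, ← mul_eq_one_iff_eq_inv₀, ← map_mul, ← C_mul,
        mul_inv_cancel₀ hβ, C_1, map_one]
      rw [Ne, map_eq_zero_iff _ hφi, C_eq_zero]; exact inv_ne_zero hβ
    obtain ⟨w, hw⟩ := IsIntegrallyClosed.exists_algebraMap_eq_of_isIntegral_pow (R := K[X])
      hl.pos (x := b⁻¹) (by rw [h1]; exact isIntegral_algebraMap)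
    refine hpow l hl hle c w ?_
    rw [← hw, ← map_pow] at h1
    rw [hφi h1, ← mul_assoc, ← C_mul, mul_inv_cancel₀ hβ, C_1, one_mul]
  · rwa [Ne, Polynomial.map_eq_zero_iff hφi]
  · rwa [natDegree_map_eq_of_injective hφi]


theorem dvd_of_sum_eq_zero {R : Type*} [CommRing R] [IsDomain R] (Y : R) (hY : Y ≠ 0) {J : ℕ}
    (r : Fin J → R) (hr : ∑ j, r j * Y ^ (j : ℕ) = 0) (j0 : Fin J) (h0 : ∀ j < j0, r j = 0) :
    Y ∣ r j0 := by
  have h1 : Y ^ ((j0 : ℕ) + 1) ∣ r j0 * Y ^ (j0 : ℕ) := by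
    rw [← Finset.add_sum_erase _ _ (Finset.mem_univ j0)] at hr
    rw [eq_neg_of_add_eq_zero_left hr, dvd_neg]
    refine Finset.dvd_sum fun j hj => ?_
    rcases lt_or_gt_of_ne (Finset.ne_of_mem_erase hj) with h | h
    · rw [h0 j h]; simp
    · exact (pow_dvd_pow Y (Nat.succ_le_of_lt h)).mul_left _
  rw [pow_succ', ] at h1
  exact (mul_dvd_mul_iff_right (pow_ne_zero _ hY)).1 h1

theorem stepanov_count {K : Type*} [Field K] [Fintype K] [DecidableEq K]
    (h : K[X]) (hh : h.Monic) (e t A J L : ℕ)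
    (he : 0 < e) (het : e * t + 1 = Fintype.card K)
    (hpow : ∀ l : ℕ, l.Prime → l ∣ e → ∀ (c : K) (w : K[X]), h ≠ C c * w ^ l)
    (hmA : h.natDegree ≤ A) (hA : 2 * e * A < Fintype.card K)
    (hLQ : L ≤ Fintype.card K)
    (hdim : L * (A + L * h.natDegree + J) < e * (J * A)) (z : K) :
    L * (Finset.univ.filter (fun x : K => (h.eval x) ^ t = z)).card ≤
      Fintype.card K * J + h.natDegree * L + h.natDegree * Fintype.card K := by
  classical
  set Q := Fintype.card K with hQ
  set m := h.natDegree with hm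
  have hAQ : A < Q := by nlinarith
  -- a nonroot
  obtain ⟨β, hβ⟩ : ∃ β : K, h.eval β ≠ 0 := by
    by_contra! hcon
    have h1 : (Finset.univ : Finset K) ⊆ h.roots.toFinset := by
      intro x _
      rw [Multiset.mem_toFinset, mem_roots hh.ne_zero]
      exact hcon x
    have h2 := Finset.card_le_card h1
    have h3 := (Multiset.toFinset_card_le h.roots).trans (card_roots' h)
    rw [Finset.card_univ] at h2
    omega
  -- quotients
  have hq : ∀ (l : Fin L) (i : Fin e), ∃ κ : K[X] →ₗ[K] K[X],
      (∀ k, hasseDeriv (l : ℕ) (h ^ (L + i * t) * k) = h ^ (L + i * t - l) * κ k) ∧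
      ∀ k A, k ∈ degreeLT K A → κ k ∈ degreeLT K (A + l * h.natDegree) := by
    intro l i
    exact exists_hasse_quot h hh _ _ (by have := l.2; omega)
  choose κ hκ1 hκ2 using hq
  set B := A + L * m + J with hB
  -- the linear map
  let T0 : Fin L → (Fin e → Fin J → degreeLT K A) →ₗ[K] K[X] := fun l =>
    ∑ i : Fin e, ∑ j : Fin J,
      (LinearMap.mulLeft K (C (z ^ (i : ℕ)) * (X - C β) ^ (j : ℕ))) ∘ₗ (κ l i) ∘ₗ
        (degreeLT K A).subtype ∘ₗ (LinearMap.proj j) ∘ₗ (LinearMap.proj i)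
  have hT0 : ∀ l k, T0 l k = ∑ i : Fin e, ∑ j : Fin J,
      (C (z ^ (i : ℕ)) * (X - C β) ^ (j : ℕ)) * κ l i (k i j : K[X]) := by
    intro l k
    simp [T0, LinearMap.sum_apply, mul_assoc]
  have hT0deg : ∀ l k, T0 l k ∈ degreeLT K B := by
    intro l k
    rw [hT0]
    refine Submodule.sum_mem _ fun i _ => Submodule.sum_mem _ fun j _ => ?_
    have h1 := hκ2 l i _ _ (k i j).2
    rw [mem_degreeLT] at h1 ⊢
    rw [mul_assoc]
    refine lt_of_le_of_lt (degree_mul_le _ _) ?_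
    have hC : degree (C (z ^ (i : ℕ)) : K[X]) ≤ 0 := degree_C_le
    refine lt_of_le_of_lt (add_le_add_left hC _) ?_
    rw [zero_add, degree_mul, degree_pow, degree_X_sub_C]
    by_cases h0 : κ l i (k i j : K[X]) = 0
    · rw [h0, degree_zero]; simp
    rw [degree_eq_natDegree h0] at h1 ⊢
    rw [nsmul_one]
    have h1' : (κ l i (k i j : K[X])).natDegree < A + l * h.natDegree := by exact_mod_cast h1
    have h2 : (j : ℕ) + (κ l i (k i j : K[X])).natDegree < B := by
      have := j.2
      have : (l : ℕ) * h.natDegree ≤ L * m := Nat.mul_le_mul_right _ l.2.le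
      omega
    exact_mod_cast h2
  let T : (Fin e → Fin J → degreeLT K A) →ₗ[K] (Fin L → degreeLT K B) :=
    LinearMap.pi fun l => (T0 l).codRestrict _ (hT0deg l)
  have hfr : ∀ a, Module.finrank K (degreeLT K a) = a := by
    intro a
    rw [(degreeLTEquiv K a).finrank_eq, Module.finrank_fin_fun]
  have hfin : ∀ a, Module.Finite K (degreeLT K a) := fun a =>
    Module.Finite.equiv (degreeLTEquiv K a).symm
  have hker : LinearMap.ker T ≠ ⊥ := by
    apply LinearMap.ker_ne_bot_of_finrank_lt
    rw [Module.finrank_pi_fintype, Module.finrank_pi_fintype]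
    simp only [Module.finrank_pi_fintype, hfr]
    simpa using hdim
  obtain ⟨k, hk, hk0⟩ := (Submodule.ne_bot_iff _).1 hker
  have hTk : ∀ l : Fin L, ∑ i : Fin e, ∑ j : Fin J,
      (C (z ^ (i : ℕ)) * (X - C β) ^ (j : ℕ)) * κ l i (k i j : K[X]) = 0 := by
    intro l
    rw [← hT0]
    have := congrFun (LinearMap.mem_ker.1 hk) l
    exact congrArg Subtype.val this
  -- the auxiliary polynomial
  set Y : K[X] := (X - C β) ^ Q with hY
  have hY0 : Y ≠ 0 := pow_ne_zero _ (X_sub_C_ne_zero β)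
  set R0 : K[X] := ∑ j : Fin J, (∑ i : Fin e, (k i j : K[X]) * (h ^ t) ^ (i : ℕ)) * Y ^ (j : ℕ)
    with hR0
  have hR0ne : R0 ≠ 0 := by
    intro hz
    apply hk0
    have hall : ∀ n : ℕ, ∀ j : Fin J, (j : ℕ) = n → ∀ i, (k i j : K[X]) = 0 := by
      intro n
      induction n using Nat.strong_induction_on with
      | _ n ih =>
        intro j hj
        have hd := dvd_of_sum_eq_zero Y hY0 _ hz j (by
          intro j' hj'
          refine Finset.sum_eq_zero fun i _ => ?_
          rw [ih j' (by rw [← hj]; exact hj') j' rfl i, zero_mul])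
        have := stepanov_indep h hh e t A he het hpow β hβ hmA hA (fun i => (k i j : K[X]))
          (fun i => (k i j).2) hd
        intro i
        exact congrFun this i
    funext i j
    exact Subtype.ext (hall j j rfl i)
  set R : K[X] := h ^ L * R0 with hR
  have hRne : R ≠ 0 := mul_ne_zero (pow_ne_zero _ hh.ne_zero) hR0ne
  have hRsum : R = ∑ i : Fin e, ∑ j : Fin J, (h ^ (L + i * t) * (k i j : K[X])) * Y ^ (j : ℕ) := by
    rw [hR, hR0, Finset.mul_sum, Finset.sum_comm]
    refine Finset.sum_congr rfl fun j _ => ?_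
    rw [Finset.sum_mul, Finset.mul_sum]
    refine Finset.sum_congr rfl fun i _ => ?_
    rw [pow_add, mul_comm (i : ℕ) t, pow_mul]; ring
  have hRdeg : R.natDegree ≤ A + (L + (e - 1) * t) * m + Q * (J - 1) := by
    rw [hRsum]
    refine natDegree_sum_le_of_forall_le _ _ fun i _ => natDegree_sum_le_of_forall_le _ _ fun j _ => ?_
    refine (natDegree_mul_le).trans ?_
    have h1 : (h ^ (L + i * t) * (k i j : K[X])).natDegree ≤ (L + (e - 1) * t) * m + A := by
      refine natDegree_mul_le.trans (add_le_add ?_ ?_)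
      · rw [natDegree_pow]
        refine Nat.mul_le_mul_right _ (Nat.add_le_add_left (Nat.mul_le_mul_right _ ?_) _)
        have := i.2; omega
      · exact natDegree_le_of_degree_le (le_of_lt (mem_degreeLT.1 (k i j).2))
    have h2 : (Y ^ (j : ℕ)).natDegree ≤ Q * (J - 1) := by
      rw [natDegree_pow, hY, natDegree_pow, natDegree_X_sub_C, mul_one, mul_comm]
      refine Nat.mul_le_mul_left _ ?_
      have := j.2; omega
    omega
  -- multiplicity
  have hmult : ∀ x ∈ Finset.univ.filter (fun x : K => (h.eval x) ^ t = z), (X - C x) ^ L ∣ R := by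
    intro x hx
    have hx : (h.eval x) ^ t = z := (Finset.mem_filter.1 hx).2
    set R' : K[X] := ∑ i : Fin e, ∑ j : Fin J,
      C ((x - β) ^ (j : ℕ)) * (h ^ (L + i * t) * (k i j : K[X])) with hR'
    have hYx : (X - C x) ^ L ∣ Y - C (x - β) := by
      refine (pow_dvd_pow _ hLQ).trans ?_
      obtain ⟨p', hp'⟩ := CharP.exists K
      obtain ⟨a, hp'', ha⟩ := FiniteField.card K p'
      have : Fact p'.Prime := ⟨hp''⟩
      have h3 : Y - C (x - β) = (X - C x) ^ Q := by
        rw [hY]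
        conv_lhs => rw [← FiniteField.pow_card (x - β)]
        rw [C_pow, ← hQ, hQ, ha, ← sub_pow_char_pow, ← ha]
        congr 1
        rw [C_sub]; ring
      rw [h3]
    have hdiff : (X - C x) ^ L ∣ R - R' := by
      rw [hRsum, hR', ← Finset.sum_sub_distrib]
      refine Finset.dvd_sum fun i _ => ?_
      rw [← Finset.sum_sub_distrib]
      refine Finset.dvd_sum fun j _ => ?_
      rw [mul_comm (C _), ← mul_sub, C_pow]
      exact (hYx.trans (sub_dvd_pow_sub_pow _ _ _)).mul_left _
    have hdR' : (X - C x) ^ L ∣ R' := by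
      apply pow_dvd_of_hasse
      intro l hl
      rw [hR', map_sum, eval_finsetSum]
      have hT := congrArg (eval x) (hTk ⟨l, hl⟩)
      rw [eval_zero] at hT
      have : (∑ i : Fin e, eval x (hasseDeriv l (∑ j : Fin J,
          C ((x - β) ^ (j : ℕ)) * (h ^ (L + i * t) * (k i j : K[X]))))) =
          (h.eval x) ^ (L - l) * eval x (∑ i : Fin e, ∑ j : Fin J,
      (C (z ^ (i : ℕ)) * (X - C β) ^ (j : ℕ)) * κ ⟨l, hl⟩ i (k i j : K[X])) := by
        rw [eval_finsetSum, Finset.mul_sum]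
        refine Finset.sum_congr rfl fun i _ => ?_
        rw [map_sum, eval_finsetSum, eval_finsetSum, Finset.mul_sum]
        refine Finset.sum_congr rfl fun j _ => ?_
        rw [← smul_eq_C_mul, map_smul, hκ1 ⟨l, hl⟩ i]
        simp only [eval_smul, eval_mul, eval_pow, eval_C, eval_sub, eval_X, smul_eq_mul]
        rw [show L + (i : ℕ) * t - l = (L - l) + t * i by rw [mul_comm t]; omega, pow_add, pow_mul, hx]
        ring
      rw [this, hT, mul_zero]
    have := dvd_add hdiff hdR'
    simpa using this
  have hprod : (∏ x ∈ Finset.univ.filter (fun x : K => (h.eval x) ^ t = z), (X - C x) ^ L) ∣ R := by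
    apply Finset.prod_dvd_of_coprime
    · intro x _ y _ hxy
      exact (isCoprime_X_sub_C_of_isUnit_sub (sub_ne_zero.2 hxy).isUnit).pow
    · exact hmult
  have hfinal := natDegree_le_of_dvd hprod hRne
  rw [natDegree_prod_of_monic _ _ (fun x _ => (monic_X_sub_C x).pow L)] at hfinal
  simp only [natDegree_pow, natDegree_X_sub_C, mul_one, Finset.sum_const, smul_eq_mul] at hfinal
  have hJ : 0 < J := by
    rcases Nat.eq_zero_or_pos J with h | h
    · subst h; simp at hdim
    · exact h
  have het' : (e - 1) * t ≤ Q := by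
    have : (e - 1) * t ≤ e * t := Nat.mul_le_mul_right _ (by omega)
    omega
  have h3 : (L + (e - 1) * t) * m ≤ m * L + m * Q := by
    nlinarith [Nat.mul_le_mul_left m het']
  have h4 : Q * (J - 1) + Q = Q * J := by
    obtain ⟨J', rfl⟩ : ∃ J', J = J' + 1 := ⟨J - 1, by omega⟩
    simp; ring
  rw [mul_comm L]
  omega


set_option maxHeartbeats 1000000 in
theorem stepanov_bound (e m : ℕ) (he : 0 < e) : ∃ C s0 : ℕ, ∀ (K : Type) [Field K] [Fintype K]
    [DecidableEq K] (s t : ℕ) (h : K[X]), Fintype.card K = s ^ 2 → s0 ≤ s → h.Monic →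
    h.natDegree = m → e * t + 1 = Fintype.card K →
    (∀ l : ℕ, l.Prime → l ∣ e → ∀ (c : K) (w : K[X]), h ≠ Polynomial.C c * w ^ l) → ∀ z : K,
    ((Finset.univ.filter (fun x : K => (h.eval x) ^ t = z)).card : ℝ) ≤ (s : ℝ) ^ 2 / e + C * s := by
  set r := 8 * e * (e * (e * m + 1)) with hr
  refine ⟨2 * (r + m * e + m), 4 * e * (m + 1) + 2 * r + 1, ?_⟩
  intro K _ _ _ s t h hcard hs hh hm het hpow z
  set B := s / (4 * e) with hB
  have hB1 : m + 1 ≤ B := by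
    rw [hB, Nat.le_div_iff_mul_le (by omega)]
    calc (m + 1) * (4 * e) = 4 * e * (m + 1) := by ring
      _ ≤ s := by omega
  have hB2 : 4 * e * B ≤ s := Nat.mul_div_le _ _
  have hB3 : s ≤ 8 * e * B := by
    have h1 : s < 4 * e * (B + 1) := Nat.lt_mul_div_succ _ (by omega)
    nlinarith
  have hes : e ≤ s := by nlinarith
  have hrs : 2 * r < s := by
    have : 0 ≤ 4 * e * (m + 1) := Nat.zero_le _
    omega
  have hses : s ≤ e * s := by nlinarith
  obtain ⟨L, hL⟩ : ∃ L, L + r = e * s := ⟨e * s - r, by omega⟩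
  have hLpos : 0 < L := by omega
  have hLes : L ≤ e * s := by omega
  have hr0 : 0 < r := by positivity
  have key := stepanov_count h hh e t (s * B) s L he het hpow
    (by rw [hm]; nlinarith)
    (by rw [hcard]; nlinarith [Nat.mul_le_mul_left s hB2])
    (by rw [hcard]; nlinarith)
    (by
      rw [hm]
      have h1 : L * (B + e * m + 1) < e * s * B := by
        have h2 : e * (e * m + 1) * s ≤ r * B := by
          calc e * (e * m + 1) * s ≤ e * (e * m + 1) * (8 * e * B) := Nat.mul_le_mul_left _ hB3
            _ = r * B := by rw [hr]; ring
        have h3 : (L + r) * (B + e * m + 1) = e * s * (B + e * m + 1) := by rw [hL]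
        nlinarith [Nat.mul_pos hr0 (show 0 < e * m + 1 by omega)]
      have h4 : L * (s * B + L * m + s) ≤ s * (L * (B + e * m + 1)) := by
        have : L * (L * m) ≤ L * (e * s * m) :=
          Nat.mul_le_mul_left _ (Nat.mul_le_mul_right _ hLes)
        nlinarith
      calc L * (s * B + L * m + s) ≤ s * (L * (B + e * m + 1)) := h4
        _ < s * (e * s * B) := Nat.mul_lt_mul_of_pos_left h1 (by omega)
        _ = e * (s * (s * B)) := by ring) z
  rw [hcard, hm] at key
  set N := (Finset.univ.filter (fun x : K => (h.eval x) ^ t = z)).card with hN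
  have key' : (L : ℝ) * N ≤ (s : ℝ) ^ 2 * s + m * L + m * (s : ℝ) ^ 2 := by exact_mod_cast key
  have hLr : (L : ℝ) = e * s - r := by
    have : (L : ℝ) + r = e * s := by exact_mod_cast hL
    linarith
  have hLpos' : (0 : ℝ) < L := by exact_mod_cast hLpos
  have heR : (1 : ℝ) ≤ e := by exact_mod_cast he
  have hsR : (2 : ℝ) * r ≤ s := by exact_mod_cast hrs.le
  have hs0 : (1 : ℝ) ≤ s := by
    have : 1 ≤ s := by omega
    exact_mod_cast this
  have hrR : (0 : ℝ) ≤ r := Nat.cast_nonneg r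
  have hmR : (0 : ℝ) ≤ m := Nat.cast_nonneg m
  refine le_of_mul_le_mul_left (key'.trans ?_) hLpos'
  push_cast
  set c : ℝ := 2 * ((r : ℝ) + m * e + m) with hc
  have hc0 : 0 ≤ c := by positivity
  have hL2 : (L : ℝ) ≤ e * s := by rw [hLr]; linarith
  have e1 : (L : ℝ) * ((s : ℝ) ^ 2 / e + c * s) =
      (s : ℝ) ^ 2 * s - r * (s : ℝ) ^ 2 / e + L * c * s := by
    rw [mul_add, hLr]
    field_simp
  rw [e1]
  have e2 : (r : ℝ) * (s : ℝ) ^ 2 / e ≤ r * (s : ℝ) ^ 2 := by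
    apply div_le_self (by positivity) heR
  have e3 : (s : ℝ) / 2 ≤ L := by
    have := le_mul_of_one_le_left (by linarith : (0:ℝ) ≤ s) heR
    rw [hLr]; linarith
  have e4 : (s : ℝ) / 2 * c * s ≤ L * c * s := by gcongr
  have e5 : (m : ℝ) * L ≤ m * e * (s : ℝ) ^ 2 := by
    calc (m : ℝ) * L ≤ m * (e * s) := by gcongr
      _ ≤ m * e * (s : ℝ) ^ 2 := by
        have : (s : ℝ) ≤ s ^ 2 := by nlinarith
        have h2 : 0 ≤ (m : ℝ) * e := by positivity
        nlinarith
  have e6 : (s : ℝ) / 2 * c * s = (r + m * e + m) * (s : ℝ) ^ 2 := by rw [hc]; ring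
  rw [e6] at e4
  linarith


theorem pow_eq_of_pow_eq_one {G : Type*} [CommGroup G] [Finite G] [IsCyclic G] (e t : ℕ)
    (hG : Nat.card G = e * t) (w : G) (hw : w ^ t = 1) : ∃ v : G, w = v ^ e := by
  obtain ⟨g, hg⟩ := IsCyclic.exists_generator (α := G)
  have ho : orderOf g = e * t := by
    rw [orderOf_eq_card_of_forall_mem_zpowers hg, hG]
  have ht : 0 < e * t := by rw [← ho]; exact orderOf_pos g
  obtain ⟨i, hi⟩ := mem_powers_iff_mem_zpowers.2 (hg w)
  simp only at hi
  rw [← hi, ← pow_mul, ← orderOf_dvd_iff_pow_eq_one, ho] at hw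
  obtain ⟨j, hj⟩ := Nat.dvd_of_mul_dvd_mul_right (Nat.pos_of_mul_pos_left ht) hw
  refine ⟨g ^ j, ?_⟩
  rw [← hi, hj, ← pow_mul, mul_comm]

set_option maxHeartbeats 1000000 in
theorem charsum_bound (e m : ℕ) (he : 0 < e) : ∃ (C : ℝ) (s0 : ℕ), ∀ (K : Type) [Field K] [Fintype K]
    (s t : ℕ) (h : K[X]) (η : MulChar K ℂ), Fintype.card K = s ^ 2 → s0 ≤ s → h.Monic →
    h.natDegree = m → e * t + 1 = Fintype.card K → η ^ e = 1 → η ≠ 1 →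
    (∀ l : ℕ, l.Prime → l ∣ e → ∀ (c : K) (w : K[X]), h ≠ Polynomial.C c * w ^ l) →
    ‖∑ x : K, η (h.eval x)‖ ≤ C * s := by
  classical
  obtain ⟨C, s0, hst⟩ := stepanov_bound e m he
  refine ⟨e * (e * C + m), s0 + 1, ?_⟩
  intro K _ _ s t h η hcard hs hh hm het hηe hη1 hpow
  have hup := hst K s t h hcard (by omega) hh hm het hpow
  set N : K → ℕ := fun z => (Finset.univ.filter (fun x : K => (h.eval x) ^ t = z)).card with hN
  have hQ1 : 1 < Fintype.card K := Fintype.one_lt_card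
  have htpos : 0 < t := by
    rcases Nat.eq_zero_or_pos t with h0 | h0
    · subst h0; omega
    · exact h0
  have hcu : Nat.card Kˣ = e * t := by
    rw [Nat.card_eq_fintype_card, Fintype.card_units]; omega
  have heR : (0 : ℝ) < e := by exact_mod_cast he
  set D : ℝ := (s : ℝ) ^ 2 / e + C * s with hD
  have hD0 : 0 ≤ D := by positivity
  have hsR : (1 : ℝ) ≤ s := by
    have : 1 ≤ s := by omega
    exact_mod_cast this
  -- lower bound
  have hlow : ∀ z : K, z ^ e = 1 → (s : ℝ) ^ 2 ≤ m + N z + (e - 1) * D := by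
    intro z hz
    set μ : Finset K := Finset.univ.filter (fun z : K => z ^ e = 1) with hμ
    have hzμ : z ∈ μ := by rw [hμ, Finset.mem_filter]; exact ⟨Finset.mem_univ _, hz⟩
    have hμc : μ.card ≤ e := by
      have h1 : μ ⊆ (nthRoots e (1 : K)).toFinset := by
        intro y hy
        rw [Multiset.mem_toFinset, mem_nthRoots he]
        exact (Finset.mem_filter.1 hy).2
      exact (Finset.card_le_card h1).trans ((Multiset.toFinset_card_le _).trans (card_nthRoots e 1))
    have hcover : (Finset.univ : Finset K) ⊆ h.roots.toFinset ∪
        μ.biUnion (fun z => Finset.univ.filter (fun x : K => (h.eval x) ^ t = z)) := by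
      intro x _
      rw [Finset.mem_union, Multiset.mem_toFinset, mem_roots hh.ne_zero, Finset.mem_biUnion]
      by_cases hx : h.eval x = 0
      · exact Or.inl hx
      · refine Or.inr ⟨(h.eval x) ^ t, ?_, by simp⟩
        rw [hμ, Finset.mem_filter]
        refine ⟨Finset.mem_univ _, ?_⟩
        rw [← pow_mul, mul_comm t, show e * t = Fintype.card K - 1 by omega]
        exact FiniteField.pow_card_sub_one_eq_one _ hx
    have h2 : Fintype.card K ≤ m + ∑ y ∈ μ, N y := by
      have := Finset.card_le_card hcover
      rw [Finset.card_univ] at this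
      refine this.trans ((Finset.card_union_le _ _).trans (add_le_add ?_ ?_))
      · rw [← hm]
        exact (Multiset.toFinset_card_le _).trans (card_roots' h)
      · exact Finset.card_biUnion_le
    have h3 : (s : ℝ) ^ 2 ≤ m + ∑ y ∈ μ, (N y : ℝ) := by
      rw [hcard] at h2
      exact_mod_cast h2
    rw [← Finset.add_sum_erase _ _ hzμ] at h3
    have h4 : ∑ y ∈ μ.erase z, (N y : ℝ) ≤ (e - 1) * D := by
      refine (Finset.sum_le_card_nsmul _ _ D fun y _ => hup y).trans ?_
      rw [nsmul_eq_mul]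
      refine mul_le_mul_of_nonneg_right ?_ hD0
      rw [Finset.card_erase_of_mem hzμ]
      have h5 : μ.card - 1 + 1 ≤ e := by
        have : 0 < μ.card := Finset.card_pos.2 ⟨z, hzμ⟩
        omega
      have h6 : ((μ.card - 1 : ℕ) : ℝ) + 1 ≤ e := by exact_mod_cast h5
      linarith
    linarith
  have hdev : ∀ z : K, z ^ e = 1 → |(N z : ℝ) - (s : ℝ) ^ 2 / e| ≤ (e * C + m) * s := by
    intro z hz
    have h1 := hlow z hz
    have h2 := hup z
    have h3 : (e - 1) * D = (s : ℝ) ^ 2 - (s : ℝ) ^ 2 / e + (e - 1) * (C * s) := by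
      rw [hD]; field_simp
    rw [h3] at h1
    have hC : (0 : ℝ) ≤ C * s := by positivity
    have he1 : (1 : ℝ) ≤ e := by exact_mod_cast he
    have hms : (m : ℝ) ≤ m * s := le_mul_of_one_le_right (Nat.cast_nonneg _) hsR
    have hm0 : (0 : ℝ) ≤ m := Nat.cast_nonneg _
    have hCe : (C : ℝ) * s ≤ e * (C * s) := le_mul_of_one_le_left hC he1
    change (N z : ℝ) ≤ _ at h2
    rw [abs_le]
    constructor
    · nlinarith
    · nlinarith
  -- double counting
  have hdc : (t : ℂ) * ∑ x : K, η (h.eval x) = ∑ y : Kˣ, η y * N ((y : K) ^ t) := by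
    have h1 : ∀ y : Kˣ, η y * N ((y : K) ^ t) =
        ∑ x : K, if (h.eval x) ^ t = (y : K) ^ t then η y else 0 := by
      intro y
      rw [← Finset.sum_filter, Finset.sum_const, nsmul_eq_mul, mul_comm]
    simp_rw [h1]
    rw [Finset.sum_comm, Finset.mul_sum]
    refine Finset.sum_congr rfl fun x _ => ?_
    by_cases hx : h.eval x = 0
    · rw [hx, MulChar.map_zero, mul_zero]
      symm
      refine Finset.sum_eq_zero fun y _ => ?_
      rw [if_neg]
      rw [zero_pow htpos.ne']
      exact (pow_ne_zero _ y.ne_zero).symm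
    · set y0 : Kˣ := Units.mk0 _ hx with hy0
      have hy0' : h.eval x = y0 := rfl
      have h2 : ∀ y : Kˣ, (if (h.eval x) ^ t = (y : K) ^ t then η y else 0) =
          (if (y * y0⁻¹) ^ t = 1 then η (y0 : K) else 0) := by
        intro y
        have h3 : (h.eval x) ^ t = (y : K) ^ t ↔ (y * y0⁻¹) ^ t = 1 := by
          rw [hy0', mul_pow, inv_pow, mul_inv_eq_one, eq_comm]
          rw [← Units.val_pow_eq_pow_val, ← Units.val_pow_eq_pow_val, Units.val_inj]
        by_cases h4 : (y * y0⁻¹) ^ t = 1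
        · rw [if_pos h4, if_pos (h3.2 h4)]
          obtain ⟨v, hv⟩ := pow_eq_of_pow_eq_one e t hcu _ h4
          have h5 : (y : K) = (y0 : K) * (v : K) ^ e := by
            rw [← Units.val_pow_eq_pow_val, ← Units.val_mul, ← hv]
            congr 1
            rw [mul_comm, inv_mul_cancel_right]
          rw [h5, map_mul, map_pow, ← MulChar.pow_apply' _ he.ne', hηe, MulChar.one_apply_coe,
            mul_one]
        · rw [if_neg h4, if_neg (fun h => h4 (h3.1 h))]
      simp_rw [h2]
      rw [← Finset.sum_filter, Finset.sum_const, nsmul_eq_mul, hy0']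
      congr 2
      have h6 : Nat.card (powMonoidHom t : Kˣ →* Kˣ).ker = t := by
        rw [IsCyclic.card_powMonoidHom_ker, hcu]
        simp
      have h7 : (Finset.univ.filter (fun y : Kˣ => (y * y0⁻¹) ^ t = 1)).card =
          (Finset.univ.filter (fun y : Kˣ => y ^ t = 1)).card := by
        refine Finset.card_bij (fun y _ => y * y0⁻¹) ?_ ?_ ?_
        · intro y hy
          simpa using hy
        · intro a _ b _ hab
          exact mul_right_cancel hab
        · intro b hb
          refine ⟨b * y0, ?_, by simp⟩
          simpa using hb
      rw [h7]
      rw [Nat.card_eq_fintype_card, Fintype.card_subtype] at h6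
      refine h6.symm.trans ?_
      congr 1
      ext y
      simp [MonoidHom.mem_ker]
  have hsum0 : ∑ y : Kˣ, η (y : K) = 0 := by
    have h1 := MulChar.sum_eq_zero_of_ne_one hη1
    rw [← h1]
    rw [← Finset.add_sum_erase _ _ (Finset.mem_univ (0 : K)), MulChar.map_zero, zero_add]
    refine Finset.sum_bij (fun y _ => (y : K)) ?_ ?_ ?_ ?_
    · intro y _; simp
    · intro a _ b _ hab; exact Units.ext hab
    · intro b hb
      exact ⟨Units.mk0 b (Finset.ne_of_mem_erase hb), Finset.mem_univ _, rfl⟩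
    · intro y _; rfl
  have hdc2 : (t : ℂ) * ∑ x : K, η (h.eval x) =
      ∑ y : Kˣ, η y * (((N ((y : K) ^ t) : ℝ) - (s : ℝ) ^ 2 / e : ℝ) : ℂ) := by
    rw [hdc]
    simp_rw [Complex.ofReal_sub, mul_sub, Finset.sum_sub_distrib, ← Finset.sum_mul]
    rw [hsum0, zero_mul, sub_zero]
    simp
  have hnorm : ‖(t : ℂ) * ∑ x : K, η (h.eval x)‖ ≤ (e * t : ℝ) * ((e * C + m) * s) := by
    rw [hdc2]
    refine (norm_sum_le _ _).trans ?_
    have h1 : ∀ y ∈ (Finset.univ : Finset Kˣ),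
        ‖η y * (((N ((y : K) ^ t) : ℝ) - (s : ℝ) ^ 2 / e : ℝ) : ℂ)‖ ≤ (e * C + m) * s := by
      intro y _
      rw [norm_mul, Complex.norm_real, Real.norm_eq_abs]
      have h2 : ‖η (y : K)‖ ≤ 1 := by
        have h3 : (η (y : K)) ^ e = 1 := by
          rw [← MulChar.pow_apply' _ he.ne', hηe, MulChar.one_apply_coe]
        exact (Complex.norm_eq_one_of_pow_eq_one h3 he.ne').le
      have h4 := hdev ((y : K) ^ t) (by
        rw [← pow_mul, mul_comm t, show e * t = Fintype.card K - 1 by omega]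
        exact FiniteField.pow_card_sub_one_eq_one _ y.ne_zero)
      calc _ ≤ 1 * |(N ((y : K) ^ t) : ℝ) - (s : ℝ) ^ 2 / e| :=
            mul_le_mul_of_nonneg_right h2 (abs_nonneg _)
        _ ≤ _ := by rw [one_mul]; exact h4
    refine (Finset.sum_le_card_nsmul _ _ _ h1).trans (le_of_eq ?_)
    rw [nsmul_eq_mul, Finset.card_univ, ← Nat.card_eq_fintype_card, hcu]
    push_cast; ring
  rw [norm_mul, Complex.norm_natCast] at hnorm
  have htR : (0 : ℝ) < t := by exact_mod_cast htpos
  refine le_of_mul_le_mul_left (hnorm.trans (le_of_eq ?_)) htR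
  ring


/-- Bounded power sums force the terms into the unit disc. -/
theorem norm_le_one_of_powersum (s : Multiset ℂ) (C : ℝ) (N0 : ℕ)
    (hb : ∀ j, N0 ≤ j → ‖(s.map (fun z => z ^ j)).sum‖ ≤ C) : ∀ z ∈ s, ‖z‖ ≤ 1 := by
  classical
  intro z hz
  by_contra hlt
  push Not at hlt
  set P : ℂ[X] := ∏ y ∈ s.toFinset.erase z, (X - Polynomial.C y) with hP
  have hPz : P.eval z ≠ 0 := by
    rw [hP, eval_prod, Finset.prod_ne_zero_iff]
    intro y hy
    simpa [sub_eq_zero] using (Finset.ne_of_mem_erase hy).symm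
  have hPy : ∀ y ∈ s, y ≠ z → P.eval y = 0 := by
    intro y hy hyz
    rw [hP, eval_prod]
    refine Finset.prod_eq_zero (i := y) ?_ (by simp)
    simp [hy, hyz]
  have key : ∀ j, (s.map (fun y => P.eval y * y ^ j)).sum = (s.count z : ℂ) * (P.eval z * z ^ j) := by
    intro j
    rw [Finset.sum_multiset_map_count]
    rw [Finset.sum_eq_single z]
    · simp
    · intro b hb1 hb2
      rw [hPy b (by simpa using hb1) hb2]; simp
    · intro h; simp [hz] at h
  have key2 : ∀ j, (s.map (fun y => P.eval y * y ^ j)).sum =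
      ∑ i ∈ Finset.range (P.natDegree + 1), P.coeff i * (s.map (fun y => y ^ (i + j))).sum := by
    intro j
    simp_rw [← Multiset.sum_map_mul_left]
    refine Eq.trans ?_ (Multiset.sum_map_sum_map s (Finset.range (P.natDegree + 1)).val)
    · congr 1
      refine Multiset.map_congr rfl fun y _ => ?_
      change _ = ∑ i ∈ Finset.range (P.natDegree + 1), _
      rw [eval_eq_sum_range, Finset.sum_mul]
      exact Finset.sum_congr rfl fun i _ => by ring
  set B : ℝ := ∑ i ∈ Finset.range (P.natDegree + 1), ‖P.coeff i‖ * C with hB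
  have hbd : ∀ j, N0 ≤ j → (s.count z : ℝ) * (‖P.eval z‖ * ‖z‖ ^ j) ≤ B := by
    intro j hj
    have h1 := key j
    rw [key2] at h1
    have h2 := congrArg norm h1
    rw [norm_mul, norm_mul, norm_pow, Complex.norm_natCast] at h2
    rw [← h2, hB]
    refine norm_sum_le_of_le _ fun i _ => ?_
    rw [norm_mul]
    exact mul_le_mul_of_nonneg_left (hb _ (by omega)) (norm_nonneg _)
  have hc : (1 : ℝ) ≤ s.count z := by
    exact_mod_cast Multiset.one_le_count_iff_mem.2 hz
  have hPn : 0 < ‖P.eval z‖ := norm_pos_iff.2 hPz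
  obtain ⟨j, hj⟩ := ((tendsto_pow_atTop_atTop_of_one_lt hlt).eventually
    (Filter.eventually_gt_atTop (B / ‖P.eval z‖))).and (Filter.eventually_ge_atTop N0) |>.exists
  have h3 := hbd j hj.2
  have h4 := hj.1
  rw [div_lt_iff₀ hPn] at h4
  have h5 : ‖P.eval z‖ * ‖z‖ ^ j ≤ s.count z * (‖P.eval z‖ * ‖z‖ ^ j) :=
    le_mul_of_one_le_left (by positivity) hc
  linarith


theorem newton_of_rec (c U : ℕ → ℂ) (m : ℕ) (hc0 : c 0 = 1) (hc : ∀ j, m < j → c j = 0)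
    (hrec : ∀ n : ℕ, (n : ℂ) * c n = ∑ i ∈ Finset.Icc 1 n, U i * c (n - i)) :
    ∃ ω : Multiset ℂ, ω.card = m ∧ ∀ n, 1 ≤ n → U n = -(ω.map (fun z => z ^ n)).sum := by
  classical
  set P : ℂ[X] := ∑ j ∈ Finset.range (m + 1), Polynomial.C (c j) * X ^ (m - j) with hP
  have hPcoeff : ∀ j, j ≤ m → P.coeff (m - j) = c j := by
    intro j hj
    rw [hP, finsetSum_coeff, Finset.sum_eq_single j]
    · simp
    · intro b hb hbj
      rw [Finset.mem_range] at hb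
      rw [coeff_C_mul, coeff_X_pow, if_neg (by omega), mul_zero]
    · intro h; simp at h; omega
  have hPdeg : P.natDegree ≤ m := by
    rw [hP]
    refine natDegree_sum_le_of_forall_le _ _ fun j _ => ?_
    exact (natDegree_C_mul_X_pow_le _ _).trans (by omega)
  have hPm : P.coeff m = 1 := by simpa [hc0] using hPcoeff 0 (Nat.zero_le _)
  have hPmon : P.Monic := monic_of_natDegree_le_of_coeff_eq_one m hPdeg hPm
  have hPd : P.natDegree = m := le_antisymm hPdeg (le_natDegree_of_ne_zero (by rw [hPm]; simp))
  have hcard : P.roots.card = P.natDegree := (splits_iff_card_roots.1 (IsAlgClosed.splits P))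
  set ω := P.roots with hω
  have hes : ∀ j, c j = (-1) ^ j * ω.esymm j := by
    intro j
    rcases le_or_gt j m with hj | hj
    · rw [← hPcoeff j hj, coeff_eq_esymm_roots_of_card hcard (by omega), hPmon.leadingCoeff, hPd,
        one_mul, Nat.sub_sub_self hj]
    · rw [hc j hj, Multiset.esymm, Multiset.powersetCard_eq_empty _ (by omega)]
      simp
  refine ⟨ω, by omega, ?_⟩
  have hmap : (Finset.univ : Finset ω).val.map (fun x : ω => (x : ℂ)) = ω := Multiset.map_univ_coe ω
  have hnewt : ∀ k : ℕ, (k : ℂ) * c k =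
      - ∑ a ∈ Finset.HasAntidiagonal.antidiagonal k with a.1 < k,
        c a.1 * (ω.map (fun z => z ^ a.2)).sum := by
    intro k
    have h1 := congrArg (MvPolynomial.aeval (fun x : ω => (x : ℂ)))
      (MvPolynomial.mul_esymm_eq_sum ω ℂ k)
    simp only [map_mul, map_sum, map_pow, map_neg, map_one, map_natCast,
      MvPolynomial.aeval_esymm_eq_multiset_esymm, MvPolynomial.psum, MvPolynomial.aeval_X] at h1
    rw [hmap] at h1
    have h2 : ∀ i, ∑ x : ω, (x : ℂ) ^ i = (ω.map (fun z => z ^ i)).sum := by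
      intro i
      conv_rhs => rw [← hmap]
      rw [Multiset.map_map]; rfl
    simp only [h2] at h1
    rw [hes k, mul_left_comm, h1, ← mul_assoc, ← pow_add, show k + (k + 1) = 2 * k + 1 by ring,
      pow_succ, pow_mul]
    simp only [even_two, Even.neg_pow, one_pow, mul_neg, mul_one, neg_mul, one_mul, neg_inj]
    refine Finset.sum_congr rfl fun a _ => ?_
    rw [hes]
  intro n
  induction n using Nat.strong_induction_on with
  | _ n ih =>
    intro hn
    have h1 := hnewt n
    rw [hrec n] at h1
    have h2 : ∑ a ∈ Finset.HasAntidiagonal.antidiagonal n with a.1 < n,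
        c a.1 * (ω.map (fun z => z ^ a.2)).sum =
        ∑ i ∈ Finset.Icc 1 n, (ω.map (fun z => z ^ i)).sum * c (n - i) := by
      refine Finset.sum_bij (fun a _ => a.2) ?_ ?_ ?_ ?_
      · intro a ha
        rw [Finset.mem_filter, Finset.HasAntidiagonal.mem_antidiagonal] at ha
        rw [Finset.mem_Icc]; omega
      · intro a ha b hb hab
        rw [Finset.mem_filter, Finset.HasAntidiagonal.mem_antidiagonal] at ha hb
        ext
        · omega
        · exact hab
      · intro i hi
        rw [Finset.mem_Icc] at hi
        refine ⟨(n - i, i), ?_, rfl⟩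
        rw [Finset.mem_filter, Finset.HasAntidiagonal.mem_antidiagonal]
        constructor
        · simp only; omega
        · simp only; omega
      · intro a ha
        rw [Finset.mem_filter, Finset.HasAntidiagonal.mem_antidiagonal] at ha
        rw [mul_comm, show n - a.2 = a.1 by omega]
    have hnm : n ∈ Finset.Icc 1 n := Finset.mem_Icc.2 ⟨hn, le_rfl⟩
    rw [h2, ← Finset.add_sum_erase _ _ hnm, ← Finset.add_sum_erase (Finset.Icc 1 n)
      (fun i => (ω.map (fun z => z ^ i)).sum * c (n - i)) hnm, Nat.sub_self, hc0] at h1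
    have h3 : ∑ i ∈ (Finset.Icc 1 n).erase n, U i * c (n - i) =
        - ∑ i ∈ (Finset.Icc 1 n).erase n, (ω.map (fun z => z ^ i)).sum * c (n - i) := by
      rw [← Finset.sum_neg_distrib]
      refine Finset.sum_congr rfl fun i hi => ?_
      rw [Finset.mem_erase, Finset.mem_Icc] at hi
      rw [ih i (by omega) hi.2.1, neg_mul]
    rw [h3] at h1
    linear_combination h1


theorem finite_monic_natDegree (F : Type*) [Field F] [Fintype F] (n : ℕ) :
    {f : F[X] | f.Monic ∧ f.natDegree = n}.Finite := by
  have e : {p : F[X] // p.Monic ∧ p.natDegree = n} ≃ (Fin n → F) :=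
    (monicEquivDegreeLT n).trans (degreeLTEquiv F n).toEquiv
  have : Finite {p : F[X] // p.Monic ∧ p.natDegree = n} := Finite.of_equiv _ e.symm
  exact Set.finite_coe_iff.1 this

/-- monic polynomials of degree `n` -/
noncomputable def monF (F : Type*) [Field F] [Fintype F] (n : ℕ) : Finset F[X] :=
  (finite_monic_natDegree F n).toFinset

theorem mem_monF {F : Type*} [Field F] [Fintype F] {n : ℕ} {f : F[X]} :
    f ∈ monF F n ↔ f.Monic ∧ f.natDegree = n := by
  simp [monF]

open Classical in
/-- monic irreducible polynomials of degree at most `n` -/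
noncomputable def irrF (F : Type*) [Field F] [Fintype F] (n : ℕ) : Finset F[X] :=
  ((Finset.range (n + 1)).biUnion (monF F)).filter Irreducible

theorem mem_irrF {F : Type*} [Field F] [Fintype F] {n : ℕ} {f : F[X]} :
    f ∈ irrF F n ↔ f.Monic ∧ Irreducible f ∧ f.natDegree ≤ n := by
  simp only [irrF, Finset.mem_filter, Finset.mem_biUnion, Finset.mem_range, mem_monF]
  constructor
  · rintro ⟨⟨a, h1, h2, h3⟩, h4⟩; exact ⟨h2, h4, by omega⟩
  · rintro ⟨h1, h2, h3⟩; exact ⟨⟨f.natDegree, by omega, h1, rfl⟩, h2⟩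

/-- the coefficients of the L-function -/
noncomputable def csum {F : Type*} [Field F] [Fintype F] (Ψ : F[X] →* ℂ) (n : ℕ) : ℂ :=
  ∑ f ∈ monF F n, Ψ f

/-- the coefficients of the logarithmic derivative -/
noncomputable def usum {F : Type*} [Field F] [Fintype F] (Ψ : F[X] →* ℂ) (i : ℕ) : ℂ :=
  ∑ p ∈ irrF F i, ∑ k ∈ Finset.Icc 1 i,
    if k * p.natDegree = i then (p.natDegree : ℂ) * Ψ p ^ k else 0

theorem usum_eq {F : Type*} [Field F] [Fintype F] (Ψ : F[X] →* ℂ) (i n : ℕ) (hin : i ≤ n)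
    (hi : 1 ≤ i) :
    usum Ψ i = ∑ p ∈ irrF F n, ∑ k ∈ Finset.Icc 1 n,
      if k * p.natDegree = i then (p.natDegree : ℂ) * Ψ p ^ k else 0 := by
  have h1 : ∀ p ∈ irrF F n, (∑ k ∈ Finset.Icc 1 n,
      if k * p.natDegree = i then (p.natDegree : ℂ) * Ψ p ^ k else 0) =
      ∑ k ∈ Finset.Icc 1 i,
        if k * p.natDegree = i then (p.natDegree : ℂ) * Ψ p ^ k else 0 := by
    intro p hp
    have hpd : 0 < p.natDegree := (mem_irrF.1 hp).2.1.natDegree_pos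
    symm
    refine Finset.sum_subset (Finset.Icc_subset_Icc_right hin) fun k hk hk2 => ?_
    rw [if_neg]
    intro h
    apply hk2
    rw [Finset.mem_Icc] at hk ⊢
    exact ⟨hk.1, by rw [← h]; exact Nat.le_mul_of_pos_right _ hpd⟩
  rw [Finset.sum_congr rfl h1, usum]
  refine Finset.sum_subset ?_ fun p hp hp2 => ?_
  · intro p hp
    rw [mem_irrF] at hp ⊢
    exact ⟨hp.1, hp.2.1, hp.2.2.trans hin⟩
  · refine Finset.sum_eq_zero fun k hk => ?_
    rw [if_neg]
    intro h
    apply hp2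
    rw [mem_irrF] at hp ⊢
    refine ⟨hp.1, hp.2.1, ?_⟩
    rw [Finset.mem_Icc] at hk
    rw [← h]
    exact Nat.le_mul_of_pos_left _ (by omega)

theorem degree_count {F : Type*} [Field F] [Fintype F] (n : ℕ) (f : F[X]) (hf : f ∈ monF F n) :
    n = ∑ p ∈ irrF F n, p.natDegree * ∑ k ∈ Finset.Icc 1 n,
      (open Classical in if p ^ k ∣ f then 1 else 0) := by
  classical
  obtain ⟨hm, hd⟩ := mem_monF.1 hf
  have hf0 := hm.ne_zero
  set S := UniqueFactorizationMonoid.normalizedFactors f with hS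
  have hSm : ∀ p ∈ S, p.Monic ∧ Irreducible p ∧ p ∣ f := by
    intro p hp
    have hirr := UniqueFactorizationMonoid.irreducible_of_normalized_factor p hp
    refine ⟨?_, hirr, UniqueFactorizationMonoid.dvd_of_mem_normalizedFactors hp⟩
    rw [← UniqueFactorizationMonoid.normalize_normalized_factor p hp]
    exact monic_normalize hirr.ne_zero
  have hprod : S.prod = f := by
    have h1 := UniqueFactorizationMonoid.prod_normalizedFactors hf0
    refine eq_of_monic_of_associated ?_ hm h1
    have h2 := monic_multiset_prod_of_monic S id fun p hp => (hSm p hp).1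
    rwa [Multiset.map_id] at h2
  have hdeg : n = (S.map natDegree).sum := by
    rw [← hd, ← natDegree_multiset_prod_of_monic _ fun p hp => (hSm p hp).1, hprod]
  have hcount : ∀ p ∈ irrF F n, (∑ k ∈ Finset.Icc 1 n, if p ^ k ∣ f then 1 else 0) = S.count p := by
    intro p hp
    obtain ⟨hp1, hp2, hp3⟩ := mem_irrF.1 hp
    have h2 : ∀ k, p ^ k ∣ f ↔ k ≤ S.count p := by
      intro k
      rw [pow_dvd_iff_le_emultiplicity,
        UniqueFactorizationMonoid.emultiplicity_eq_count_normalizedFactors hp2 hf0,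
        hp1.normalize_eq_self, Nat.cast_le]
    simp_rw [h2]
    rw [← Finset.sum_filter, Finset.sum_const, smul_eq_mul, mul_one]
    have h3 : S.count p ≤ n := by
      have h4 := natDegree_le_of_dvd ((h2 _).2 le_rfl) hf0
      rw [natDegree_pow, hd] at h4
      exact (Nat.le_mul_of_pos_right _ hp2.natDegree_pos).trans h4
    have h5 : (Finset.Icc 1 n).filter (fun k => k ≤ S.count p) = Finset.Icc 1 (S.count p) := by
      ext k; simp only [Finset.mem_filter, Finset.mem_Icc]; omega
    rw [h5]; simp
  conv_lhs => rw [hdeg, Finset.sum_multiset_map_count]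
  have hR : ∑ p ∈ irrF F n, p.natDegree * ∑ k ∈ Finset.Icc 1 n, (if p ^ k ∣ f then 1 else 0) =
      ∑ p ∈ irrF F n, p.natDegree * S.count p :=
    Finset.sum_congr rfl (fun p hp => by rw [hcount p hp])
  rw [hR]
  simp only [smul_eq_mul]
  simp_rw [mul_comm (Multiset.count _ _)]
  refine Finset.sum_subset ?_ ?_
  · intro p hp
    obtain ⟨h1, h2, h3⟩ := hSm p (Multiset.mem_toFinset.1 hp)
    exact mem_irrF.2 ⟨h1, h2, by rw [← hd]; exact natDegree_le_of_dvd h3 hf0⟩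
  · intro p _ hp
    rw [Multiset.count_eq_zero_of_notMem (by simpa using hp), mul_zero]

theorem sum_dvd_eq {F : Type*} [Field F] [Fintype F] (Ψ : F[X] →* ℂ) (n : ℕ) (g : F[X])
    (hg : g.Monic) :
    ∑ f ∈ monF F n, (open Classical in if g ∣ f then Ψ f else 0) =
      if g.natDegree ≤ n then Ψ g * csum Ψ (n - g.natDegree) else 0 := by
  classical
  rw [← Finset.sum_filter]
  split_ifs with h
  · rw [csum, Finset.mul_sum]
    symm
    refine Finset.sum_bij (fun f _ => g * f) ?_ ?_ ?_ ?_
    · intro f hf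
      rw [mem_monF] at hf
      rw [Finset.mem_filter, mem_monF]
      refine ⟨⟨hg.mul hf.1, ?_⟩, dvd_mul_right _ _⟩
      rw [hg.natDegree_mul hf.1]; omega
    · intro a _ b _ hab
      exact mul_left_cancel₀ hg.ne_zero hab
    · intro f hf
      rw [Finset.mem_filter, mem_monF] at hf
      obtain ⟨⟨h1, h2⟩, w, rfl⟩ := hf
      have hw : w.Monic := hg.of_mul_monic_left h1
      refine ⟨w, ?_, rfl⟩
      rw [hg.natDegree_mul hw] at h2
      rw [mem_monF]
      exact ⟨hw, by omega⟩
    · intro f _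
      rw [map_mul]
  · refine Finset.sum_eq_zero fun f hf => ?_
    rw [Finset.mem_filter, mem_monF] at hf
    exact absurd (natDegree_le_of_dvd hf.2 hf.1.1.ne_zero) (by omega)

theorem csum_rec {F : Type*} [Field F] [Fintype F] (Ψ : F[X] →* ℂ) (n : ℕ) :
    (n : ℂ) * csum Ψ n = ∑ i ∈ Finset.Icc 1 n, usum Ψ i * csum Ψ (n - i) := by
  classical
  have hL : (n : ℂ) * csum Ψ n = ∑ p ∈ irrF F n, ∑ k ∈ Finset.Icc 1 n, (p.natDegree : ℂ) *
      ∑ f ∈ monF F n, if p ^ k ∣ f then Ψ f else 0 := by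
    rw [csum, Finset.mul_sum]
    have h1 : ∀ f ∈ monF F n, (n : ℂ) * Ψ f = ∑ p ∈ irrF F n, ∑ k ∈ Finset.Icc 1 n,
        (p.natDegree : ℂ) * if p ^ k ∣ f then Ψ f else 0 := by
      intro f hf
      have h2 := congrArg (Nat.cast : ℕ → ℂ) (degree_count n f hf)
      conv_lhs => rw [h2]
      push_cast
      rw [Finset.sum_mul]
      refine Finset.sum_congr rfl fun p _ => ?_
      rw [mul_assoc, Finset.sum_mul, Finset.mul_sum]
      refine Finset.sum_congr rfl fun k _ => ?_
      split_ifs <;> simp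
    rw [Finset.sum_congr rfl h1, Finset.sum_comm]
    refine Finset.sum_congr rfl fun p _ => ?_
    rw [Finset.sum_comm]
    refine Finset.sum_congr rfl fun k _ => ?_
    rw [Finset.mul_sum]
  rw [hL]
  have hR : ∀ i ∈ Finset.Icc 1 n, usum Ψ i * csum Ψ (n - i) =
      ∑ p ∈ irrF F n, ∑ k ∈ Finset.Icc 1 n,
      if k * p.natDegree = i then (p.natDegree : ℂ) * Ψ p ^ k * csum Ψ (n - i) else 0 := by
    intro i hi
    rw [Finset.mem_Icc] at hi
    rw [usum_eq Ψ i n hi.2 hi.1, Finset.sum_mul]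
    refine Finset.sum_congr rfl fun p _ => ?_
    rw [Finset.sum_mul]
    refine Finset.sum_congr rfl fun k _ => ?_
    rw [ite_mul, zero_mul]
  rw [Finset.sum_congr rfl hR]
  conv_rhs => rw [Finset.sum_comm]
  refine Finset.sum_congr rfl fun p hp => ?_
  conv_rhs => rw [Finset.sum_comm]
  refine Finset.sum_congr rfl fun k hk => ?_
  obtain ⟨hp1, hp2, hp3⟩ := mem_irrF.1 hp
  rw [sum_dvd_eq Ψ n (p ^ k) (hp1.pow k), natDegree_pow, Finset.sum_ite_eq, map_pow]
  rw [Finset.mem_Icc] at hk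
  have : 1 ≤ k * p.natDegree := Nat.mul_pos hk.1 hp2.natDegree_pos
  by_cases h : k * p.natDegree ≤ n
  · rw [if_pos h, if_pos (Finset.mem_Icc.2 ⟨this, h⟩)]; ring
  · rw [if_neg h, if_neg (fun h2 => h (Finset.mem_Icc.1 h2).2), mul_zero]

/-- The rational-function form of the `L`-function gives power sums. -/
theorem usum_powersum {F : Type*} [Field F] [Fintype F] (Ψ : F[X] →* ℂ) (m : ℕ)
    (hc : ∀ j, m < j → csum Ψ j = 0) :
    ∃ ω : Multiset ℂ, ω.card = m ∧ ∀ n, 1 ≤ n → usum Ψ n = -(ω.map (fun z => z ^ n)).sum := by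
  refine newton_of_rec (csum Ψ) (usum Ψ) m ?_ hc (csum_rec Ψ)
  have : monF F 0 = {1} := by
    ext f
    rw [mem_monF, Finset.mem_singleton]
    constructor
    · rintro ⟨h1, h2⟩; exact h1.natDegree_eq_zero.1 h2
    · rintro rfl; exact ⟨monic_one, natDegree_one⟩
  rw [csum, this, Finset.sum_singleton, map_one]


theorem csum_vanish {F : Type*} [Field F] [Fintype F] (Ψ : F[X] →* ℂ) (M : F[X]) (hM : M.Monic)
    (hper : ∀ f g, M ∣ f - g → Ψ f = Ψ g) (u : F[X]) (hu : IsCoprime u M) (hu1 : Ψ u ≠ 1)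
    (j : ℕ) (hj : M.natDegree ≤ j) : csum Ψ j = 0 := by
  classical
  have hfin : Finite (AdjoinRoot M) := by
    have := hM.finite_adjoinRoot
    exact Module.finite_of_finite F
  have := Fintype.ofFinite (AdjoinRoot M)
  set rep := AdjoinRoot.modByMonicHom hM with hrep
  have hmk : ∀ a, AdjoinRoot.mk M (rep a) = a := AdjoinRoot.mk_leftInverse hM
  have hdeg : ∀ a, (rep a).degree < M.degree := by
    intro a
    obtain ⟨f, rfl⟩ := AdjoinRoot.mk_surjective a
    rw [hrep, AdjoinRoot.modByMonicHom_mk]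
    exact degree_modByMonic_lt _ hM
  set φ : AdjoinRoot M → ℂ := fun a => Ψ (rep a) with hφ
  have hφmk : ∀ f, φ (AdjoinRoot.mk M f) = Ψ f := by
    intro f
    refine hper _ _ ?_
    rw [← AdjoinRoot.mk_eq_mk, hmk]
  have hunit : IsUnit (AdjoinRoot.mk M u) := by
    obtain ⟨a, b, hab⟩ := hu
    have h1 := congrArg (AdjoinRoot.mk M) hab
    rw [map_add, map_mul, map_mul, AdjoinRoot.mk_self, mul_zero, add_zero, map_one] at h1
    exact IsUnit.of_mul_eq_one_right _ h1
  have hsum : ∑ a, φ a = 0 := by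
    have h1 : ∑ a, φ (AdjoinRoot.mk M u * a) = ∑ a, φ a :=
      Fintype.sum_bijective _ (IsUnit.isUnit_iff_mulLeft_bijective.1 hunit) _ _ fun _ => rfl
    have h2 : ∀ a, φ (AdjoinRoot.mk M u * a) = Ψ u * φ a := by
      intro a
      obtain ⟨f, rfl⟩ := AdjoinRoot.mk_surjective a
      rw [← map_mul, hφmk, hφmk, map_mul]
    simp_rw [h2] at h1
    rw [← Finset.mul_sum] at h1
    have h3 : (Ψ u - 1) * ∑ a, φ a = 0 := by rw [sub_mul, h1, one_mul, sub_self]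
    exact (mul_eq_zero.1 h3).resolve_left (sub_ne_zero.2 hu1)
  have hshift : ∀ r : F[X], r.degree < M.degree → ∑ f ∈ monF F j, Ψ (f + r) = csum Ψ j := by
    intro r hr
    have hmem : ∀ r : F[X], r.degree < M.degree → ∀ f ∈ monF F j, f + r ∈ monF F j := by
      intro r hr f hf
      rw [mem_monF] at hf ⊢
      have hlt : r.degree < f.degree := by
        refine hr.trans_le ?_
        rw [degree_eq_natDegree hM.ne_zero, degree_eq_natDegree hf.1.ne_zero, hf.2]
        exact_mod_cast hj
      refine ⟨hf.1.add_of_left hlt, ?_⟩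
      rw [natDegree_add_eq_left_of_degree_lt hlt, hf.2]
    rw [csum]
    refine Finset.sum_bij (fun f _ => f + r) (hmem r hr) ?_ ?_ ?_
    · intro a _ b _ hab; exact add_right_cancel hab
    · intro b hb
      refine ⟨b + -r, hmem (-r) (by rwa [degree_neg]) b hb, by ring⟩
    · intro f _; rfl
  have hall : (Fintype.card (AdjoinRoot M) : ℂ) * csum Ψ j = 0 := by
    have h1 : ∑ a : AdjoinRoot M, ∑ f ∈ monF F j, Ψ (f + rep a) =
        (Fintype.card (AdjoinRoot M) : ℂ) * csum Ψ j := by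
      rw [Finset.sum_congr rfl fun a _ => hshift _ (hdeg a), Finset.sum_const, nsmul_eq_mul]
      rfl
    rw [← h1, Finset.sum_comm]
    refine Finset.sum_eq_zero fun f _ => ?_
    rw [← hsum]
    refine Fintype.sum_bijective (fun a => AdjoinRoot.mk M f + a) (Equiv.addLeft (AdjoinRoot.mk M f)).bijective _ _ ?_
    intro a
    rw [← hφmk, map_add, hmk]
  refine (mul_eq_zero.1 hall).resolve_left ?_
  exact_mod_cast Fintype.card_ne_zero

/-- The character `f ↦ ∏ χ(N(f mod p))^{a p}`. -/
noncomputable def psiHom {F : Type*} [Field F] (χ : MulChar F ℂ) (I : Finset F[X])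
    (a : F[X] → ℕ) : F[X] →* ℂ :=
  ∏ p ∈ I, ((χ.toMonoidHom.comp (Algebra.norm F)).comp
    ((AdjoinRoot.mk p : F[X] →+* AdjoinRoot p) : F[X] →* AdjoinRoot p)) ^ (a p)

theorem psiHom_apply {F : Type*} [Field F] (χ : MulChar F ℂ) (I : Finset F[X])
    (a : F[X] → ℕ) (f : F[X]) :
    psiHom χ I a f = ∏ p ∈ I, χ (Algebra.norm F (AdjoinRoot.mk p f)) ^ (a p) := by
  rw [psiHom, MonoidHom.finsetProd_apply]
  rfl

theorem psiHom_usum {F : Type*} [Field F] [Fintype F] (χ : MulChar F ℂ) (I : Finset F[X])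
    (hI : ∀ p ∈ I, p.Monic ∧ Irreducible p) (a : F[X] → ℕ) (p0 : F[X]) (hp0 : p0 ∈ I)
    (x : Fˣ) (hx : χ x ^ (a p0) ≠ 1) :
    ∃ ω : Multiset ℂ, ω.card + 1 ≤ (∏ p ∈ I, p).natDegree ∧
      ∀ n, 1 ≤ n → usum (psiHom χ I a) n = -(ω.map (fun z => z ^ n)).sum := by
  classical
  set M := ∏ p ∈ I, p with hM
  have hMm : M.Monic := monic_prod_of_monic _ _ fun p hp => (hI p hp).1
  have hdiv : ∀ p ∈ I, p ∣ M := fun p hp => Finset.dvd_prod_of_mem _ hp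
  have hp0i := (hI p0 hp0).2
  have : Fact (Irreducible p0) := ⟨hp0i⟩
  have : Finite (AdjoinRoot p0) := by
    have := (hI p0 hp0).1.finite_adjoinRoot
    exact Module.finite_of_finite F
  obtain ⟨y, hy⟩ := FiniteField.norm_surjective F (AdjoinRoot p0) (x : F)
  obtain ⟨g, rfl⟩ := AdjoinRoot.mk_surjective y
  set M' := ∏ p ∈ I.erase p0, p with hM'
  have hcop : ∀ p ∈ I, ∀ p' ∈ I, p ≠ p' → IsCoprime p p' := by
    intro p hp p' hp' hne
    rw [(hI p hp).2.coprime_iff_not_dvd]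
    intro hd
    exact hne (eq_of_monic_of_associated (hI p hp).1 (hI p' hp').1
      (((hI p hp).2.associated_of_dvd (hI p' hp').2 hd)))
  have hcop0 : IsCoprime p0 M' := IsCoprime.prod_right fun p hp =>
    hcop _ hp0 _ (Finset.mem_of_mem_erase hp) (Finset.ne_of_mem_erase hp).symm
  obtain ⟨b, c, hbc⟩ := hcop0
  set u : F[X] := 1 + c * M' * (g - 1) with hu
  have hu0 : AdjoinRoot.mk p0 u = AdjoinRoot.mk p0 g := by
    rw [AdjoinRoot.mk_eq_mk]
    refine ⟨- b * (g - 1), ?_⟩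
    rw [hu]; linear_combination (g - 1) * hbc
  have hup : ∀ p ∈ I.erase p0, AdjoinRoot.mk p u = 1 := by
    intro p hp
    rw [← map_one (AdjoinRoot.mk p), AdjoinRoot.mk_eq_mk]
    obtain ⟨w, hw⟩ : p ∣ M' := Finset.dvd_prod_of_mem _ hp
    exact ⟨c * w * (g - 1), by rw [hu, hw]; ring⟩
  have hΨu : psiHom χ I a u = χ x ^ (a p0) := by
    rw [psiHom_apply, ← Finset.mul_prod_erase _ _ hp0, hu0, hy]
    rw [Finset.prod_eq_one, mul_one]
    intro p hp
    rw [hup p hp, map_one, map_one, one_pow]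
  have hucop : IsCoprime u M := by
    refine IsCoprime.prod_right fun p hp => ?_
    refine IsCoprime.symm ?_
    rw [(hI p hp).2.coprime_iff_not_dvd, ← AdjoinRoot.mk_eq_zero]
    by_cases h : p = p0
    · subst h
      rw [hu0]
      intro h0
      rw [h0] at hy
      have h2 : Algebra.norm F (0 : AdjoinRoot p) = 0 := by
        have := (hI p hp).1.finite_adjoinRoot
        exact Algebra.norm_zero
      rw [h2] at hy
      exact x.ne_zero hy.symm
    · rw [hup p (Finset.mem_erase.2 ⟨h, hp⟩)]
      have : Fact (Irreducible p) := ⟨(hI p hp).2⟩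
      exact one_ne_zero
  have hdpos : 1 ≤ M.natDegree :=
    hp0i.natDegree_pos.trans_le (natDegree_le_of_dvd (hdiv p0 hp0) hMm.ne_zero)
  obtain ⟨ω, h1, h2⟩ := usum_powersum (psiHom χ I a) (M.natDegree - 1) (by
    intro j hj
    refine csum_vanish _ M hMm ?_ u hucop (by rwa [hΨu]) j (by omega)
    intro f g hfg
    rw [psiHom_apply, psiHom_apply]
    refine Finset.prod_congr rfl fun p hp => ?_
    rw [AdjoinRoot.mk_eq_mk.2 ((hdiv p hp).trans hfg)])
  exact ⟨ω, by omega, h2⟩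


theorem norm_adjoinRoot_eq_resultant {F : Type*} [Field F] [Fintype F] (f g : F[X])
    (hf : f.Monic) (hfi : Irreducible f) :
    Algebra.norm F (AdjoinRoot.mk f g) = resultant f g f.natDegree g.natDegree := by
  classical
  have : Fact (Irreducible f) := ⟨hfi⟩
  have := hf.finite_adjoinRoot
  set Ω := AlgebraicClosure F
  apply (algebraMap F Ω).injective
  rw [Algebra.norm_eq_prod_embeddings, ← resultant_map_map]
  have hsep : f.Separable := PerfectField.separable_of_irreducible hfi
  have h1 := resultant_eq_prod_eval (f.map (algebraMap F Ω)) (g.map (algebraMap F Ω)) g.natDegree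
    natDegree_map_le (IsAlgClosed.splits _)
  rw [natDegree_map] at h1
  rw [h1, (hf.map _).leadingCoeff, one_pow, one_mul]
  have hnd : (f.aroots Ω).Nodup := nodup_roots (hsep.map)
  change _ = ((f.aroots Ω).map _).prod
  have h2 : ((f.aroots Ω).map (fun x => eval x (g.map (algebraMap F Ω)))).prod =
      ∏ x ∈ (f.aroots Ω).toFinset, eval x (g.map (algebraMap F Ω)) := by
    rw [Finset.prod_eq_multiset_prod, Multiset.toFinset_val, hnd.dedup]
  rw [h2, Finset.prod_subtype (p := fun x => x ∈ f.aroots Ω) _ (fun x => Multiset.mem_toFinset)]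
  refine Fintype.prod_equiv (AdjoinRoot.equiv Ω F f hf.ne_zero) _ _ fun σ => ?_
  have h3 : ((AdjoinRoot.equiv Ω F f hf.ne_zero σ : {x // x ∈ f.aroots Ω}) : Ω) =
      σ (AdjoinRoot.root f) := by
    simp [AdjoinRoot.equiv]
  rw [h3, eval_map_algebraMap, aeval_algHom_apply, AdjoinRoot.aeval_eq]

theorem norm_reciprocity {F : Type*} [Field F] [Fintype F] (f g : F[X])
    (hf : f.Monic) (hfi : Irreducible f) (hg : g.Monic) (hgi : Irreducible g) :
    Algebra.norm F (AdjoinRoot.mk f g) =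
      (-1) ^ (f.natDegree * g.natDegree) * Algebra.norm F (AdjoinRoot.mk g f) := by
  rw [norm_adjoinRoot_eq_resultant f g hf hfi, norm_adjoinRoot_eq_resultant g f hg hgi,
    resultant_comm]

theorem norm_aeval_eq {F L : Type*} [Field F] [Fintype F] [Field L] [Fintype L] [Algebra F L]
    (α : L) (p : F[X]) (hp : p.Monic) (hpi : Irreducible p) :
    Algebra.norm F (aeval α p) = (-1) ^ (Module.finrank F L * p.natDegree) *
      Algebra.norm F (AdjoinRoot.mk p (minpoly F α)) ^
        (Module.finrank F L / (minpoly F α).natDegree) := by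
  have hα : IsIntegral F α := Algebra.IsIntegral.isIntegral α
  set m := minpoly F α with hm
  set δ := m.natDegree with hδ
  have hfr : δ * Module.finrank (IntermediateField.adjoin F {α}) L = Module.finrank F L := by
    rw [hδ, hm, ← IntermediateField.adjoin.finrank hα, Module.finrank_mul_finrank]
  have hδ0 : 0 < δ := minpoly.natDegree_pos hα
  have hk : Module.finrank (IntermediateField.adjoin F {α}) L = Module.finrank F L / δ := by
    rw [← hfr, Nat.mul_div_cancel_left _ hδ0]
  have h1 : aeval α p = algebraMap (IntermediateField.adjoin F {α}) L
      (IntermediateField.adjoinRootEquivAdjoin F hα (AdjoinRoot.mk (minpoly F α) p)) := by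
    have h0 := aeval_algHom_apply (IntermediateField.adjoinRootEquivAdjoin F hα).toAlgHom
      (AdjoinRoot.root (minpoly F α)) p
    rw [← AdjoinRoot.aeval_eq]
    refine Eq.trans ?_ (congrArg (algebraMap (IntermediateField.adjoin F {α}) L) h0)
    have h00 : (IntermediateField.adjoinRootEquivAdjoin F hα).toAlgHom
      (AdjoinRoot.root (minpoly F α)) = IntermediateField.AdjoinSimple.gen F α :=
      IntermediateField.adjoinRootEquivAdjoin_apply_root F hα
    rw [h00]
    rw [← aeval_algebraMap_apply, IntermediateField.AdjoinSimple.algebraMap_gen]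
  rw [h1, ← Algebra.norm_norm (S := IntermediateField.adjoin F {α}), Algebra.norm_algebraMap,
    map_pow, Algebra.norm_eq_of_algEquiv, hk,
    norm_reciprocity _ p (minpoly.monic hα) (minpoly.irreducible hα) hp hpi, mul_pow, ← pow_mul]
  congr 2
  rw [← hm, ← hδ, mul_right_comm, ← hk, hfr]

theorem card_minpoly_fibre {F L : Type*} [Field F] [Fintype F] [Field L] [Fintype L] [Algebra F L]
    (p : F[X]) (hp : p.Monic) (hpi : Irreducible p) :
    (open Classical in (Finset.univ.filter (fun α : L => minpoly F α = p)).card) =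
      if p.natDegree ∣ Module.finrank F L then p.natDegree else 0 := by
  classical
  split_ifs with h
  · have h1 : Finset.univ.filter (fun α : L => minpoly F α = p) = (p.aroots L).toFinset := by
      ext α
      rw [Finset.mem_filter, Multiset.mem_toFinset, mem_aroots]
      constructor
      · rintro ⟨_, rfl⟩
        exact ⟨hpi.ne_zero, minpoly.aeval _ _⟩
      · rintro ⟨_, h2⟩
        exact ⟨Finset.mem_univ _, (minpoly.eq_of_irreducible_of_monic hpi h2 hp).symm⟩
    have hsep : p.Separable := PerfectField.separable_of_irreducible hpi
    have hspl : (p.map (algebraMap F L)).Splits := by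
      have h2 : p ∣ X ^ (Nat.card F) ^ Module.finrank F L - X :=
        (hpi.natDegree_dvd_iff_dvd_X_pow_card_pow_sub_X).1 h
      have h3 : Nat.card F ^ Module.finrank F L = Fintype.card L := by
        rw [← Module.natCard_eq_pow_finrank, Nat.card_eq_fintype_card]
      rw [h3] at h2
      have h4 := (FiniteField.isSplittingField_sub L F).splits
      refine Splits.of_dvd h4 ?_ (Polynomial.map_dvd _ h2)
      rw [Polynomial.map_ne_zero_iff (algebraMap F L).injective]
      exact FiniteField.X_pow_card_sub_X_ne_zero F Fintype.one_lt_card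
    rw [h1, Multiset.toFinset_card_of_nodup (nodup_roots hsep.map),
      splits_iff_card_roots.1 hspl, natDegree_map]
  · rw [Finset.card_eq_zero, Finset.filter_eq_empty_iff]
    rintro α _ rfl
    exact h (minpoly.degree_dvd (Algebra.IsIntegral.isIntegral α))

theorem usum_eq_field {F : Type*} (L : Type*) [Field F] [Fintype F] [Field L] [Fintype L]
    [Algebra F L] (Ψ : F[X] →* ℂ) :
    usum Ψ (Module.finrank F L) =
      ∑ α : L, Ψ (minpoly F α) ^ (Module.finrank F L / (minpoly F α).natDegree) := by
  classical
  set n := Module.finrank F L with hn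
  have hn0 : 0 < n := Module.finrank_pos
  have hmaps : ∀ α ∈ (Finset.univ : Finset L), minpoly F α ∈ irrF F n := by
    intro α _
    have hα : IsIntegral F α := Algebra.IsIntegral.isIntegral α
    exact mem_irrF.2 ⟨minpoly.monic hα, minpoly.irreducible hα, minpoly.natDegree_le α⟩
  rw [← Finset.sum_fiberwise_of_maps_to hmaps, usum]
  refine Finset.sum_congr rfl fun p hp => ?_
  obtain ⟨hp1, hp2, hp3⟩ := mem_irrF.1 hp
  have h1 : ∑ α : L with minpoly F α = p, Ψ (minpoly F α) ^ (n / (minpoly F α).natDegree) =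
      ∑ α : L with minpoly F α = p, Ψ p ^ (n / p.natDegree) := by
    refine Finset.sum_congr rfl fun α hα => ?_
    rw [(Finset.mem_filter.1 hα).2]
  rw [h1, Finset.sum_const, nsmul_eq_mul, card_minpoly_fibre p hp1 hp2, ← hn]
  have hd0 := hp2.natDegree_pos
  split_ifs with h
  · obtain ⟨k, hk⟩ := h
    have hk0 : 0 < k := Nat.pos_of_ne_zero (by rintro rfl; omega)
    rw [hk, Nat.mul_div_cancel_left _ hd0, Finset.sum_eq_single k]
    · rw [if_pos (mul_comm _ _)]
    · intro b _ hb
      rw [if_neg]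
      intro h2
      rw [mul_comm] at h2
      exact hb (Nat.eq_of_mul_eq_mul_left hd0 h2)
    · intro h2
      exfalso; apply h2
      rw [Finset.mem_Icc]
      exact ⟨hk0, Nat.le_mul_of_pos_left _ hd0⟩
  · rw [Nat.cast_zero, zero_mul]
    refine Finset.sum_eq_zero fun k _ => ?_
    rw [if_neg]
    intro h2
    exact h ⟨k, by rw [← h2, mul_comm]⟩

/-- the character sum over the extension field -/
noncomputable def fsum {F : Type*} [Field F] (L : Type*) [Field L] [Fintype L]
    [Algebra F L] (χ : MulChar F ℂ) (I : Finset F[X]) (a : F[X] → ℕ) : ℂ :=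
  ∑ α : L, ∏ p ∈ I, χ (Algebra.norm F (aeval α p)) ^ (a p)

theorem norm_fsum {F : Type*} (L : Type*) [Field F] [Fintype F] [Field L] [Fintype L]
    [Algebra F L] (χ : MulChar F ℂ) (I : Finset F[X]) (hI : ∀ p ∈ I, p.Monic ∧ Irreducible p)
    (a : F[X] → ℕ) :
    ‖fsum L χ I a‖ = ‖usum (psiHom χ I a) (Module.finrank F L)‖ := by
  set n := Module.finrank F L with hn
  set ε : ℂ := ∏ p ∈ I, χ ((-1) ^ (n * p.natDegree)) ^ (a p) with hε
  have hε1 : ‖ε‖ = 1 := by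
    rw [hε, norm_prod]
    refine Finset.prod_eq_one fun p _ => ?_
    have : χ ((-1) ^ (n * p.natDegree)) ^ 2 = 1 := by
      rw [← map_pow, ← pow_mul, mul_comm, pow_mul]; simp
    rw [norm_pow, Complex.norm_eq_one_of_pow_eq_one this two_ne_zero, one_pow]
  have : fsum L χ I a = ε * usum (psiHom χ I a) n := by
    rw [hn, usum_eq_field L, fsum, Finset.mul_sum]
    refine Finset.sum_congr rfl fun α _ => ?_
    rw [psiHom_apply, ← Finset.prod_pow, hε, ← Finset.prod_mul_distrib]
    refine Finset.prod_congr rfl fun p hp => ?_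
    rw [norm_aeval_eq α p (hI p hp).1 (hI p hp).2, map_mul, map_pow χ (Algebra.norm F _), mul_pow,
      pow_right_comm]
  rw [this, norm_mul, hε1, one_mul]


theorem prod_pow_not_power {F K : Type*} [Field F] [Fintype F] [Field K] [Algebra F K]
    (I : Finset F[X]) (hI : ∀ p ∈ I, p.Monic ∧ Irreducible p) (b : F[X] → ℕ) (p0 : F[X])
    (hp0 : p0 ∈ I) (l : ℕ) (hl : ¬ l ∣ b p0) (c : K) (w : K[X]) :
    (∏ p ∈ I, p ^ b p).map (algebraMap F K) ≠ Polynomial.C c * w ^ l := by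
  classical
  intro heq
  set Ω := AlgebraicClosure K
  have h1 := congrArg (fun f => f.map (algebraMap K Ω)) heq
  rw [map_map, ← Finset.mul_prod_erase _ _ hp0, Polynomial.map_mul, Polynomial.map_pow,
    Polynomial.map_mul, Polynomial.map_pow, map_C] at h1
  set φ := (algebraMap K Ω).comp (algebraMap F K) with hφ
  set R := ∏ p ∈ I.erase p0, p ^ b p with hR
  have hcop : IsCoprime p0 R := by
    refine IsCoprime.prod_right fun p hp => IsCoprime.pow_right ?_
    have hpI := Finset.mem_of_mem_erase hp
    rw [(hI p0 hp0).2.coprime_iff_not_dvd]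
    intro hd
    exact (Finset.ne_of_mem_erase hp) (eq_of_monic_of_associated (hI p0 hp0).1 (hI p hpI).1
      (((hI p0 hp0).2.associated_of_dvd (hI p hpI).2 hd))).symm
  have hRm : R.Monic := monic_prod_of_monic _ _ fun p hp =>
    ((hI p (Finset.mem_of_mem_erase hp)).1).pow _
  have hp0m := (hI p0 hp0).1
  have hsep : p0.Separable := PerfectField.separable_of_irreducible (hI p0 hp0).2
  obtain ⟨β, hβ⟩ := IsAlgClosed.exists_root (p0.map φ) (by
    rw [degree_map]
    exact ((hI p0 hp0).2.degree_pos).ne')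
  have hp0ne : p0.map φ ≠ 0 := (hp0m.map φ).ne_zero
  have hRne : R.map φ ≠ 0 := (hRm.map φ).ne_zero
  have hc0 : (p0.map φ).roots.count β = 1 :=
    Multiset.count_eq_one_of_mem (nodup_roots hsep.map) ((mem_roots hp0ne).2 hβ)
  have hcR : (R.map φ).roots.count β = 0 := by
    rw [Multiset.count_eq_zero, mem_roots hRne]
    intro hRβ
    obtain ⟨x, y, hxy⟩ := hcop
    have h2 := congrArg (fun f => (f.map φ).eval β) hxy
    simp only [Polynomial.map_add, Polynomial.map_mul, eval_add, eval_mul, Polynomial.map_one,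
      eval_one] at h2
    rw [hβ.eq_zero, hRβ.eq_zero] at h2
    simp at h2
  have hne : (p0.map φ) ^ b p0 * R.map φ ≠ 0 := mul_ne_zero (pow_ne_zero _ hp0ne) hRne
  have hcne : (algebraMap K Ω) c ≠ 0 := by
    intro h
    rw [h, C_0, zero_mul] at h1
    exact hne h1
  have h3 := congrArg (fun f => f.roots.count β) h1
  rw [roots_mul hne, roots_C_mul _ hcne, roots_pow, roots_pow, Multiset.count_add,
    Multiset.count_nsmul, Multiset.count_nsmul, hc0, hcR, mul_one, add_zero] at h3
  exact hl ⟨_, h3⟩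

/-- the multiplicative character lifted through the norm -/
noncomputable def normChar {F : Type*} (K : Type*) [Field F] [Field K] [Algebra F K]
    [FiniteDimensional F K] (χ : MulChar F ℂ) : MulChar K ℂ where
  toMonoidHom := χ.toMonoidHom.comp (Algebra.norm F)
  map_nonunit' := by
    intro x hx
    have : x = 0 := by
      by_contra h; exact hx (isUnit_iff_ne_zero.2 h)
    subst this
    change χ (Algebra.norm F (0 : K)) = 0
    rw [Algebra.norm_zero, MulChar.map_zero]

theorem normChar_apply {F K : Type*} [Field F] [Field K] [Algebra F K]
    [FiniteDimensional F K] (χ : MulChar F ℂ) (x : K) :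
    normChar K χ x = χ (Algebra.norm F x) := rfl

set_option maxHeartbeats 1000000 in
theorem fsum_even_bound {F : Type*} [Field F] [Fintype F] (p : ℕ) [Fact p.Prime] [CharP F p]
    (χ : MulChar F ℂ) (hχ : orderOf χ = Fintype.card F - 1)
    (I : Finset F[X]) (hI : ∀ p ∈ I, p.Monic ∧ Irreducible p) (a : F[X] → ℕ)
    (ha : ∀ p ∈ I, a p < Fintype.card F - 1) (p0 : F[X]) (hp0 : p0 ∈ I) (ha0 : a p0 ≠ 0) :
    ∃ (C : ℝ) (N0 : ℕ), 1 ≤ N0 ∧ ∀ N, N0 ≤ N →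
      ‖usum (psiHom χ I a) (2 * N)‖ ≤ C * (Fintype.card F : ℝ) ^ N := by
  classical
  set q := Fintype.card F with hq
  have hq1 : 1 < q := Fintype.one_lt_card
  set g := Nat.gcd (q - 1) (I.gcd a) with hg
  have hgq : g ∣ q - 1 := Nat.gcd_dvd_left _ _
  have hga : ∀ p ∈ I, g ∣ a p := fun p hp => (Nat.gcd_dvd_right _ _).trans (Finset.gcd_dvd hp)
  have hg0 : 0 < g := Nat.gcd_pos_of_pos_left _ (by omega)
  have hglt : g < q - 1 :=
    (Nat.le_of_dvd (Nat.pos_of_ne_zero ha0) (hga p0 hp0)).trans_lt (ha p0 hp0)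
  obtain ⟨e, he⟩ := hgq
  have he0 : 0 < e := Nat.pos_of_ne_zero (by rintro rfl; omega)
  set b : F[X] → ℕ := fun p => a p / g with hb
  have hab : ∀ p ∈ I, a p = g * b p := fun p hp => (Nat.mul_div_cancel' (hga p hp)).symm
  set h1 : F[X] := ∏ p ∈ I, p ^ b p with hh1
  have hh1m : h1.Monic := monic_prod_of_monic _ _ fun p hp => ((hI p hp).1).pow _
  obtain ⟨C, s0, hC⟩ := charsum_bound e h1.natDegree he0
  refine ⟨C, s0 + 1, by omega, ?_⟩
  intro N hN
  have : NeZero (2 * N) := ⟨by omega⟩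
  set K := FiniteField.Extension F p (2 * N) with hK
  let _ : Fintype K := Fintype.ofFinite K
  have hKfr : Module.finrank F K = 2 * N := FiniteField.finrank_extension F p (2 * N)
  have hKcard : Fintype.card K = (q ^ N) ^ 2 := by
    rw [← Nat.card_eq_fintype_card, FiniteField.natCard_extension, Nat.card_eq_fintype_card,
      mul_comm, pow_mul]
  have hdvd : q - 1 ∣ (q ^ N) ^ 2 - 1 := by
    rw [← pow_mul]
    simpa using Nat.sub_dvd_pow_sub_pow q 1 (N * 2)
  obtain ⟨t', ht'⟩ := hdvd
  have hqpos : 0 < (q ^ N) ^ 2 := by positivity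
  have hset : e * (g * t') + 1 = Fintype.card K := by
    rw [hKcard, ← mul_assoc, mul_comm e g, ← he, ← ht']
    omega
  have hs0 : s0 ≤ q ^ N := by
    have := Nat.lt_pow_self hq1 (n := N)
    omega
  have key := hC K (q ^ N) (g * t') (h1.map (algebraMap F K)) (normChar K (χ ^ g)) hKcard hs0
    (hh1m.map _) (natDegree_map _) hset ?_ ?_ ?_
  · rw [← hKfr, ← norm_fsum K χ I hI a]
    have hsum : ∑ x : K, normChar K (χ ^ g) ((h1.map (algebraMap F K)).eval x) =
        fsum K χ I a := by
      rw [fsum]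
      refine Finset.sum_congr rfl fun x _ => ?_
      rw [normChar_apply, MulChar.pow_apply' _ hg0.ne', eval_map_algebraMap, hh1, map_prod,
        map_prod, map_prod, ← Finset.prod_pow]
      refine Finset.prod_congr rfl fun p hp => ?_
      rw [map_pow, map_pow, map_pow, ← pow_mul, hab p hp, mul_comm g]
    rw [← hsum]
    exact_mod_cast key
  · ext u
    rw [MulChar.pow_apply' _ he0.ne', normChar_apply, ← MulChar.pow_apply' _ he0.ne', ← pow_mul,
      ← he, ← hχ, pow_orderOf_eq_one, MulChar.one_apply_coe]
    exact MulChar.one_apply ((u.isUnit).map (Algebra.norm F))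
  · intro h
    have hχg : χ ^ g ≠ 1 := by
      intro h2
      have := Nat.le_of_dvd hg0 (orderOf_dvd_of_pow_eq_one h2)
      omega
    apply hχg
    ext u
    obtain ⟨y, hy⟩ := FiniteField.norm_surjective F K (u : F)
    have hy0 : y ≠ 0 := by
      rintro rfl
      rw [Algebra.norm_zero] at hy
      exact u.ne_zero hy.symm
    have h3 := congrArg (fun η : MulChar K ℂ => η y) h
    rw [normChar_apply, hy, MulChar.one_apply (isUnit_iff_ne_zero.2 hy0)] at h3
    rw [h3, MulChar.one_apply_coe]
  · intro l hl hle c w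
    obtain ⟨p1, hp1, hlp⟩ : ∃ p1 ∈ I, ¬ l ∣ b p1 := by
      by_contra hcon
      push Not at hcon
      have h2 : g * l ∣ g := by
        conv_rhs => rw [hg]
        refine Nat.dvd_gcd ?_ (Finset.dvd_gcd fun p hp => ?_)
        · rw [he]; exact Nat.mul_dvd_mul_left _ hle
        · rw [hab p hp]; exact Nat.mul_dvd_mul_left _ (hcon p hp)
      have h3 := Nat.le_of_dvd hg0 h2
      have := hl.two_le
      nlinarith
    exact prod_pow_not_power I hI b p1 hp1 l hlp c w

theorem fsum_bound {F : Type*} (L : Type*) [Field F] [Fintype F] [Field L] [Fintype L]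
    [Algebra F L] (χ : MulChar F ℂ) (hχ : orderOf χ = Fintype.card F - 1)
    (I : Finset F[X]) (hI : ∀ p ∈ I, p.Monic ∧ Irreducible p) (a : F[X] → ℕ)
    (ha : ∀ p ∈ I, a p < Fintype.card F - 1) (p0 : F[X]) (hp0 : p0 ∈ I) (ha0 : a p0 ≠ 0) :
    ‖fsum L χ I a‖ ≤ ((∏ p ∈ I, p).natDegree - 1 : ℝ) *
      Real.sqrt ((Fintype.card F : ℝ)) ^ (Module.finrank F L) := by
  set q := Fintype.card F with hq
  have hq1 : 1 < q := Fintype.one_lt_card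
  have hqR : (0 : ℝ) < q := by exact_mod_cast (by omega : 0 < q)
  obtain ⟨p, hp⟩ := CharP.exists F
  have : Fact p.Prime := ⟨CharP.char_is_prime F p⟩
  obtain ⟨C, N0, hN0, hC⟩ := fsum_even_bound p χ hχ I hI a ha p0 hp0 ha0
  obtain ⟨x, hx⟩ : ∃ x : Fˣ, χ x ^ a p0 ≠ 1 := by
    by_contra hcon
    push Not at hcon
    have h2 : χ ^ a p0 = 1 := by
      ext u
      rw [MulChar.pow_apply' _ ha0, hcon, MulChar.one_apply_coe]
    have h3 := Nat.le_of_dvd (Nat.pos_of_ne_zero ha0) (orderOf_dvd_of_pow_eq_one h2)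
    have := ha p0 hp0
    omega
  obtain ⟨ω, hω1, hω2⟩ := psiHom_usum χ I hI a p0 hp0 x hx
  have hle := norm_le_one_of_powersum (ω.map (fun z => z ^ 2 / (q : ℂ))) C N0 (by
    intro j hj
    have h1 := hC j hj
    rw [hω2 (2 * j) (by omega), norm_neg] at h1
    rw [Multiset.map_map]
    have h2 : (ω.map ((fun z => z ^ j) ∘ fun z => z ^ 2 / (q : ℂ))).sum =
        (ω.map (fun z => z ^ (2 * j))).sum * ((q : ℂ) ^ j)⁻¹ := by
      rw [← Multiset.sum_map_mul_right]
      congr 1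
      refine Multiset.map_congr rfl fun z _ => ?_
      simp only [Function.comp_apply]
      rw [div_pow, ← pow_mul, div_eq_mul_inv]
    rw [h2, norm_mul, norm_inv, norm_pow, Complex.norm_natCast, ← div_eq_mul_inv,
      div_le_iff₀ (by positivity)]
    exact h1)
  have hz : ∀ z ∈ ω, ‖z‖ ≤ Real.sqrt q := by
    intro z hz
    have h1 := hle _ (Multiset.mem_map_of_mem _ hz)
    rw [norm_div, norm_pow, Complex.norm_natCast, div_le_one hqR] at h1
    exact Real.le_sqrt_of_sq_le h1
  have hn : 1 ≤ Module.finrank F L := Module.finrank_pos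
  rw [norm_fsum L χ I hI a, hω2 _ hn, norm_neg]
  set n := Module.finrank F L
  have h4 : ‖(ω.map (fun z => z ^ n)).sum‖ ≤ ω.card * Real.sqrt q ^ n := by
    refine (norm_multiset_sum_le _).trans ?_
    rw [Multiset.map_map]
    have := Multiset.sum_le_card_nsmul (ω.map (norm ∘ fun z => z ^ n)) (Real.sqrt q ^ n) (by
      intro y hy
      obtain ⟨z, hz1, rfl⟩ := Multiset.mem_map.1 hy
      simp only [Function.comp_apply, norm_pow]
      exact pow_le_pow_left₀ (norm_nonneg _) (hz z hz1) n)
    rw [Multiset.card_map, nsmul_eq_mul] at this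
    exact this
  refine h4.trans (mul_le_mul_of_nonneg_right ?_ (by positivity))
  have : (ω.card : ℝ) + 1 ≤ (∏ p ∈ I, p).natDegree := by exact_mod_cast hω1
  linarith


theorem exists_full_char (F : Type*) [Field F] [Fintype F] :
    ∃ χ : MulChar F ℂ, orderOf χ = Fintype.card F - 1 := by
  have h1 : Fintype.card F - 1 ≠ 0 := by
    have := Fintype.one_lt_card (α := F); omega
  exact MulChar.exists_mulChar_orderOf F dvd_rfl (Complex.isPrimitiveRoot_exp _ h1)

theorem full_char_inj {F : Type*} [Field F] [Fintype F] (χ : MulChar F ℂ)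
    (hχ : orderOf χ = Fintype.card F - 1) (u : Fˣ) (hu : χ u = 1) : u = 1 := by
  classical
  obtain ⟨g, hg⟩ := IsCyclic.exists_generator (α := Fˣ)
  obtain ⟨i, hi⟩ := mem_powers_iff_mem_zpowers.2 (hg u)
  simp only at hi
  have h1 : χ ^ i = 1 := by
    ext v
    obtain ⟨j, hj⟩ := mem_powers_iff_mem_zpowers.2 (hg v)
    simp only at hj
    rw [MulChar.pow_apply_coe, MulChar.one_apply_coe, ← map_pow, ← Units.val_pow_eq_pow_val, ← hj,
      pow_right_comm, hi, Units.val_pow_eq_pow_val, map_pow, hu, one_pow]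
  have h2 := orderOf_dvd_of_pow_eq_one h1
  rw [hχ, ← Fintype.card_units] at h2
  obtain ⟨c, hc⟩ := h2
  rw [← hi, hc, pow_mul, pow_card_eq_one, one_pow]

theorem char_geom {F : Type*} [Field F] [Fintype F] (χ : MulChar F ℂ)
    (hχ : orderOf χ = Fintype.card F - 1) (x : F) (hx : x ≠ 0) (hx1 : x ≠ 1) :
    ∑ j ∈ Finset.range (Fintype.card F - 1), χ x ^ j = 0 := by
  have h1 := mul_geom_sum (χ x) (Fintype.card F - 1)
  rw [← map_pow, FiniteField.pow_card_sub_one_eq_one x hx, map_one, sub_self] at h1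
  refine (mul_eq_zero.1 h1).resolve_left ?_
  intro h2
  have h3 := full_char_inj χ hχ (Units.mk0 x hx) (sub_eq_zero.1 h2)
  apply hx1
  have := congrArg Units.val h3
  simpa using this

theorem char_geom_norm_le {F : Type*} [Field F] [Fintype F] (χ : MulChar F ℂ) (x : F) :
    ‖∑ j ∈ Finset.range (Fintype.card F - 1), χ x ^ j‖ ≤ ((Fintype.card F - 1 : ℕ) : ℝ) := by
  have hn : ‖χ x‖ ≤ 1 := by
    by_cases hx : x = 0
    · rw [hx, MulChar.map_zero]; simp
    · have h1 : χ x ^ (Fintype.card F - 1) = 1 := by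
        rw [← map_pow, FiniteField.pow_card_sub_one_eq_one x hx, map_one]
      refine (Complex.norm_eq_one_of_pow_eq_one h1 ?_).le
      have := Fintype.one_lt_card (α := F); omega
  refine (norm_sum_le _ _).trans ?_
  refine (Finset.sum_le_card_nsmul _ _ 1 fun j _ => ?_).trans ?_
  · rw [norm_pow]; exact pow_le_one₀ (norm_nonneg _) hn
  · simp

theorem card_low {F E : Type*} [Field F] [Fintype F] [Field E] [Fintype E] [Algebra F E] (n : ℕ)
    (hn : Module.finrank F E = n) :
    (open Classical in (Finset.univ.filter (fun α : E => (minpoly F α).natDegree ≠ n)).card) ≤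
      2 * Fintype.card F ^ (n / 2) := by
  classical
  set q := Fintype.card F with hq
  have hq1 : 1 < q := Fintype.one_lt_card
  have hsub : Finset.univ.filter (fun α : E => (minpoly F α).natDegree ≠ n) ⊆
      (Finset.range (n / 2 + 1)).biUnion
        (fun δ => ((X ^ q ^ δ - X : E[X]).roots).toFinset) := by
    intro α hα
    have hinteg : IsIntegral F α := Algebra.IsIntegral.isIntegral α
    have hne := (Finset.mem_filter.1 hα).2
    have hdvd : (minpoly F α).natDegree ∣ n := hn ▸ minpoly.degree_dvd hinteg
    have hpos : 0 < (minpoly F α).natDegree := minpoly.natDegree_pos hinteg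
    have hn0 : 0 < n := hn ▸ Module.finrank_pos
    obtain ⟨k, hk⟩ := hdvd
    have hk2 : 2 ≤ k := by
      rcases k with _ | _ | k
      · omega
      · simp at hk; omega
      · omega
    rw [Finset.mem_biUnion]
    refine ⟨(minpoly F α).natDegree, ?_, ?_⟩
    · rw [Finset.mem_range, Nat.lt_succ_iff, Nat.le_div_iff_mul_le (by norm_num)]
      rw [hk]
      exact Nat.mul_le_mul_left _ hk2
    · rw [Multiset.mem_toFinset, mem_roots]
      · have h2 : minpoly F α ∣ X ^ (Nat.card F) ^ (minpoly F α).natDegree - X :=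
          ((minpoly.irreducible hinteg).natDegree_dvd_iff_dvd_X_pow_card_pow_sub_X).1 dvd_rfl
        rw [Nat.card_eq_fintype_card, ← hq] at h2
        obtain ⟨w, hw⟩ := h2
        have h3 := congrArg (aeval α) hw
        rw [map_mul, minpoly.aeval, zero_mul] at h3
        simpa using h3
      · exact FiniteField.X_pow_card_pow_sub_X_ne_zero E hpos.ne' hq1
  refine (Finset.card_le_card hsub).trans (Finset.card_biUnion_le.trans ?_)
  have h1 : ∀ δ ∈ Finset.range (n / 2 + 1),
      ((X ^ q ^ δ - X : E[X]).roots).toFinset.card ≤ q ^ δ := by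
    intro δ _
    refine (Multiset.toFinset_card_le _).trans ((card_roots' _).trans ?_)
    refine (natDegree_sub_le _ _).trans ?_
    rw [natDegree_X_pow, natDegree_X]
    exact max_le le_rfl (Nat.one_le_pow _ _ (by omega))
  refine (Finset.sum_le_sum h1).trans ?_
  have h2 : ∀ m, ∑ δ ∈ Finset.range (m + 1), q ^ δ ≤ 2 * q ^ m := by
    intro m
    induction m with
    | zero => simp
    | succ m ih =>
      rw [Finset.sum_range_succ]
      have : 2 * q ^ m ≤ q ^ (m + 1) := by
        rw [pow_succ, mul_comm]; exact Nat.mul_le_mul_left _ hq1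
      omega
  exact h2 _

set_option maxHeartbeats 1000000 in
theorem exists_norm_one {F E : Type*} [Field F] [Fintype F] [Field E] [Fintype E] [Algebra F E]
    (n d k : ℕ) (hq2 : 2 < Fintype.card F) (hfr : Module.finrank F E = n)
    (hd : 1 ≤ d) (hdn : d < n) (I : Finset F[X])
    (hI : ∀ p ∈ I, p.Monic ∧ Irreducible p ∧ p.natDegree ∣ d) (hk : I.card ≤ k)
    (hcond : 2 * d + 2 * (k + 1) ≤ n) :
    ∃ α : E, (minpoly F α).natDegree = n ∧ ∀ p ∈ I, Algebra.norm F (aeval α p) = 1 := by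
  classical
  by_contra hcon
  push Not at hcon
  set q := Fintype.card F with hq
  have hI' : ∀ p ∈ I, p.Monic ∧ Irreducible p := fun p hp => ⟨(hI p hp).1, (hI p hp).2.1⟩
  obtain ⟨χ, hχ⟩ := exists_full_char F
  -- degree of the modulus
  have hM : (∏ p ∈ I, p).natDegree ≤ q ^ d := by
    have h1 : ∏ p ∈ I, p ∣ X ^ q ^ d - X := by
      refine Finset.prod_dvd_of_coprime ?_ ?_
      · intro p hp p' hp' hne
        change IsCoprime p p'
        rw [(hI p hp).2.1.coprime_iff_not_dvd]
        intro hdv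
        exact hne (eq_of_monic_of_associated (hI p hp).1 (hI p' hp').1
          (((hI p hp).2.1.associated_of_dvd (hI p' hp').2.1 hdv)))
      · intro p hp
        have := ((hI p hp).2.1.natDegree_dvd_iff_dvd_X_pow_card_pow_sub_X).1 (hI p hp).2.2
        rwa [Nat.card_eq_fintype_card] at this
    rw [← FiniteField.X_pow_card_pow_sub_X_natDegree_eq F (p := q) (n := d) (by omega) (by omega)]
    exact natDegree_le_of_dvd h1 (FiniteField.X_pow_card_pow_sub_X_ne_zero F (by omega) (by omega))
  set s : ℝ := Real.sqrt q ^ n with hs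
  have hqR : (2 : ℝ) < q := by exact_mod_cast hq2
  have hsq1 : 1 ≤ Real.sqrt q := by
    rw [Real.one_le_sqrt]; linarith
  have hsq : Real.sqrt q ^ 2 = q := Real.sq_sqrt (by linarith)
  have hs2 : s ^ 2 = (q : ℝ) ^ n := by
    rw [hs, ← pow_mul, mul_comm, pow_mul, hsq]
  have hs0 : 0 < s := by positivity
  -- the big sum
  set t := Finset.range (q - 1) with ht
  set T : ℂ := ∑ α : E, ∏ p : I, ∑ j ∈ t, χ (Algebra.norm F (aeval α (p : F[X]))) ^ j with hT
  have hw : ∀ α : E, ‖∏ p : I, ∑ j ∈ t, χ (Algebra.norm F (aeval α (p : F[X]))) ^ j‖ ≤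
      ((q - 1 : ℕ) : ℝ) ^ I.card := by
    intro α
    rw [norm_prod]
    refine (Finset.prod_le_prod (fun p _ => norm_nonneg _) fun p _ => char_geom_norm_le χ _).trans ?_
    rw [Finset.prod_const, Finset.card_univ, Fintype.card_coe]
  set A : ℝ := ((q - 1 : ℕ) : ℝ) ^ I.card with hA
  have hA0 : 0 < A := by
    rw [hA]
    have : 0 < q - 1 := by omega
    positivity
  have hTle : ‖T‖ ≤ 2 * A * s := by
    have h1 : T = ∑ α ∈ Finset.univ.filter (fun α : E => (minpoly F α).natDegree ≠ n),
        ∏ p : I, ∑ j ∈ t, χ (Algebra.norm F (aeval α (p : F[X]))) ^ j := by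
      rw [hT]
      symm
      refine Finset.sum_subset (Finset.subset_univ _) fun α _ hα => ?_
      have hαn : (minpoly F α).natDegree = n := by
        by_contra h; exact hα (Finset.mem_filter.2 ⟨Finset.mem_univ _, h⟩)
      obtain ⟨p, hp, hpn⟩ := hcon α hαn
      refine Finset.prod_eq_zero (i := (⟨p, hp⟩ : I)) (Finset.mem_univ _) ?_
      refine char_geom χ hχ _ ?_ hpn
      rw [Algebra.norm_ne_zero_iff]
      intro h0
      have h2 := (minpoly.dvd F α h0)
      have h3 : (minpoly F α).natDegree ≤ p.natDegree :=
        natDegree_le_of_dvd h2 (hI p hp).1.ne_zero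
      have h4 := Nat.le_of_dvd (by omega) (hI p hp).2.2
      omega
    rw [h1]
    refine (norm_sum_le _ _).trans ((Finset.sum_le_card_nsmul _ _ A fun α _ => hw α).trans ?_)
    rw [nsmul_eq_mul]
    have h5 : ((Finset.univ.filter (fun α : E => (minpoly F α).natDegree ≠ n)).card : ℝ) ≤
        2 * (q : ℝ) ^ (n / 2) := by exact_mod_cast card_low (E := E) n hfr
    have h6 : (q : ℝ) ^ (n / 2) ≤ s := by
      rw [hs]
      calc (q : ℝ) ^ (n / 2) = Real.sqrt q ^ (2 * (n / 2)) := by rw [pow_mul, hsq]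
        _ ≤ Real.sqrt q ^ n := pow_le_pow_right₀ hsq1 (Nat.mul_div_le _ _)
    nlinarith
  -- expansion
  let ext : (I → ℕ) → F[X] → ℕ := fun a p => if h : p ∈ I then a ⟨p, h⟩ else 0
  have hexp : T = ∑ a ∈ Fintype.piFinset (fun _ : I => t), fsum E χ I (ext a) := by
    rw [hT]
    simp_rw [Finset.prod_univ_sum]
    rw [Finset.sum_comm]
    refine Finset.sum_congr rfl fun a _ => ?_
    rw [fsum]
    refine Finset.sum_congr rfl fun α _ => ?_
    refine Eq.trans ?_ (Finset.prod_coe_sort I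
      (fun p => χ (Algebra.norm F (aeval α p)) ^ ext a p))
    refine Finset.prod_congr rfl fun p _ => ?_
    congr 1
    simp [ext]
  have hz : (0 : I → ℕ) ∈ Fintype.piFinset (fun _ : I => t) := by
    rw [Fintype.mem_piFinset]
    intro p
    rw [ht, Finset.mem_range]
    change 0 < q - 1
    omega
  have hf0 : fsum E χ I (ext 0) = (s : ℂ) ^ 2 := by
    have hcE : (Fintype.card E : ℝ) = s ^ 2 := by
      rw [hs2, ← Nat.card_eq_fintype_card, Module.natCard_eq_pow_finrank (K := F), hfr,
        Nat.card_eq_fintype_card]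
      push_cast; rfl
    have h1 : ∀ p, ext 0 p = 0 := by
      intro p; simp [ext]
    rw [fsum]
    simp only [h1, pow_zero, Finset.prod_const_one, Finset.sum_const, Finset.card_univ,
      nsmul_eq_mul, mul_one]
    exact_mod_cast congrArg (Complex.ofReal) hcE
  rw [← Finset.add_sum_erase _ _ hz, hf0] at hexp
  have hrest : ‖∑ a ∈ (Fintype.piFinset (fun _ : I => t)).erase 0, fsum E χ I (ext a)‖ ≤
      A * (((q : ℝ) ^ d - 1) * s) := by
    have hB0 : 0 ≤ ((q : ℝ) ^ d - 1) * s := by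
      refine mul_nonneg ?_ hs0.le
      have : (1 : ℝ) ≤ (q : ℝ) ^ d := one_le_pow₀ (by linarith)
      linarith
    refine (norm_sum_le _ _).trans ((Finset.sum_le_card_nsmul _ _ (((q : ℝ) ^ d - 1) * s) ?_).trans ?_)
    · intro a ha
      rw [Finset.mem_erase, Fintype.mem_piFinset] at ha
      obtain ⟨p0, hp0⟩ := Function.ne_iff.1 ha.1
      have h1 := fsum_bound E χ hχ I hI' (ext a) (by
        intro p hp
        have := ha.2 ⟨p, hp⟩
        rw [ht, Finset.mem_range] at this
        simpa [ext, hp] using this) p0 p0.2 (by simpa [ext] using hp0)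
      rw [hfr] at h1
      refine h1.trans (mul_le_mul_of_nonneg_right ?_ hs0.le)
      have : ((∏ p ∈ I, p).natDegree : ℝ) ≤ (q : ℝ) ^ d := by exact_mod_cast hM
      linarith
    · rw [nsmul_eq_mul]
      refine mul_le_mul_of_nonneg_right ?_ hB0
      have h2 : (Fintype.piFinset (fun _ : I => t)).card = (q - 1) ^ I.card := by
        rw [Fintype.card_piFinset]
        simp [ht]
      have h3 := (Finset.card_erase_le (s := Fintype.piFinset (fun _ : I => t)) (a := 0))
      rw [h2] at h3
      rw [hA]
      exact_mod_cast h3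
  have hfin : s ^ 2 ≤ 2 * A * s + A * (((q : ℝ) ^ d - 1) * s) := by
    have h1 : ((s : ℂ) ^ 2) = T - ∑ a ∈ (Fintype.piFinset (fun _ : I => t)).erase 0,
        fsum E χ I (ext a) := by rw [hexp]; ring
    have h2 := congrArg norm h1
    rw [norm_pow, Complex.norm_real, Real.norm_of_nonneg hs0.le] at h2
    rw [h2]
    exact (norm_sub_le _ _).trans (add_le_add hTle hrest)
  have hfin2 : s ≤ A * ((q : ℝ) ^ d + 1) := by
    refine le_of_mul_le_mul_right ?_ hs0
    nlinarith
  have hAk : A ≤ (q : ℝ) ^ k := by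
    calc A ≤ (q : ℝ) ^ I.card := by
          rw [hA]
          refine pow_le_pow_left₀ (Nat.cast_nonneg _) ?_ _
          exact_mod_cast Nat.sub_le q 1
      _ ≤ (q : ℝ) ^ k := pow_le_pow_right₀ (by linarith) hk
  have hsbig : (q : ℝ) ^ k * (q : ℝ) ^ d * q ≤ s := by
    rw [hs]
    calc (q : ℝ) ^ k * (q : ℝ) ^ d * q = Real.sqrt q ^ (2 * (d + (k + 1))) := by
          rw [pow_mul, hsq]; ring
      _ ≤ Real.sqrt q ^ n := pow_le_pow_right₀ hsq1 (by omega)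
  have hqd : (1 : ℝ) ≤ (q : ℝ) ^ d := one_le_pow₀ (by linarith)
  have hqk : (1 : ℝ) ≤ (q : ℝ) ^ k := one_le_pow₀ (by linarith)
  have h7 : A * ((q : ℝ) ^ d + 1) ≤ (q : ℝ) ^ k * (2 * (q : ℝ) ^ d) :=
    mul_le_mul hAk (by linarith) (by linarith) (by linarith)
  have h8 : (0 : ℝ) < (q : ℝ) ^ k * (q : ℝ) ^ d := by positivity
  nlinarith

/-- If `q > 2` and `n ≥ 2d + 2(|P_d|+1)`, there is a degree-`n` element `α` such that `q - 1`
divides the number of connected components of `G_d(n,q,α)`; in particular the graph is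
not connected for that `α`. -/
theorem exists_alpha_not_connected
    {F E : Type*} [Field F] [Fintype F] [Field E] [Fintype E] [Algebra F E]
    (q n d : ℕ) (hq : IsPrimePow q) (hq2 : 2 < q)
    (hcardF : Fintype.card F = q) (hcardE : Fintype.card E = q ^ n)
    (hn : 1 < n) (hd : 1 ≤ d) (hdn : d < n)
    (hcond : 2 * d + 2 * ((primarySet F d).ncard + 1) ≤ n) :
    ∃ α : E, (minpoly F α).natDegree = n ∧
      (q - 1) ∣ (Subgroup.closure
        {u : Eˣ | ∃ g ∈ primarySet F d, (u : E) = Polynomial.aeval α g}).index ∧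
      Subgroup.closure
        {u : Eˣ | ∃ g ∈ primarySet F d, (u : E) = Polynomial.aeval α g} ≠ ⊤ := by
  classical
  have hfr : Module.finrank F E = n := by
    have h := Module.natCard_eq_pow_finrank (K := F) (V := E)
    rw [Nat.card_eq_fintype_card, Nat.card_eq_fintype_card, hcardE, hcardF] at h
    exact (Nat.pow_right_injective (by omega : 2 ≤ q) h).symm
  set I := (irrF F d).filter (fun p => p.natDegree ∣ d) with hIdef
  have hI : ∀ p ∈ I, p.Monic ∧ Irreducible p ∧ p.natDegree ∣ d := by
    intro p hp
    rw [hIdef, Finset.mem_filter, mem_irrF] at hp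
    exact ⟨hp.1.1, hp.1.2.1, hp.2⟩
  have hfin : (primarySet F d).Finite :=
    (finite_monic_natDegree F d).subset fun g hg => ⟨hg.1, hg.2.1⟩
  have hpos : ∀ p ∈ I, 0 < d / p.natDegree := fun p hp =>
    Nat.div_pos (Nat.le_of_dvd (by omega) (hI p hp).2.2) (hI p hp).2.1.natDegree_pos
  have hk : I.card ≤ (primarySet F d).ncard := by
    rw [← Set.ncard_coe_finset]
    refine Set.ncard_le_ncard_of_injOn (fun p => p ^ (d / p.natDegree)) ?_ ?_ hfin
    · intro p hp
      have hp' : p ∈ I := hp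
      obtain ⟨h1, h2, h3⟩ := hI p hp'
      refine ⟨h1.pow _, ?_, p, h1, h2, _, hpos p hp', rfl⟩
      rw [natDegree_pow]
      exact Nat.div_mul_cancel h3
    · intro p hp r hr h
      have hp' : p ∈ I := hp
      have hr' : r ∈ I := hr
      obtain ⟨h1, h2, h3⟩ := hI p hp'
      obtain ⟨g1, g2, g3⟩ := hI r hr'
      have hdv : p ∣ r ^ (d / r.natDegree) := by
        rw [← show p ^ (d / p.natDegree) = r ^ (d / r.natDegree) from h]
        exact dvd_pow_self p (hpos p hp').ne_bot
      have hdv2 : p ∣ r := h2.prime.dvd_of_dvd_pow hdv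
      exact eq_of_monic_of_associated h1 g1 (h2.associated_of_dvd g2 hdv2)
  obtain ⟨α, hα, hN⟩ := exists_norm_one (F := F) (E := E) n d (primarySet F d).ncard
    (by omega) hfr hd hdn I hI hk hcond
  have hle : Subgroup.closure
        {u : Eˣ | ∃ g ∈ primarySet F d, (u : E) = Polynomial.aeval α g} ≤
      (Units.map (Algebra.norm F : E →* F)).ker := by
    rw [Subgroup.closure_le]
    rintro u ⟨g, ⟨_, hgd, p, h1, h2, e, he, rfl⟩, hu⟩
    rw [natDegree_pow] at hgd
    have hp : p ∈ I := by
      rw [hIdef, Finset.mem_filter, mem_irrF]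
      have hdv : p.natDegree ∣ d := ⟨e, by rw [← hgd, mul_comm]⟩
      exact ⟨⟨h1, h2, Nat.le_of_dvd (by omega) hdv⟩, hdv⟩
    rw [SetLike.mem_coe, MonoidHom.mem_ker]
    ext
    rw [Units.coe_map, Units.val_one, hu, map_pow]
    change Algebra.norm F (aeval α p ^ e) = 1
    rw [map_pow, hN p hp, one_pow]
  have hidx : (Units.map (Algebra.norm F : E →* F)).ker.index = q - 1 := by
    rw [Subgroup.index_ker, MonoidHom.range_eq_top.2 (FiniteField.unitsMap_norm_surjective F E)]
    rw [Subgroup.card_top, Nat.card_eq_fintype_card, Fintype.card_units, hcardF]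
  have hdvd : (q - 1) ∣ (Subgroup.closure
        {u : Eˣ | ∃ g ∈ primarySet F d, (u : E) = Polynomial.aeval α g}).index := by
    rw [← hidx]
    exact Subgroup.index_dvd_of_le hle
  refine ⟨α, hα, hdvd, fun htop => ?_⟩
  rw [htop, Subgroup.index_top] at hdvd
  have := Nat.le_of_dvd one_pos hdvd
  omega
end

section
/- Let q be a prime power and n > 2 an integer, and let ℓ > 1 be an integer dividing q^n − 1 such that n ≥ 2 + 2·(q + 1)·(log ℓ / log q). Then there exists at least one α ∈ 𝔽_{q^n} of degree n over 𝔽_q such that the subgroup of 𝔽_{q^n}^× generated by {α + c : c ∈ 𝔽_q} is a proper subgroup of 𝔽_{q^n}^×; i.e., the Cayley graph G_1(n,q,α) is not connected. -/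
open Polynomial

theorem stp_lin {E ι κ : Type*} [Field E] [Fintype ι] [Fintype κ]
    (h : Fintype.card κ < Fintype.card ι) (G : ι → κ → E) :
    ∃ u : ι → E, u ≠ 0 ∧ ∀ k, ∑ i, u i * G i k = 0 := by
  classical
  let L : (ι → E) →ₗ[E] (κ → E) :=
    { toFun := fun u k => ∑ i, u i * G i k
      map_add' := by
        intro x y; funext k; simp [add_mul, Finset.sum_add_distrib]
      map_smul' := by
        intro c x; funext k; simp [Finset.mul_sum, mul_assoc] }
  have hk : LinearMap.ker L ≠ ⊥ := LinearMap.ker_ne_bot_of_finrank_lt (by simpa using h)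
  obtain ⟨u, hu, hne⟩ := (Submodule.ne_bot_iff _).1 hk
  exact ⟨u, hne, fun k => congrFun (LinearMap.mem_ker.1 hu) k⟩

theorem stp_indep {E ι : Type*} [Field E] [Fintype ι]
    (o : ι → ℕ) (ho : Function.Injective o) (h : ι → E[X]) (hh : ∀ i, (h i).coeff 0 ≠ 0)
    (u : ι → E) (hu : u ≠ 0) : ∑ i, C (u i) * (X ^ (o i) * h i) ≠ 0 := by
  classical
  intro h0
  obtain ⟨i0, hi0⟩ := Function.ne_iff.1 hu
  obtain ⟨i, hi, hmin⟩ := (Finset.univ.filter (fun i => u i ≠ 0)).exists_min_image o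
    ⟨i0, by simpa using hi0⟩
  have h1 := congrArg (fun p => p.coeff (o i)) h0
  simp only [finsetSum_coeff, coeff_C_mul, coeff_zero, coeff_X_pow_mul'] at h1
  rw [Finset.sum_eq_single i] at h1
  · simp at h1
    rcases h1 with h1 | h1
    · simp at hi; exact hi h1
    · exact hh i h1
  · intro j _ hj
    by_cases huj : u j = 0
    · simp [huj]
    · have := hmin j (by simpa using huj)
      have h2 : o i ≠ o j := fun e => hj (ho e).symm
      rw [if_neg (by omega)]; simp
  · simp

theorem stp_mult {E : Type*} [Field E] (R : E[X]) (hR : R ≠ 0) (A : Finset E) (m : ℕ)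
    (h : ∀ α ∈ A, (X - C α) ^ m ∣ R) : A.card * m ≤ R.natDegree := by
  classical
  calc A.card * m = ∑ α ∈ A, m := by simp
    _ ≤ ∑ α ∈ A, R.roots.count α := by
        apply Finset.sum_le_sum
        intro α hα
        rw [count_roots]
        exact (le_rootMultiplicity_iff hR).2 (h α hα)
    _ ≤ R.roots.card := by
        calc _ ≤ ∑ α ∈ A ∪ R.roots.toFinset, R.roots.count α :=
              Finset.sum_le_sum_of_subset Finset.subset_union_left
          _ = _ := Multiset.sum_count_eq_card (by intro x hx; simp at hx ⊢; right; exact hx)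
    _ ≤ _ := card_roots' R

theorem stp_dvd {E : Type*} [Field E] (R : E[X]) (α ρ : E) (hρ : ρ ≠ 0) (m : ℕ)
    (h : ∀ s < m, (R.comp (C α + C ρ * X)).coeff s = 0) : (X - C α) ^ m ∣ R := by
  obtain ⟨V, hV⟩ := X_pow_dvd_iff.2 h
  have h1 : R = (R.comp (C α + C ρ * X)).comp (C ρ⁻¹ * (X - C α)) := by
    rw [comp_assoc]
    have : (C α + C ρ * X).comp (C ρ⁻¹ * (X - C α)) = X := by
      simp only [add_comp, C_comp, mul_comp, X_comp]
      rw [← mul_assoc, ← C_mul, mul_inv_cancel₀ hρ]; simp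
    rw [this, comp_X]
  rw [h1, hV, mul_comp, pow_comp, X_comp, mul_pow]
  exact Dvd.intro_left (C ρ⁻¹ ^ m * V.comp _) (by ring)

/-- weighted degree bound -/
def StpW {E : Type*} [Field E] (e d : ℕ) (P : E[X][X]) : Prop :=
  ∀ s, (P.coeff s).natDegree ≤ d + s * e

theorem StpW.mul {E : Type*} [Field E] {e d1 d2 : ℕ} {P Q : E[X][X]} (hP : StpW e d1 P)
    (hQ : StpW e d2 Q) : StpW e (d1 + d2) (P * Q) := by
  intro s
  rw [coeff_mul]
  apply natDegree_sum_le_of_forall_le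
  rintro ⟨x, y⟩ hxy
  have hxy := Finset.HasAntidiagonal.mem_antidiagonal.1 hxy
  simp only at hxy ⊢
  have := hP x
  have := hQ y
  have h3 := natDegree_mul_le (p := P.coeff x) (q := Q.coeff y)
  subst hxy
  rw [add_mul]; omega

theorem StpW.one {E : Type*} [Field E] (e : ℕ) : StpW e 0 (1 : E[X][X]) := by
  intro s
  rw [coeff_one]; split_ifs <;> simp

theorem StpW.pow {E : Type*} [Field E] {e d : ℕ} {P : E[X][X]} (hP : StpW e d P) (n : ℕ) :
    StpW e (n * d) (P ^ n) := by
  induction n with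
  | zero => simpa using StpW.one e
  | succ n ih => rw [pow_succ, add_mul, one_mul]; exact ih.mul hP

theorem StpW.prod {E ι : Type*} [Field E] {e : ℕ} {S : Finset ι} {P : ι → E[X][X]}
    (hP : ∀ i ∈ S, StpW e 0 (P i)) : StpW e 0 (∏ i ∈ S, P i) := by
  classical
  induction S using Finset.induction_on with
  | empty => simpa using StpW.one e
  | insert a S ha ih =>
    rw [Finset.prod_insert ha]
    exact (hP a (by simp)).mul (ih fun i hi => hP i (by simp [hi]))

theorem StpW.lin {E : Type*} [Field E] {e d : ℕ} {A B : E[X]} (hA : A.natDegree ≤ d)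
    (hB : B.natDegree ≤ d + e) : StpW e d (C A + C B * X) := by
  intro s
  rcases s with _ | _ | s
  · simpa using hA
  · simpa [coeff_C] using hB
  · simp

/-- exponent digits -/
def stpB {K : Type*} (ℓ : ℕ) (a : K → ℕ) (i : ℕ) (c : K) : ℕ := (i * a c) % ℓ

theorem stpB_inj {K : Type*} {ℓ : ℕ} (hℓ : ℓ.Prime) (a : K → ℕ) (c : K) (hc : ¬ ℓ ∣ a c)
    {i j : ℕ} (hi : i < ℓ) (hj : j < ℓ) (h : stpB ℓ a i c = stpB ℓ a j c) : i = j := by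
  have h1 : i * a c ≡ j * a c [MOD ℓ] := h
  have h2 : Nat.gcd ℓ (a c) = 1 := (Nat.Prime.coprime_iff_not_dvd hℓ).2 hc
  have h3 := Nat.ModEq.cancel_right_of_coprime h2 h1
  exact Nat.ModEq.eq_of_lt_of_lt h3 hi hj

theorem stpB_sum {K : Type*} {ℓ : ℕ} (hℓ : ℓ.Prime) (a : K → ℕ) (c : K) (hc : ¬ ℓ ∣ a c) :
    2 * ∑ i : Fin ℓ, stpB ℓ a i c = ℓ * (ℓ - 1) := by
  let φ : Fin ℓ → Fin ℓ := fun i => ⟨stpB ℓ a i c, Nat.mod_lt _ hℓ.pos⟩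
  have hφ : Function.Bijective φ := by
    apply Finite.injective_iff_bijective.1
    intro i j hij
    exact Fin.ext (stpB_inj hℓ a c hc i.2 j.2 (congrArg Fin.val hij))
  have h1 : ∑ i : Fin ℓ, stpB ℓ a i c = ∑ i : Fin ℓ, (i : ℕ) :=
    hφ.sum_comp (fun i : Fin ℓ => (i : ℕ))
  rw [h1, Fin.sum_univ_eq_sum_range (fun i => i), mul_comm, Finset.sum_range_id_mul_two]

theorem stpB_sum_div {K : Type*} {ℓ : ℕ} (hℓ : ℓ.Prime) (a : K → ℕ) (S : Finset K)
    (hc : ∀ c ∈ S, ¬ ℓ ∣ a c) :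
    2 * ∑ i : Fin ℓ, (∑ c ∈ S, stpB ℓ a i c) / ℓ ≤ S.card * (ℓ - 1) := by
  have h1 : ℓ * (2 * ∑ i : Fin ℓ, (∑ c ∈ S, stpB ℓ a i c) / ℓ) ≤ ℓ * (S.card * (ℓ - 1)) := by
    calc ℓ * (2 * ∑ i : Fin ℓ, (∑ c ∈ S, stpB ℓ a i c) / ℓ)
        = 2 * ∑ i : Fin ℓ, ℓ * ((∑ c ∈ S, stpB ℓ a i c) / ℓ) := by rw [← Finset.mul_sum]; ring
      _ ≤ 2 * ∑ i : Fin ℓ, ∑ c ∈ S, stpB ℓ a i c := by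
          gcongr with i
          exact Nat.mul_div_le _ _
      _ = ∑ c ∈ S, 2 * ∑ i : Fin ℓ, stpB ℓ a i c := by
          rw [Finset.sum_comm, Finset.mul_sum]
      _ = ∑ c ∈ S, ℓ * (ℓ - 1) := Finset.sum_congr rfl fun c h => stpB_sum hℓ a c (hc c h)
      _ = _ := by simp; ring
  exact Nat.le_of_mul_le_mul_left h1 hℓ.pos

/-- the bivariate auxiliary polynomial -/
noncomputable def stpT {E K : Type*} [Field E] [DecidableEq K] (S : Finset K) (z : K → E)
    (e : K → ℕ) (t : ℕ) : E[X][X] :=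
  (C X + C (∏ c ∈ S, (X + C (z c))) * X) ^ t *
    ∏ c ∈ S, (C 1 + C (∏ d ∈ S.erase c, (X + C (z d))) * X) ^ (e c)

theorem stp_natDegree_prod {E K : Type*} [Field E] (S : Finset K) (z : K → E) :
    (∏ c ∈ S, (X + C (z c))).natDegree = S.card := by
  rw [natDegree_prod_of_monic _ _ (fun c _ => monic_X_add_C _)]; simp

theorem stpT_W {E K : Type*} [Field E] [DecidableEq K] (S : Finset K) (hS : S.Nonempty)
    (z : K → E) (e : K → ℕ) (t : ℕ) : StpW (S.card - 1) t (stpT S z e t) := by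
  have hk := hS.card_pos
  have h1 : StpW (S.card - 1) 1 (C X + C (∏ c ∈ S, (X + C (z c))) * X : E[X][X]) := by
    apply StpW.lin
    · simp
    · rw [stp_natDegree_prod]; omega
  have h2 := (h1.pow t).mul (StpW.prod (S := S)
    (P := fun c => (C 1 + C (∏ d ∈ S.erase c, (X + C (z d))) * X) ^ (e c)) (by
      intro c hc
      have h3 : StpW (S.card - 1) 0 (C 1 + C (∏ d ∈ S.erase c, (X + C (z d))) * X : E[X][X]) := by
        apply StpW.lin
        · simp
        · rw [stp_natDegree_prod, Finset.card_erase_of_mem hc]; omega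
      simpa using h3.pow (e c)))
  simpa [stpT] using h2

theorem stpT_eval {E K : Type*} [Field E] [DecidableEq K] (S : Finset K) (z : K → E)
    (e : K → ℕ) (t : ℕ) (α : E) :
    (X ^ t * ∏ c ∈ S, (X + C (z c)) ^ (e c)).comp (C α + C (∏ c ∈ S, (α + z c)) * X) =
      C (∏ c ∈ S, (α + z c) ^ (e c)) * (stpT S z e t).map (evalRingHom α) := by
  simp only [stpT, mul_comp, pow_comp, X_comp, prod_comp, add_comp, C_comp, Polynomial.map_mul,
    Polynomial.map_pow, Polynomial.map_add, Polynomial.map_prod, map_C, map_X, coe_evalRingHom,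
    eval_X, eval_add, eval_C, map_prod C, C_pow]
  rw [mul_left_comm, ← Finset.prod_mul_distrib]
  congr 1
  apply Finset.prod_congr rfl
  intro c hc
  rw [← mul_pow]
  congr 1
  rw [mul_add, ← mul_assoc, Finset.mul_prod_erase S (fun c => C (α + z c)) hc]
  simp
  ring

theorem stp_core {E K : Type*} [Field E] [Fintype E] [DecidableEq K]
    (ℓ M J m D N P : ℕ) (hℓ : ℓ.Prime) (hN : Fintype.card E = N) (hNM : N = ℓ * M + 1)
    (hM : D + J = M) (S : Finset K) (z : K → E) (c0 : K) (hc0 : c0 ∈ S)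
    (hz0 : z c0 = 0) (hz : ∀ c ∈ S, c ≠ c0 → z c ≠ 0) (a : K → ℕ) (ha : ∀ c ∈ S, ¬ ℓ ∣ a c)
    (ζ : E) (A : Finset E)
    (hA : ∀ α ∈ A, (∀ c ∈ S, α + z c ≠ 0) ∧ (∏ c ∈ S, (α + z c) ^ (a c)) ^ M = ζ)
    (hmN : m ≤ N) (hkJ : S.card ≤ J) (hP : P + S.card * (ℓ - 1) = 2 * ℓ * J)
    (hcount : 2 * m * M + (S.card - 1) * (m * (m - 1)) < P * D) :
    A.card * m < N * J := by
  classical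
  have hl := hℓ.pos
  set k := S.card with hk
  have hk0 : 0 < k := Finset.card_pos.2 ⟨c0, hc0⟩
  have hdiv : ∀ i, (∑ c ∈ S, stpB ℓ a i c) / ℓ ≤ k := by
    intro i
    apply Nat.div_le_of_le_mul
    calc _ ≤ ∑ c ∈ S, ℓ := Finset.sum_le_sum fun c _ => (Nat.mod_lt _ hl).le
      _ = _ := by simp [hk]; ring
  let Ji : ℕ → ℕ := fun i => J - (∑ c ∈ S, stpB ℓ a i c) / ℓ
  let ι := (Σ i : Fin ℓ, Fin (Ji i)) × Fin D
  let κ := Σ s : Fin m, Fin (M + s * (k - 1))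
  have hcard : Fintype.card κ < Fintype.card ι := by
    have e1 : Fintype.card κ = ∑ s : Fin m, (M + s * (k - 1)) := by simp [κ]
    have e2 : Fintype.card ι = (∑ i : Fin ℓ, Ji i) * D := by simp [ι]
    have e3 : 2 * Fintype.card κ = 2 * m * M + (k - 1) * (m * (m - 1)) := by
      rw [e1, Finset.sum_add_distrib, ← Finset.sum_mul, Fin.sum_univ_eq_sum_range (fun i => i),
        ← Finset.sum_range_id_mul_two]
      simp; ring
    have e4 : ∑ i : Fin ℓ, Ji i + ∑ i : Fin ℓ, (∑ c ∈ S, stpB ℓ a i c) / ℓ = ℓ * J := by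
      rw [← Finset.sum_add_distrib]
      rw [Finset.sum_congr rfl (g := fun _ => J)]
      · simp
      · intro i _
        exact Nat.sub_add_cancel ((hdiv i).trans hkJ)
    have e5 := stpB_sum_div hℓ a S ha
    rw [← hk] at e5
    have e6 : P ≤ 2 * ∑ i : Fin ℓ, Ji i := by
      have : 2 * ℓ * J = 2 * (ℓ * J) := by ring
      omega
    have e7 : 2 * Fintype.card κ < 2 * Fintype.card ι := by
      rw [e3, e2]
      calc _ < P * D := hcount
        _ ≤ (2 * ∑ i : Fin ℓ, Ji i) * D := Nat.mul_le_mul_right _ e6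
        _ = _ := by ring
    omega
  let ee : ι → K → ℕ := fun x c => stpB ℓ a x.1.1 c * M
  let LL : ι → ℕ → E[X] := fun x s =>
    C (ζ ^ (x.1.1 : ℕ)) * (stpT S z (ee x) x.2).coeff s * X ^ (x.1.2 : ℕ)
  obtain ⟨u, hu0, hu⟩ := stp_lin hcard (fun x y => (LL x y.1).coeff y.2)
  have hJi : ∀ x : ι, (x.1.2 : ℕ) < J := fun x => lt_of_lt_of_le x.1.2.2 (Nat.sub_le _ _)
  have hL : ∀ s < m, ∑ x, C (u x) * LL x s = 0 := by
    intro s hs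
    ext r
    simp only [finsetSum_coeff, coeff_C_mul, coeff_zero]
    by_cases hr : r < M + s * (k - 1)
    · exact hu ⟨⟨s, hs⟩, ⟨r, hr⟩⟩
    · apply Finset.sum_eq_zero
      intro x _
      rw [coeff_eq_zero_of_natDegree_lt, mul_zero]
      have h1 := stpT_W S ⟨c0, hc0⟩ z (ee x) x.2 s
      have h2 : (LL x s).natDegree ≤ (x.2 + s * (k - 1)) + x.1.2 := by
        refine natDegree_mul_le.trans (Nat.add_le_add ?_ (by simp))
        refine natDegree_mul_le.trans ?_
        simpa using h1
      have h3 := hJi x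
      have h4 := x.2.2
      omega
  let g : ι → E[X] := fun x =>
    (X ^ (x.2 : ℕ) * ∏ c ∈ S, (X + C (z c)) ^ (ee x c)) * (X ^ N) ^ (x.1.2 : ℕ)
  let R := ∑ x, C (u x) * g x
  have hR : R ≠ 0 := by
    have := stp_indep (E := E)
      (fun x : ι => (x.2 : ℕ) + ee x c0 + N * x.1.2)
      (by
        rintro ⟨⟨i, j⟩, t⟩ ⟨⟨i', j'⟩, t'⟩ h
        have hj := hJi ⟨⟨i, j⟩, t⟩
        have hj' := hJi ⟨⟨i', j'⟩, t'⟩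
        have ht := t.2
        have ht' := t'.2
        simp only [ee] at h hj hj'
        have key : ∀ (b t j : ℕ), t + b * M + N * j = (t + j) + M * (ℓ * j + b) := by
          intro b t j; rw [hNM]; ring
        rw [key, key] at h
        have hMpos : 0 < M := by omega
        have q1 := congrArg (· % M) h
        simp only [Nat.add_mul_mod_self_left] at q1
        rw [Nat.mod_eq_of_lt (by omega), Nat.mod_eq_of_lt (by omega)] at q1
        have q2 : ℓ * (j : ℕ) + stpB ℓ a i c0 = ℓ * (j' : ℕ) + stpB ℓ a i' c0 :=
          Nat.eq_of_mul_eq_mul_left hMpos (by omega)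
        have q3 := congrArg (· % ℓ) q2
        have lt1 : stpB ℓ a i c0 < ℓ := Nat.mod_lt _ hl
        have lt2 : stpB ℓ a i' c0 < ℓ := Nat.mod_lt _ hl
        simp only [Nat.mul_add_mod, Nat.mod_eq_of_lt lt1, Nat.mod_eq_of_lt lt2] at q3
        have q4 : i = i' := Fin.ext (stpB_inj hℓ a c0 (ha c0 hc0) i.2 i'.2 q3)
        subst q4
        have q5 : (j : ℕ) = j' := Nat.eq_of_mul_eq_mul_left hl (by omega)
        have q6 : j = j' := Fin.ext q5
        subst q6
        have q7 : t = t' := Fin.ext (by omega)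
        subst q7
        rfl)
      (fun x : ι => ∏ c ∈ S.erase c0, (X + C (z c)) ^ (ee x c))
      (by
        intro x
        rw [coeff_zero_eq_eval_zero, eval_prod, Finset.prod_ne_zero_iff]
        intro c hc
        have := hz c (Finset.mem_of_mem_erase hc) (Finset.ne_of_mem_erase hc)
        simp [this])
      u hu0
    intro hR0
    apply this
    rw [← hR0]
    apply Finset.sum_congr rfl
    intro x _
    congr 1
    simp only [g]
    rw [← Finset.mul_prod_erase S _ hc0, hz0]
    simp only [map_zero, add_zero, pow_add, pow_mul]
    ring
  have hdeg : R.natDegree < N * J := by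
    have hJ : 0 < J := by omega
    have hN0 : 0 < N := by omega
    have : R.natDegree ≤ N * J - 1 := by
      apply natDegree_sum_le_of_forall_le
      intro x _
      have h0 : (C (u x) * g x).natDegree ≤ (g x).natDegree := natDegree_C_mul_le _ _
      refine h0.trans ?_
      have h1 : (g x).natDegree ≤ x.2 + (∑ c ∈ S, stpB ℓ a x.1.1 c) * M + x.1.2 * N := by
        simp only [g]
        refine natDegree_mul_le.trans (Nat.add_le_add ?_ (by simp [← pow_mul, mul_comm]))
        refine natDegree_mul_le.trans (Nat.add_le_add (by simp) ?_)
        rw [Finset.sum_mul, natDegree_prod_of_monic _ _ (fun c _ => (monic_X_add_C _).pow _)]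
        apply Finset.sum_le_sum
        intro c _
        simp [ee]
      refine h1.trans ?_
      have h2 := x.2.2
      have h3 : (x.1.2 : ℕ) + (∑ c ∈ S, stpB ℓ a x.1.1 c) / ℓ + 1 ≤ J := by
        have h4 : (x.1.2 : ℕ) < J - (∑ c ∈ S, stpB ℓ a x.1.1 c) / ℓ := x.1.2.2
        omega
      have h5 := Nat.div_add_mod (∑ c ∈ S, stpB ℓ a x.1.1 c) ℓ
      have h6 := Nat.mod_lt (∑ c ∈ S, stpB ℓ a x.1.1 c) hl
      generalize (∑ c ∈ S, stpB ℓ a x.1.1 c) / ℓ = d at *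
      generalize (∑ c ∈ S, stpB ℓ a x.1.1 c) % ℓ = r at *
      rw [← h5]
      have h7 : N * ((x.1.2 : ℕ) + d + 1) ≤ N * J := Nat.mul_le_mul_left _ h3
      have h8 : (r + 1) * M ≤ ℓ * M := Nat.mul_le_mul_right _ h6
      have h9 : N * d = ℓ * M * d + d := by rw [hNM]; ring
      have h10 : (ℓ * d + r) * M = ℓ * M * d + r * M := by ring
      have h11 : (r + 1) * M = r * M + M := by ring
      have h12 : N * ((x.1.2 : ℕ) + d + 1) = x.1.2 * N + N * d + N := by ring
      rw [h10]
      omega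
    have : 0 < N * J := Nat.mul_pos hN0 hJ
    omega
  refine lt_of_le_of_lt (stp_mult R hR A m ?_) hdeg
  intro α hα
  obtain ⟨hα1, hα2⟩ := hA α hα
  have hρ : (∏ c ∈ S, (α + z c)) ≠ 0 := Finset.prod_ne_zero_iff.2 hα1
  apply stp_dvd R α _ hρ
  intro s hs
  have hterm : ∀ x : ι, ((g x).comp (C α + C (∏ c ∈ S, (α + z c)) * X)).coeff s =
      eval α (LL x s) := by
    intro x
    simp only [g]
    rw [mul_comp, stpT_eval, pow_comp, pow_comp, X_comp]
    have hfrob : (C α + C (∏ c ∈ S, (α + z c)) * X) ^ N =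
        C α + C (∏ c ∈ S, (α + z c)) * X ^ N := by
      obtain ⟨p, hp⟩ := CharP.exists E
      obtain ⟨n, hpp, hn⟩ := FiniteField.card E p
      have := Fact.mk hpp
      have hx : ∀ y : E, y ^ N = y := fun y => hN ▸ FiniteField.pow_card y
      have hNp : N = p ^ (n : ℕ) := by rw [← hN, hn]
      have : (C α + C (∏ c ∈ S, (α + z c)) * X) ^ N =
        (C α) ^ N + (C (∏ c ∈ S, (α + z c)) * X) ^ N := by
        rw [hNp]; exact add_pow_char_pow _ _ _ _
      rw [this, mul_pow, ← C_pow, ← C_pow, hx, hx]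
    rw [hfrob]
    have hpow : ∃ V : E[X], (C α + C (∏ c ∈ S, (α + z c)) * X ^ N) ^ (x.1.2 : ℕ) =
        C (α ^ (x.1.2 : ℕ)) + X ^ N * V := by
      have : X ^ N ∣ (C α + C (∏ c ∈ S, (α + z c)) * X ^ N) ^ (x.1.2 : ℕ) -
          (C α) ^ (x.1.2 : ℕ) := by
        refine dvd_trans ?_ (sub_dvd_pow_sub_pow _ _ _)
        exact ⟨C (∏ c ∈ S, (α + z c)), by ring⟩
      obtain ⟨V, hV⟩ := this
      exact ⟨V, by rw [← hV, C_pow]; ring⟩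
    obtain ⟨V, hV⟩ := hpow
    rw [hV, mul_add, mul_left_comm, coeff_add, coeff_X_pow_mul', if_neg (by omega), add_zero,
      coeff_mul_C, coeff_C_mul, coeff_map]
    simp only [LL, eval_mul, eval_C, eval_pow, eval_X, coe_evalRingHom]
    congr 2
    rw [← hα2, ← pow_mul, ← Finset.prod_pow]
    apply Finset.prod_congr rfl
    intro c hc
    have h1 : (α + z c) ^ (ℓ * M) = 1 := by
      have := FiniteField.pow_card_sub_one_eq_one (α + z c) (hα1 c hc)
      rwa [hN, hNM, Nat.add_sub_cancel] at this
    simp only [ee, stpB]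
    conv_rhs => rw [← pow_mul, show a c * (M * (x.1.1 : ℕ)) = ((x.1.1 : ℕ) * a c) * M by ring,
      ← Nat.div_add_mod ((x.1.1 : ℕ) * a c) ℓ, add_mul, pow_add,
      show ∀ w, ℓ * w * M = ℓ * M * w by intro w; ring, pow_mul, h1, one_pow, one_mul]
  have hsum : (R.comp (C α + C (∏ c ∈ S, (α + z c)) * X)).coeff s =
      eval α (∑ x, C (u x) * LL x s) := by
    simp only [R, Polynomial.sum_comp, finsetSum_coeff, eval_finsetSum, mul_comp, C_comp, coeff_C_mul,
      hterm, eval_mul, eval_C]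
  rw [hsum, hL s hs, eval_zero]

theorem stp_num (k l m s : ℝ) (hk : 1 ≤ k) (hl : 2 ≤ l) (h1 : k * l ^ 3 ≤ s) (h2 : 48 ≤ s)
    (h3 : s ≤ m) (h4 : m < s + l) :
    2 * m * (m + l * k) + l * (k - 1) * (m * (m - 1)) <
      k * (l + 1) * (s ^ 2 - 1 - m - l * k) := by
  have hl3 : l ^ 3 ≤ s := le_trans (by nlinarith [pow_pos (by linarith : 0 < l) 3]) h1
  have hkl2 : 2 * (k * l ^ 2) ≤ s := by
    refine le_trans ?_ h1
    have : 0 ≤ k * l ^ 2 := by positivity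
    nlinarith
  have hm2 : m ^ 2 ≤ s ^ 2 + 2 * l * s + l ^ 2 := by nlinarith
  have hc : 0 ≤ 2 + l * (k - 1) := by nlinarith
  have e1 : 2 * m * (m + l * k) + l * (k - 1) * (m * (m - 1)) + k * (l + 1) * m =
      (2 + l * (k - 1)) * m ^ 2 + (l * k + l + k * (l + 1)) * m := by ring
  have e2 : (2 + l * (k - 1)) * m ^ 2 ≤ (2 + l * (k - 1)) * (s ^ 2 + 2 * l * s + l ^ 2) :=
    mul_le_mul_of_nonneg_left hm2 hc
  have e3 : (l * k + l + k * (l + 1)) * m ≤ (l * k + l + k * (l + 1)) * (s + l) :=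
    mul_le_mul_of_nonneg_left h4.le (by positivity)
  -- constants
  have c1 : k * (l + 1) ^ 2 ≤ 9 / 8 * s := by
    have : (l + 1) ^ 2 ≤ 9 / 4 * l ^ 2 := by nlinarith
    have := mul_le_mul_of_nonneg_left this (by linarith : 0 ≤ k)
    nlinarith
  have c2 : l * (l + 1) * k ^ 2 ≤ 3 / 4 * (k * s) := by
    have h5 : l * (l + 1) ≤ 3 / 2 * l ^ 2 := by nlinarith
    have h6 := mul_le_mul_of_nonneg_right h5 (by positivity : 0 ≤ k ^ 2)
    have h7 := mul_le_mul_of_nonneg_left hkl2 (by linarith : 0 ≤ k)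
    nlinarith
  have c3 : 3 * l ^ 2 + l ^ 2 * k ≤ 2 * s := by
    have : l ^ 2 ≤ k * l ^ 2 := by nlinarith [sq_nonneg l]
    nlinarith
  have hl0 : 0 ≤ l ^ 3 := by positivity
  have c0 : k * (l + 1) * (1 + l * k) + (2 + l * (k - 1)) * l ^ 2 +
      (l * k + l + k * (l + 1)) * l ≤ (5 + k) * s := by
    have : k * (l + 1) * (1 + l * k) + (2 + l * (k - 1)) * l ^ 2 +
      (l * k + l + k * (l + 1)) * l = k * (l + 1) ^ 2 + l * (l + 1) * k ^ 2 +
        (3 * l ^ 2 + l ^ 2 * k) + k * l ^ 3 - l ^ 3 := by ring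
    rw [this]
    have : 0 ≤ k * s := by nlinarith
    nlinarith
  have d1 : 2 * l ^ 2 + 2 * l + 2 ≤ s := by
    by_cases h : l ≤ 4
    · nlinarith
    · push Not at h; nlinarith [mul_pos (by linarith : 0 < l) (by linarith : 0 < l)]
  have d2 : (2 + l * (k - 1)) * (2 * l) + (l * k + l + k * (l + 1)) + (5 + k) <
      (k + l - 2) * s := by
    have : 0 ≤ (k - 1) * (s - (2 * l ^ 2 + 2 * l + 2)) := mul_nonneg (by linarith) (by linarith)
    have : 48 * (l - 1) ≤ (l - 1) * s := by nlinarith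
    nlinarith
  have d3 := mul_lt_mul_of_pos_right d2 (by linarith : 0 < s)
  nlinarith

theorem stp_bound {E K : Type*} [Field E] [Fintype E] [DecidableEq K]
    (ℓ M N : ℕ) (hℓ : ℓ.Prime) (hN : Fintype.card E = N) (hNM : N = ℓ * M + 1)
    (S : Finset K) (z : K → E) (c0 : K) (hc0 : c0 ∈ S)
    (hz0 : z c0 = 0) (hz : ∀ c ∈ S, c ≠ c0 → z c ≠ 0) (a : K → ℕ) (ha : ∀ c ∈ S, ¬ ℓ ∣ a c)
    (ζ : E) (A : Finset E)
    (hA : ∀ α ∈ A, (∀ c ∈ S, α + z c ≠ 0) ∧ (∏ c ∈ S, (α + z c) ^ (a c)) ^ M = ζ)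
    (s : ℝ) (hs : s ^ 2 = N) (hs48 : 48 ≤ s) (hsk : (S.card : ℝ) * (ℓ : ℝ) ^ 3 ≤ s) :
    (A.card : ℝ) ≤ N / ℓ + S.card * s := by
  set k := S.card with hk
  have hk0 : 1 ≤ k := Finset.card_pos.2 ⟨c0, hc0⟩
  have hkr : (1 : ℝ) ≤ k := by exact_mod_cast hk0
  have hl2 : (2 : ℝ) ≤ ℓ := by exact_mod_cast hℓ.two_le
  have hl0 : (0 : ℝ) < ℓ := by linarith
  set μ := ⌈s / ℓ⌉₊ with hμ
  have hμ1 : s ≤ ((ℓ * μ : ℕ) : ℝ) := by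
    have := Nat.le_ceil (s / ℓ)
    rw [div_le_iff₀ hl0] at this
    push_cast; rw [← hμ] at this; linarith
  have hμ2 : ((ℓ * μ : ℕ) : ℝ) < s + ℓ := by
    have := Nat.ceil_lt_add_one (by positivity : 0 ≤ s / ℓ)
    rw [← hμ] at this
    have h := mul_lt_mul_of_pos_left this hl0
    rw [mul_add, mul_div_cancel₀ _ hl0.ne'] at h
    push_cast; linarith
  have hnum := stp_num k ℓ ((ℓ * μ : ℕ) : ℝ) s hkr hl2 hsk hs48 hμ1 hμ2
  have hNMr : (N : ℝ) = ℓ * M + 1 := by exact_mod_cast hNM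
  have hm1 : (1 : ℝ) ≤ ((ℓ * μ : ℕ) : ℝ) := by linarith
  have hpos : 0 < s ^ 2 - 1 - ((ℓ * μ : ℕ) : ℝ) - ℓ * k := by
    by_contra hcon
    push Not at hcon
    have h1 : (k : ℝ) * (ℓ + 1) * (s ^ 2 - 1 - ((ℓ * μ : ℕ) : ℝ) - ℓ * k) ≤ 0 :=
      mul_nonpos_of_nonneg_of_nonpos (by positivity) hcon
    have h2 : 0 ≤ 2 * ((ℓ * μ : ℕ) : ℝ) * (((ℓ * μ : ℕ) : ℝ) + ℓ * k) := by positivity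
    have h3 : 0 ≤ (ℓ : ℝ) * (k - 1) * (((ℓ * μ : ℕ) : ℝ) * (((ℓ * μ : ℕ) : ℝ) - 1)) :=
      mul_nonneg (mul_nonneg hl0.le (by linarith)) (mul_nonneg (by linarith) (by linarith))
    linarith
  have hJM : μ + k ≤ M := by
    have : (ℓ : ℝ) * (μ + k) < ℓ * M := by push_cast at hpos; linarith
    have := lt_of_mul_lt_mul_left this hl0.le
    exact_mod_cast this.le
  obtain ⟨D, hD⟩ := Nat.exists_eq_add_of_le hJM
  have hDr : (M : ℝ) = μ + k + D := by exact_mod_cast hD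
  have hcore := stp_core ℓ M (μ + k) (ℓ * μ) D N (2 * (ℓ * μ) + k * (ℓ + 1)) hℓ hN hNM
    (by omega) S z c0 hc0 hz0 hz a ha ζ A hA
    (by
      rw [hNM]
      have : ℓ * μ ≤ ℓ * M := Nat.mul_le_mul_left _ (by omega)
      omega)
    (by omega)
    (by
      have := hℓ.pos
      obtain ⟨l', rfl⟩ : ∃ l', ℓ = l' + 1 := ⟨ℓ - 1, by omega⟩
      rw [← hk, Nat.add_sub_cancel]; ring)
    (by
      rw [← hk]
      have hm1' : 1 ≤ ℓ * μ := by exact_mod_cast hm1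
      have : (((2 * (ℓ * μ) * M + (k - 1) * ((ℓ * μ) * (ℓ * μ - 1)) : ℕ)) : ℝ) <
          (((2 * (ℓ * μ) + k * (ℓ + 1)) * D : ℕ) : ℝ) := by
        push_cast [Nat.cast_sub hk0, Nat.cast_sub hm1']
        push_cast at hnum
        rw [hs, hNMr] at hnum
        apply lt_of_mul_lt_mul_left _ hl0.le
        rw [hDr] at hnum ⊢
        nlinarith
      exact_mod_cast this)
  have hc : (A.card : ℝ) * ((ℓ * μ : ℕ) : ℝ) ≤ N * (μ + k) := by exact_mod_cast hcore.le
  have hm0 : (0 : ℝ) < ((ℓ * μ : ℕ) : ℝ) := by linarith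
  have : (A.card : ℝ) * ((ℓ * μ : ℕ) : ℝ) ≤ (N / ℓ + k * s) * ((ℓ * μ : ℕ) : ℝ) := by
    refine hc.trans ?_
    have e1 : (N : ℝ) / ℓ * ((ℓ * μ : ℕ) : ℝ) = N * μ := by push_cast; field_simp
    rw [add_mul, e1, mul_add]
    have e2 : (k : ℝ) * s * s ≤ k * s * ((ℓ * μ : ℕ) : ℝ) :=
      mul_le_mul_of_nonneg_left hμ1 (by positivity)
    have e3 : (N : ℝ) * k = k * s * s := by rw [← hs]; ring
    linarith
  exact le_of_mul_le_mul_right this hm0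

theorem stp_kernel_card {E K : Type*} [Field E] [Fintype K] [DecidableEq K] [DecidableEq E]
    (ℓ : ℕ) (hℓ : ℓ.Prime) (w : K → E) (hw : ∀ c, w c ^ ℓ = 1) (c0 : K) (hc0 : w c0 ≠ 1) :
    (Finset.univ.filter (fun a : K → Fin ℓ => ∏ c, w c ^ (a c : ℕ) = 1)).card ≤
      ℓ ^ (Fintype.card K - 1) := by
  have hne : ∀ c, w c ≠ 0 := by
    intro c h
    have := hw c
    rw [h, zero_pow hℓ.ne_zero] at this
    exact zero_ne_one this
  have := Fact.mk hℓ
  have hord : orderOf (w c0) = ℓ := orderOf_eq_prime (hw c0) hc0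
  have h1 : Fintype.card ({c : K // c ≠ c0} → Fin ℓ) = ℓ ^ (Fintype.card K - 1) := by
    simp [Fintype.card_subtype_compl]
  rw [← h1, ← Finset.card_univ]
  apply Finset.card_le_card_of_injOn (fun a c => a c.1) (by simp)
  intro a ha b hb hab
  simp only [Finset.coe_filter, Finset.mem_univ, true_and, Set.mem_ofPred_eq] at ha hb
  have hrest : ∀ c, c ≠ c0 → a c = b c := fun c hc => congrFun hab ⟨c, hc⟩
  rw [← Finset.mul_prod_erase _ _ (Finset.mem_univ c0)] at ha hb
  have hp : ∏ c ∈ Finset.univ.erase c0, w c ^ (a c : ℕ) =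
      ∏ c ∈ Finset.univ.erase c0, w c ^ (b c : ℕ) :=
    Finset.prod_congr rfl fun c hc => by rw [hrest c (Finset.ne_of_mem_erase hc)]
  rw [hp, ← hb] at ha
  have hpne : ∏ c ∈ Finset.univ.erase c0, w c ^ (b c : ℕ) ≠ 0 :=
    Finset.prod_ne_zero_iff.2 fun c _ => pow_ne_zero _ (hne c)
  have h2 := mul_right_cancel₀ hpne ha
  have h3 : (a c0 : ℕ) = b c0 :=
    pow_injOn_Iio_orderOf (by simp [hord]) (by simp [hord]) h2
  funext c
  by_cases hc : c = c0
  · subst hc; exact Fin.ext h3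
  · exact hrest c hc

theorem stp_support_sum {K : Type*} [Fintype K] [DecidableEq K] (ℓ : ℕ) (hℓ : 0 < ℓ) :
    ∑ a : K → Fin ℓ, (Finset.univ.filter (fun c => (a c : ℕ) ≠ 0)).card =
      Fintype.card K * ((ℓ - 1) * ℓ ^ (Fintype.card K - 1)) := by
  have h1 : ∀ a : K → Fin ℓ, (Finset.univ.filter (fun c => (a c : ℕ) ≠ 0)).card =
      ∑ c, if (a c : ℕ) ≠ 0 then 1 else 0 := fun a => Finset.card_filter _ _
  simp_rw [h1]
  rw [Finset.sum_comm]
  rw [Finset.sum_congr rfl (g := fun _ => (ℓ - 1) * ℓ ^ (Fintype.card K - 1))]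
  · simp
  intro c _
  rw [← Finset.card_filter]
  have h2 : (Finset.univ.filter (fun a : K → Fin ℓ => (a c : ℕ) ≠ 0)) =
      Fintype.piFinset (fun d => if d = c then Finset.univ.filter (fun x : Fin ℓ => (x : ℕ) ≠ 0)
        else Finset.univ) := by
    ext a
    simp only [Finset.mem_filter, Finset.mem_univ, true_and, Fintype.mem_piFinset]
    constructor
    · intro h d
      by_cases hd : d = c
      · subst hd; simpa using h
      · simp [hd]
    · intro h
      simpa using h c
  rw [h2, Fintype.card_piFinset, ← Finset.mul_prod_erase _ _ (Finset.mem_univ c)]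
  congr 1
  · simp only [if_true]
    obtain ⟨l', rfl⟩ : ∃ l', ℓ = l' + 1 := ⟨ℓ - 1, by omega⟩
    have : (Finset.univ.filter (fun x : Fin (l' + 1) => (x : ℕ) ≠ 0)) = Finset.univ.erase 0 := by
      ext x; simp
    rw [this, Finset.card_erase_of_mem (Finset.mem_univ _)]; simp
  · rw [Finset.prod_congr rfl (g := fun _ => ℓ)]
    · rw [Finset.prod_const, Finset.card_erase_of_mem (Finset.mem_univ _), Finset.card_univ]
    · intro d hd
      simp [Finset.ne_of_mem_erase hd]

theorem stp_lower {F E : Type*} [Field F] [Fintype F] [Field E] [Fintype E] [Algebra F E]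
    [DecidableEq F] [DecidableEq E]
    (ℓ M N : ℕ) (hℓ : ℓ.Prime) (hN : Fintype.card E = N) (hNM : N = ℓ * M + 1)
    (G : Finset E) (hG : ∀ α ∈ G, ∀ c : F, α + algebraMap F E c ≠ 0)
    (s : ℝ) (hs : s ^ 2 = N) (hs48 : 48 ≤ s) (hsk : (Fintype.card F : ℝ) * (ℓ : ℝ) ^ 3 ≤ s)
    (a : F → Fin ℓ) (ha : ∃ c, (a c : ℕ) ≠ 0) :
    (G.card : ℝ) ≤ (G.filter (fun α => ∏ c, ((α + algebraMap F E c) ^ M) ^ (a c : ℕ) = 1)).card +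
      (ℓ - 1) * (N / ℓ + (Finset.univ.filter (fun c => (a c : ℕ) ≠ 0)).card * s) := by
  have hpw : ∀ y : E, y ≠ 0 → y ^ (M * ℓ) = 1 := by
    intro y hy
    have := FiniteField.pow_card_sub_one_eq_one y hy
    rwa [hN, hNM, Nat.add_sub_cancel, mul_comm] at this
  set φ : E → E := fun α => ∏ c, ((α + algebraMap F E c) ^ M) ^ (a c : ℕ) with hφ
  set S := Finset.univ.filter (fun c => (a c : ℕ) ≠ 0) with hS
  have hmaps : ∀ α ∈ G, φ α ∈ (nthRoots ℓ (1 : E)).toFinset := by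
    intro α hα
    rw [Multiset.mem_toFinset, mem_nthRoots hℓ.pos]
    simp only [hφ]
    rw [← Finset.prod_pow]
    apply Finset.prod_eq_one
    intro c _
    rw [← pow_mul, mul_comm, pow_mul, ← pow_mul _ M ℓ, hpw _ (hG α hα c), one_pow]
  have hfib := Finset.card_eq_sum_card_fiberwise hmaps
  have hcls : ∀ ζ : E, ((G.filter (fun α => φ α = ζ)).card : ℝ) ≤ N / ℓ + S.card * s := by
    intro ζ
    obtain ⟨c0, hc0⟩ := ha
    have := stp_bound (E := E) ℓ M N hℓ hN hNM S (fun c => algebraMap F E (c - c0)) c0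
      (by simp [hS, hc0]) (by simp)
      (by intro c _ hc; simpa [sub_eq_zero] using hc)
      (fun c => (a c : ℕ))
      (by
        intro c hc h
        simp only [hS, Finset.mem_filter, Finset.mem_univ, true_and] at hc
        exact hc (Nat.eq_zero_of_dvd_of_lt h (a c).2))
      ζ ((G.filter (fun α => φ α = ζ)).image (fun α => α + algebraMap F E c0))
      (by
        intro β hβ
        simp only [Finset.mem_image, Finset.mem_filter] at hβ
        obtain ⟨α, ⟨hα, hαζ⟩, rfl⟩ := hβ
        have e : ∀ c, α + algebraMap F E c0 + algebraMap F E (c - c0) = α + algebraMap F E c := by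
          intro c; rw [map_sub]; ring
        simp only [e]
        refine ⟨fun c _ => hG α hα c, ?_⟩
        rw [← hαζ, ← Finset.prod_pow]
        simp only [hφ]
        rw [hS, Finset.prod_filter]
        apply Finset.prod_congr rfl
        intro c _
        split_ifs with h
        · rw [← pow_mul, ← pow_mul, mul_comm]
        · push Not at h; rw [h, pow_zero])
      s hs hs48
      (le_trans (by
        gcongr
        rw [← Finset.card_univ]
        exact Finset.card_le_card (Finset.subset_univ _)) hsk)
    rwa [Finset.card_image_of_injective _ (add_left_injective _)] at this
  have h1mem : (1 : E) ∈ (nthRoots ℓ (1 : E)).toFinset := by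
    rw [Multiset.mem_toFinset, mem_nthRoots hℓ.pos]; simp
  rw [← Finset.add_sum_erase _ _ h1mem] at hfib
  have hfibr : (G.card : ℝ) = (G.filter (fun α => φ α = 1)).card +
      ∑ ζ ∈ ((nthRoots ℓ (1 : E)).toFinset).erase 1, ((G.filter (fun α => φ α = ζ)).card : ℝ) := by
    exact_mod_cast hfib
  rw [hfibr]
  gcongr
  have hcard : (((nthRoots ℓ (1 : E)).toFinset).erase 1).card ≤ ℓ - 1 := by
    rw [Finset.card_erase_of_mem h1mem]
    have : ((nthRoots ℓ (1 : E)).toFinset).card ≤ ℓ := by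
      exact (Multiset.toFinset_card_le _).trans (card_nthRoots ℓ 1)
    omega
  have hcardr : ((((nthRoots ℓ (1 : E)).toFinset).erase 1).card : ℝ) ≤ ℓ - 1 := by
    have h : ((((nthRoots ℓ (1 : E)).toFinset).erase 1).card : ℝ) ≤ ((ℓ - 1 : ℕ) : ℝ) := by
      exact_mod_cast hcard
    rwa [Nat.cast_sub hℓ.one_le, Nat.cast_one] at h
  calc _ ≤ ∑ ζ ∈ ((nthRoots ℓ (1 : E)).toFinset).erase 1, ((N : ℝ) / ℓ + S.card * s) :=
        Finset.sum_le_sum fun ζ _ => hcls ζ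
    _ = (((nthRoots ℓ (1 : E)).toFinset).erase 1).card * ((N : ℝ) / ℓ + S.card * s) := by
        rw [Finset.sum_const, nsmul_eq_mul]
    _ ≤ _ := mul_le_mul_of_nonneg_right hcardr (by positivity)

theorem stp_total {F E : Type*} [Field F] [Fintype F] [Field E] [Fintype E] [Algebra F E]
    [DecidableEq F] [DecidableEq E]
    (q ℓ M N : ℕ) (hℓ : ℓ.Prime) (hF : Fintype.card F = q)
    (hN : Fintype.card E = N) (hNM : N = ℓ * M + 1)
    (G : Finset E) (hG : ∀ α ∈ G, ∀ c : F, α + algebraMap F E c ≠ 0) (hGc : G.card + q = N)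
    (s : ℝ) (hs : s ^ 2 = N) (hs48 : 48 ≤ s) (hsk : (q : ℝ) * (ℓ : ℝ) ^ 3 ≤ s)
    (hsq : (q : ℝ) * (ℓ : ℝ) ^ (q + 1) ≤ s) :
    (q : ℝ) * s - q ≤
      (G.filter (fun α => ∀ c : F, (α + algebraMap F E c) ^ M = 1)).card := by
  have hq0 : 0 < q := hF ▸ Fintype.card_pos
  have hpw : ∀ y : E, y ≠ 0 → (y ^ M) ^ ℓ = 1 := by
    intro y hy
    have := FiniteField.pow_card_sub_one_eq_one y hy
    rwa [hN, hNM, Nat.add_sub_cancel, mul_comm, pow_mul] at this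
  set T := (G.filter (fun α => ∀ c : F, (α + algebraMap F E c) ^ M = 1)).card with hT
  set L : ℕ := ℓ ^ (q - 1) with hL
  have hLq : ℓ ^ q = ℓ * L := by
    rw [hL, ← pow_succ']; congr 1; omega
  let cnt : (F → Fin ℓ) → ℕ := fun a =>
    (G.filter (fun α => ∏ c, ((α + algebraMap F E c) ^ M) ^ (a c : ℕ) = 1)).card
  let kk : (F → Fin ℓ) → ℕ := fun a => (Finset.univ.filter (fun c => (a c : ℕ) ≠ 0)).card
  have hl2 : (2 : ℝ) ≤ ℓ := by exact_mod_cast hℓ.two_le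
  -- upper bound
  have hup : ∑ a, cnt a ≤ ∑ α ∈ G, (L + if (∀ c : F, (α + algebraMap F E c) ^ M = 1)
      then (ℓ * L - L) else 0) := by
    simp only [cnt, Finset.card_filter]
    rw [Finset.sum_comm]
    apply Finset.sum_le_sum
    intro α hα
    rw [← Finset.card_filter]
    split_ifs with h
    · calc _ ≤ (Finset.univ : Finset (F → Fin ℓ)).card := Finset.card_filter_le _ _
        _ = ℓ * L := by simp [hF, hLq]
        _ = _ := by
          have : L ≤ ℓ * L := Nat.le_mul_of_pos_left _ hℓ.pos
          omega
    · push Not at h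
      obtain ⟨c0, hc0⟩ := h
      have := stp_kernel_card ℓ hℓ (fun c => (α + algebraMap F E c) ^ M)
        (fun c => hpw _ (hG α hα c)) c0 hc0
      rw [hF] at this
      simpa using this
  have hup2 : (∑ a, (cnt a : ℝ)) ≤ L * G.card + (ℓ - 1) * L * T := by
    have e : ∑ α ∈ G, (L + if (∀ c : F, (α + algebraMap F E c) ^ M = 1)
      then (ℓ * L - L) else 0) = G.card * L + T * (ℓ * L - L) := by
      rw [Finset.sum_add_distrib, ← Finset.sum_filter]
      simp [hT]
    rw [e] at hup
    have h2 : ((∑ a, cnt a : ℕ) : ℝ) ≤ ((G.card * L + T * (ℓ * L - L) : ℕ) : ℝ) := by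
      exact_mod_cast hup
    have : L ≤ ℓ * L := Nat.le_mul_of_pos_left _ hℓ.pos
    push_cast [Nat.cast_sub this] at h2
    linarith
  -- lower bound
  have hlow : ∀ a : F → Fin ℓ, (G.card : ℝ) ≤ cnt a + (ℓ - 1) * (N / ℓ + kk a * s) -
      (if a = (fun _ => ⟨0, hℓ.pos⟩) then ((ℓ : ℝ) - 1) * (N / ℓ) else 0) := by
    intro a
    split_ifs with h
    · have h1 : cnt a = G.card := by
        simp only [cnt]
        rw [Finset.filter_true_of_mem]
        intro α _
        simp [h]
      have h2 : 0 ≤ ((ℓ : ℝ) - 1) * (kk a * s) :=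
        mul_nonneg (by linarith) (by positivity)
      rw [h1]; linarith
    · have ha : ∃ c, (a c : ℕ) ≠ 0 := by
        by_contra hcon
        push Not at hcon
        exact h (funext fun c => Fin.ext (hcon c))
      have := stp_lower ℓ M N hℓ hN hNM G hG s hs hs48 (by rw [hF]; exact hsk) a ha
      simp only [cnt, kk, sub_zero]
      exact this
  have hsum := Finset.sum_le_sum (s := Finset.univ) fun a _ => hlow a
  simp only [Finset.sum_sub_distrib, Finset.sum_add_distrib, ← Finset.mul_sum,
    ← Finset.sum_mul, Finset.sum_ite_eq', Finset.sum_const, Finset.card_univ,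
    Finset.mem_univ, if_true, nsmul_eq_mul] at hsum
  have hcardA : (Fintype.card (F → Fin ℓ) : ℝ) = ℓ * L := by
    have : Fintype.card (F → Fin ℓ) = ℓ * L := by simp [hF, hLq]
    exact_mod_cast this
  have hkk : (∑ a, (kk a : ℝ)) = q * ((ℓ - 1) * L) := by
    have h := stp_support_sum (K := F) ℓ hℓ.pos
    rw [hF] at h
    have h2 : ((∑ a, kk a : ℕ) : ℝ) = ((q * ((ℓ - 1) * L) : ℕ) : ℝ) := by exact_mod_cast h
    push_cast [Nat.cast_sub hℓ.one_le] at h2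
    exact h2
  rw [hcardA, hkk] at hsum
  have hGr : (G.card : ℝ) = N - q := by
    have : (G.card : ℝ) + q = N := by exact_mod_cast hGc
    linarith
  rw [hGr] at hsum hup2
  set x : ℝ := (N : ℝ) / ℓ with hx
  have hNx : (N : ℝ) = ℓ * x := by rw [hx]; field_simp
  have hL0 : (0 : ℝ) < L := by
    have : 0 < L := pow_pos hℓ.pos _
    exact_mod_cast this
  have key : ((ℓ : ℝ) - 1) * x ≤ (ℓ - 1) * (L * (T + q + (ℓ - 1) * q * s)) := by
    rw [hNx] at hsum hup2
    nlinarith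
  have key2 := le_of_mul_le_mul_left key (by linarith)
  have hs2 : (q : ℝ) * (ℓ ^ 2 * L) ≤ s := by
    have : (ℓ : ℝ) ^ (q + 1) = ℓ ^ 2 * L := by
      have h : ℓ ^ (q + 1) = ℓ ^ 2 * L := by rw [pow_succ, hLq]; ring
      exact_mod_cast h
    rwa [this] at hsq
  have hxs : L * (q * ℓ * s) ≤ x := by
    have h1 : (q : ℝ) * (ℓ ^ 2 * L) * s ≤ s * s :=
      mul_le_mul_of_nonneg_right hs2 (by linarith)
    have h2 : s * s = ℓ * x := by rw [← hNx, ← hs]; ring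
    apply le_of_mul_le_mul_left _ (by linarith : (0 : ℝ) < ℓ)
    rw [← h2]; linarith
  have key3 := le_of_mul_le_mul_left (hxs.trans key2) hL0
  linarith

theorem stp_bad {F E : Type*} [Field F] [Fintype F] [Field E] [Fintype E] [Algebra F E]
    [DecidableEq E] (q n : ℕ) (hF : Fintype.card F = q) (hE : Fintype.card E = q ^ n)
    (hn : 2 < n) (B : Finset E)
    (hB : ∀ α ∈ B, α ∉ Set.range (algebraMap F E) ∧ (minpoly F α).natDegree ≠ n) :
    B.card + q < q * q ^ (n / 2) := by
  have hq : 1 < q := hF ▸ Fintype.one_lt_card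
  have hfr : Module.finrank F E = n := by
    have h := Module.card_eq_pow_finrank (K := F) (V := E)
    rw [hF, hE] at h
    exact (Nat.pow_right_injective hq h).symm
  have hsub : B ⊆ (Finset.Icc 2 (n / 2)).biUnion
      (fun d => (X ^ (q ^ d) - X : E[X]).roots.toFinset) := by
    intro α hα
    obtain ⟨h1, h2⟩ := hB α hα
    have hint : IsIntegral F α := IsIntegral.of_finite F α
    set d := (minpoly F α).natDegree with hd
    have hdvd : d ∣ n := by rw [← hfr]; exact minpoly.degree_dvd hint
    have hd0 : 0 < d := minpoly.natDegree_pos hint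
    have hd1 : d ≠ 1 := by
      intro h
      exact h1 (minpoly.natDegree_eq_one_iff.1 h)
    obtain ⟨r, hr⟩ := hdvd
    have hr2 : 2 ≤ r := by
      by_contra hcon
      have : r = 0 ∨ r = 1 := by omega
      rcases this with rfl | rfl <;> omega
    have hdn : d ≤ n / 2 := by
      rw [Nat.le_div_iff_mul_le (by norm_num), hr]
      exact Nat.mul_le_mul_left _ hr2
    simp only [Finset.mem_biUnion, Finset.mem_Icc]
    refine ⟨d, ⟨by omega, hdn⟩, ?_⟩
    have hqd : 1 < q ^ d := Nat.one_lt_pow hd0.ne' hq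
    rw [Multiset.mem_toFinset, mem_roots (FiniteField.X_pow_card_sub_X_ne_zero E hqd)]
    simp only [IsRoot.def, eval_sub, eval_pow, eval_X, sub_eq_zero]
    let _ : Fintype (IntermediateField.adjoin F {α}) := Fintype.ofFinite _
    have hc : Fintype.card (IntermediateField.adjoin F {α}) = q ^ d := by
      rw [Module.card_eq_pow_finrank (K := F), hF, IntermediateField.adjoin.finrank hint]
    have := FiniteField.pow_card (IntermediateField.AdjoinSimple.gen F α)
    rw [hc] at this
    simpa using congrArg (algebraMap _ E) this
  have h1 : B.card ≤ ∑ d ∈ Finset.Icc 2 (n / 2), q ^ d := by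
    refine (Finset.card_le_card hsub).trans (Finset.card_biUnion_le.trans ?_)
    apply Finset.sum_le_sum
    intro d hd
    have hd := Finset.mem_Icc.1 hd
    have hqd : 1 < q ^ d := Nat.one_lt_pow (by omega) hq
    calc _ ≤ (X ^ (q ^ d) - X : E[X]).roots.card := Multiset.toFinset_card_le _
      _ ≤ _ := card_roots' _
      _ = _ := FiniteField.X_pow_card_sub_X_natDegree_eq E hqd
  have h2 : ∑ d ∈ Finset.range (n / 2 + 1), q ^ d < q ^ (n / 2 + 1) :=
    Nat.geomSum_lt hq (by intro k hk; simpa using hk)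
  have h3 : ∑ d ∈ Finset.Icc 2 (n / 2), q ^ d + q ≤ ∑ d ∈ Finset.range (n / 2 + 1), q ^ d := by
    have : insert 1 (Finset.Icc 2 (n / 2)) ⊆ Finset.range (n / 2 + 1) := by
      intro d hd
      simp at hd ⊢
      omega
    have h := Finset.sum_le_sum_of_subset (f := fun d => q ^ d) this
    rw [Finset.sum_insert (by simp)] at h
    simp at h ⊢
    omega
  rw [pow_succ'] at h2
  omega

theorem stp_size (q n ℓ ℓ₀ : ℕ) (hq : 1 < q) (hℓ : 1 ≤ ℓ) (hle : ℓ ≤ ℓ₀)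
    (hcond : 2 + 2 * ((q : ℝ) + 1) * (Real.log ℓ₀ / Real.log q) ≤ (n : ℝ)) :
    (q : ℝ) * (ℓ : ℝ) ^ (q + 1) ≤ Real.sqrt ((q ^ n : ℕ) : ℝ) := by
  apply Real.le_sqrt_of_sq_le
  have hlq : 0 < Real.log q := Real.log_pos (by exact_mod_cast hq)
  have hq0 : (0 : ℝ) < q := by positivity
  have hl0 : (0 : ℝ) < ℓ := by positivity
  have hlog : Real.log ℓ ≤ Real.log ℓ₀ := Real.log_le_log hl0 (by exact_mod_cast hle)
  push_cast
  rw [← Real.log_le_log_iff (by positivity) (by positivity), Real.log_pow, Real.log_pow,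
    Real.log_mul hq0.ne' (by positivity), Real.log_pow]
  have h1 := mul_le_mul_of_nonneg_right hcond hlq.le
  have h2 : (2 + 2 * ((q : ℝ) + 1) * (Real.log ℓ₀ / Real.log q)) * Real.log q =
      2 * Real.log q + 2 * (q + 1) * Real.log ℓ₀ := by field_simp
  rw [h2] at h1
  have h3 : 2 * ((q : ℝ) + 1) * Real.log ℓ ≤ 2 * (q + 1) * Real.log ℓ₀ :=
    mul_le_mul_of_nonneg_left hlog (by positivity)
  push_cast
  linarith

/-- If `ℓ > 1` divides `q^n - 1` and `n ≥ 2 + 2(q+1) log_q ℓ`, then there is a degree-`n`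
element `α` such that the subgroup of `𝔽_{q^n}^×` generated by `{α + c : c ∈ 𝔽_q}` is proper,
i.e. Chung's graph `G_1(n,q,α)` is not connected. -/
theorem exists_alpha_line_graph_not_connected
    {F E : Type*} [Field F] [Fintype F] [Field E] [Fintype E] [Algebra F E]
    (q n ℓ : ℕ) (hq : IsPrimePow q)
    (hcardF : Fintype.card F = q) (hcardE : Fintype.card E = q ^ n)
    (hn : 2 < n) (hℓ : 1 < ℓ) (hdvd : ℓ ∣ q ^ n - 1)
    (hcond : 2 + 2 * ((q : ℝ) + 1) * (Real.log ℓ / Real.log q) ≤ (n : ℝ)) :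
    ∃ α : E, (minpoly F α).natDegree = n ∧
      Subgroup.closure {u : Eˣ | ∃ c : F, (u : E) = α + algebraMap F E c} ≠ ⊤ := by
  classical
  have hq1 : 1 < q := hq.one_lt
  obtain ⟨l, hl, hlℓ⟩ := Nat.exists_prime_and_dvd (n := ℓ) (by omega)
  have hle : l ≤ ℓ := Nat.le_of_dvd (by omega) hlℓ
  have hsq := stp_size q n l ℓ hq1 hl.one_le hle hcond
  obtain ⟨M, hM⟩ := hlℓ.trans hdvd
  have hNpos : 1 < q ^ n := Nat.one_lt_pow (by omega) hq1
  have hNM : q ^ n = l * M + 1 := by omega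
  set s := Real.sqrt ((q ^ n : ℕ) : ℝ) with hs
  have hs2 : s ^ 2 = ((q ^ n : ℕ) : ℝ) := Real.sq_sqrt (by positivity)
  -- numerical facts
  have hl2 : 2 ≤ l := hl.two_le
  have hnot : ¬ (q = 2 ∧ l = 2) := by
    rintro ⟨rfl, rfl⟩
    have : 2 ∣ 2 ^ n := dvd_pow_self 2 (by omega)
    omega
  have hq3 : q * l ^ 3 ≤ q * l ^ (q + 1) :=
    Nat.mul_le_mul_left _ (Nat.pow_le_pow_right hl.pos (by omega))
  have h48 : 48 ≤ q * l ^ (q + 1) := by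
    by_cases hq2 : q = 2
    · have : 3 ≤ l := by omega
      have : 3 ^ 3 ≤ l ^ 3 := Nat.pow_le_pow_left this 3
      subst hq2
      norm_num at this ⊢
      omega
    · have h1 : 2 ^ 4 ≤ l ^ 4 := Nat.pow_le_pow_left hl2 4
      have h2 : l ^ 4 ≤ l ^ (q + 1) := Nat.pow_le_pow_right hl.pos (by omega)
      calc 48 = 3 * 2 ^ 4 := by norm_num
        _ ≤ q * l ^ (q + 1) := Nat.mul_le_mul (by omega) (h1.trans h2)
  have h48r : (48 : ℝ) ≤ s := le_trans (by exact_mod_cast h48) hsq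
  have hskr : (q : ℝ) * (l : ℝ) ^ 3 ≤ s := le_trans (by exact_mod_cast hq3) hsq
  -- elements outside the base field
  let G : Finset E := (Finset.univ.image (algebraMap F E))ᶜ
  have hGmem : ∀ α ∈ G, α ∉ Set.range (algebraMap F E) := by
    intro α hα
    simpa [G] using hα
  have hGc : G.card + q = q ^ n := by
    have h1 : (Finset.univ.image (algebraMap F E)).card = q := by
      rw [Finset.card_image_of_injective _ (algebraMap F E).injective, Finset.card_univ, hcardF]
    have h2 := Finset.card_compl_add_card (Finset.univ.image (algebraMap F E))
    rw [h1, hcardE] at h2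
    exact h2
  have hG : ∀ α ∈ G, ∀ c : F, α + algebraMap F E c ≠ 0 := by
    intro α hα c h
    exact hGmem α hα ⟨-c, by rw [map_neg]; exact (eq_neg_of_add_eq_zero_left h).symm⟩
  have htot := stp_total (F := F) (E := E) q l M (q ^ n) hl hcardF hcardE hNM G hG hGc s hs2 h48r
    hskr hsq
  set T := G.filter (fun α => ∀ c : F, (α + algebraMap F E c) ^ M = 1) with hT
  have hex : ∃ α ∈ T, (minpoly F α).natDegree = n := by
    by_contra hcon
    push Not at hcon
    have hbad := stp_bad (F := F) q n hcardF hcardE hn T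
      (fun α hα => ⟨hGmem α (Finset.mem_filter.1 hα).1, hcon α hα⟩)
    have hbr : (T.card : ℝ) + q < q * ((q ^ (n / 2) : ℕ) : ℝ) := by exact_mod_cast hbad
    have hsge : ((q ^ (n / 2) : ℕ) : ℝ) ≤ s := by
      apply Real.le_sqrt_of_sq_le
      have : (q ^ (n / 2)) ^ 2 ≤ q ^ n := by
        rw [← pow_mul]
        exact Nat.pow_le_pow_right (by omega) (Nat.div_mul_le_self n 2)
      exact_mod_cast this
    have : (q : ℝ) * ((q ^ (n / 2) : ℕ) : ℝ) ≤ q * s :=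
      mul_le_mul_of_nonneg_left hsge (by positivity)
    linarith
  obtain ⟨α, hα, hdeg⟩ := hex
  refine ⟨α, hdeg, ?_⟩
  intro htop
  have hker : Subgroup.closure {u : Eˣ | ∃ c : F, (u : E) = α + algebraMap F E c} ≤
      (powMonoidHom M : Eˣ →* Eˣ).ker := by
    rw [Subgroup.closure_le]
    rintro u ⟨c, hc⟩
    simp only [SetLike.mem_coe, MonoidHom.mem_ker, powMonoidHom_apply]
    apply Units.ext
    rw [Units.val_pow_eq_pow_val, hc, Units.val_one]
    exact (Finset.mem_filter.1 hα).2 c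
  rw [htop] at hker
  obtain ⟨g, hg⟩ := IsCyclic.exists_generator (α := Eˣ)
  have hgM : g ^ M = 1 := by
    have := hker (Subgroup.mem_top g)
    simpa [MonoidHom.mem_ker] using this
  have hord : orderOf g = l * M := by
    rw [orderOf_eq_card_of_forall_mem_zpowers hg, Nat.card_eq_fintype_card, Fintype.card_units,
      hcardE, hNM, Nat.add_sub_cancel]
  have hMpos : 0 < M := by
    rcases Nat.eq_zero_or_pos M with h | h
    · subst h; omega
    · exact h
  have h1 := Nat.le_of_dvd hMpos (orderOf_dvd_of_pow_eq_one hgM)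
  rw [hord] at h1
  nlinarith
end
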